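/- Let 0<α<1, 1<p<1/α, and q = p/(1−αp). There exists a constant c depending only on p and α such that for every weight w ∈ A_{p,q}^+(ℝ), the Weyl operator W_α satisfies ‖W_α‖_{L^p_{w^p}(ℝ)→L^q_{w^q}(ℝ)} ≤ c ‖w‖_{A_{p,q}^+(ℝ)}^{(1-α)·max{1, p'/q}}. Moreover, this estimate is sharp: the exponent (1−α)max{1,p'/q} cannot be decreased. -/

import Mathlib

open MeasureTheory Set Filter
open scoped ENNReal

noncomputable section

/-- A weight on `ℝ`: an a.e. positive, locally integrable function. -/
def IsWeight (w : ℝ → ℝ) : Prop :=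
  (∀ᵐ x : ℝ, 0 < w x) ∧ MeasureTheory.LocallyIntegrable w MeasureTheory.volume

/-- `∫_a^b w` as a lower integral. -/
def lintIoc (w : ℝ → ℝ) (a b : ℝ) : ℝ≥0∞ :=
  ∫⁻ t in Set.Ioc a b, ENNReal.ofReal (w t)

/-- Average `(1/(b-a)) ∫_a^b w`. -/
def avgIoc (w : ℝ → ℝ) (a b : ℝ) : ℝ≥0∞ :=
  (ENNReal.ofReal (b - a))⁻¹ * lintIoc w a b

/-- The one-sided `A_{p,q}^+` characteristic:
`sup_{x,h>0} ((1/h)∫_{x-h}^x u^q)((1/h)∫_x^{x+h} u^{-p'})^{q/p'}`, `p' = p/(p-1)`. -/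
def apqPlusChar (p q : ℝ) (u : ℝ → ℝ) : ℝ≥0∞ :=
  ⨆ (x : ℝ) (h : ℝ) (_ : 0 < h),
    avgIoc (fun t => u t ^ q) (x - h) x *
      avgIoc (fun t => u t ^ (-(p / (p - 1)))) x (x + h) ^ (q / (p / (p - 1)))

/-- Weighted `L^p` "norm" `(∫ g^p w)^{1/p}` of an `ℝ≥0∞`-valued function. -/
def lnormW (p : ℝ) (w : ℝ → ℝ) (g : ℝ → ℝ≥0∞) : ℝ≥0∞ :=
  (∫⁻ x : ℝ, g x ^ p * ENNReal.ofReal (w x)) ^ (1 / p)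

/-- The Weyl fractional integral (applied to `|f|`):
`W_α f(x) = ∫_x^∞ |f(t)| (t-x)^{α-1} dt`. -/
def Walpha (α : ℝ) (f : ℝ → ℝ) (x : ℝ) : ℝ≥0∞ :=
  ∫⁻ t in Set.Ioi x, ENNReal.ofReal (|f t| * (t - x) ^ (α - 1))

/-! ### Finite binary trees -/

/-- Leaves of the complete binary tree of depth `n`. -/
def Leaf : ℕ → Type
  | 0 => Unit
  | n + 1 => Bool × Leaf n

def tch {n : ℕ} (c : Bool) (f : Leaf (n + 1) → ℝ) : Leaf n → ℝ := fun t => f (c, t)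

def tS : {n : ℕ} → (Leaf n → ℝ) → ℝ
  | 0, f => f ()
  | _ + 1, f => tS (tch false f) + tS (tch true f)

lemma tS_zero (f : Leaf 0 → ℝ) : tS f = f () := rfl

lemma tS_succ {n : ℕ} (f : Leaf (n + 1) → ℝ) : tS f = tS (tch false f) + tS (tch true f) := rfl

lemma tS_succ' {n : ℕ} (f : Leaf (n + 1) → ℝ) (c : Bool) : tS f = tS (tch c f) + tS (tch (!c) f) := by
  rw [tS_succ]; cases c <;> simp [add_comm]

lemma tS_mono : ∀ {n : ℕ} {f g : Leaf n → ℝ}, (∀ t, f t ≤ g t) → tS f ≤ tS g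
  | 0, _, _, h => h _
  | _ + 1, _, _, h => add_le_add (tS_mono fun _ => h _) (tS_mono fun _ => h _)

lemma tS_nonneg : ∀ {n : ℕ} {f : Leaf n → ℝ}, (∀ t, 0 ≤ f t) → 0 ≤ tS f
  | 0, _, h => h _
  | _ + 1, _, h => add_nonneg (tS_nonneg fun _ => h _) (tS_nonneg fun _ => h _)

lemma tS_pos : ∀ {n : ℕ} {f : Leaf n → ℝ}, (∀ t, 0 < f t) → 0 < tS f
  | 0, _, h => h _
  | _ + 1, _, h => add_pos (tS_pos fun _ => h _) (tS_pos fun _ => h _)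

lemma tS_add : ∀ {n : ℕ} (f g : Leaf n → ℝ), tS (fun t => f t + g t) = tS f + tS g
  | 0, _, _ => rfl
  | n + 1, f, g => by
      have h1 := tS_add (tch false f) (tch false g)
      have h2 := tS_add (tch true f) (tch true g)
      rw [tS_succ, tS_succ f, tS_succ g]
      linarith [show tS (tch false fun t => f t + g t) = _ from h1,
        show tS (tch true fun t => f t + g t) = _ from h2]

lemma tS_mul : ∀ {n : ℕ} (a : ℝ) (f : Leaf n → ℝ), tS (fun t => a * f t) = a * tS f
  | 0, _, _ => rfl
  | n + 1, a, f => by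
      have h1 := tS_mul a (tch false f)
      have h2 := tS_mul a (tch true f)
      rw [tS_succ, tS_succ f]
      linarith [show tS (tch false fun t => a * f t) = _ from h1,
        show tS (tch true fun t => a * f t) = _ from h2]

lemma tS_sub {n : ℕ} (f g : Leaf n → ℝ) : tS (fun t => f t - g t) = tS f - tS g := by
  have h := tS_add f (fun t => (-1) * g t)
  rw [tS_mul] at h
  rw [show (fun t => f t - g t) = fun t => f t + (-1) * g t by funext t; ring, h]; ring

lemma tS_le_succ {n : ℕ} {f : Leaf (n + 1) → ℝ} (h : ∀ t, 0 ≤ f t) (c : Bool) :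
    tS (tch c f) ≤ tS f := by
  rw [tS_succ' f c]
  have : 0 ≤ tS (tch (!c) f) := tS_nonneg fun t => h _
  linarith

/-- running maximum of averages -/
def fstar : (n : ℕ) → (σ F : Leaf n → ℝ) → ℝ → Leaf n → ℝ
  | 0, _, _, M, _ => M
  | n + 1, σ, F, M, x =>
      fstar n (tch x.1 σ) (tch x.1 F) (max M (tS (tch x.1 F) / tS (tch x.1 σ))) x.2

lemma fstar_ge : ∀ (n : ℕ) (σ F : Leaf n → ℝ) (M : ℝ) (t : Leaf n), M ≤ fstar n σ F M t
  | 0, _, _, _, _ => le_rfl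
  | n + 1, σ, F, M, x => (le_max_left _ _).trans (fstar_ge n _ _ _ _)

lemma bern {x y p r : ℝ} (hpr : p.HolderConjugate r) (hy : 0 ≤ y) (hxy : y ≤ x) :
    x ^ p - y ^ p ≤ r * x * (x ^ (p - 1) - y ^ (p - 1)) := by
  have hp1 := hpr.lt
  have hp0 := hpr.pos
  have hr0 := hpr.symm.pos
  have hr1 := hpr.symm.lt
  have hx : 0 ≤ x := hy.trans hxy
  -- Young: x * y^(p-1) ≤ x^p/p + y^p/r
  have hY := Real.young_inequality_of_nonneg hx (Real.rpow_nonneg hy (p - 1)) hpr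
  have e1 : (y ^ (p - 1)) ^ r = y ^ p := by
    rw [← Real.rpow_mul hy]; congr 1; exact hpr.sub_one_mul_conj
  have e2 : x * x ^ (p - 1) = x ^ p := by
    rcases eq_or_lt_of_le hx with h | h
    · rw [← h, Real.zero_rpow hp0.ne']; simp
    · rw [Real.rpow_sub_one h.ne']; field_simp
  rw [e1] at hY
  have e3 : r / p = r - 1 := hpr.symm.div_conj_eq_sub_one
  have : r * (x * y ^ (p - 1)) ≤ (r - 1) * x ^ p + y ^ p := by
    calc r * (x * y ^ (p - 1)) ≤ r * (x ^ p / p + y ^ p / r) := by gcongr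
      _ = (r / p) * x ^ p + y ^ p := by field_simp
      _ = _ := by rw [e3]
  nlinarith [this, e2]

lemma bern2 {x y p : ℝ} (hp : 1 < p) (hy : 0 ≤ y) (hxy : y ≤ x) :
    x ^ p - y ^ p ≤ p * x ^ (p - 1) * (x - y) := by
  have hx : 0 ≤ x := hy.trans hxy
  have hpr := Real.HolderConjugate.conjExponent hp
  have hp0 := hpr.pos
  have hY := Real.young_inequality_of_nonneg hy (Real.rpow_nonneg hx (p - 1)) hpr
  have e1 : (x ^ (p - 1)) ^ p.conjExponent = x ^ p := by
    rw [← Real.rpow_mul hx]; congr 1; exact hpr.sub_one_mul_conj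
  have e2 : x * x ^ (p - 1) = x ^ p := by
    rcases eq_or_lt_of_le hx with h | h
    · rw [← h, Real.zero_rpow hp0.ne']; simp
    · rw [Real.rpow_sub_one h.ne']; field_simp
  rw [e1] at hY
  have e3 : p / p.conjExponent = p - 1 := hpr.div_conj_eq_sub_one
  have : p * (y * x ^ (p - 1)) ≤ y ^ p + (p - 1) * x ^ p := by
    calc p * (y * x ^ (p - 1)) ≤ p * (y ^ p / p + x ^ p / p.conjExponent) := by gcongr
      _ = y ^ p + (p / p.conjExponent) * x ^ p := by field_simp
      _ = _ := by rw [e3]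
  nlinarith [this, e2]

/-- pieces of Doob -/
lemma doob_aux {p r : ℝ} (hpr : p.HolderConjugate r) :
    ∀ (n : ℕ) (σ F : Leaf n → ℝ) (M : ℝ), (∀ t, 0 < σ t) → (∀ t, 0 ≤ F t) → 0 ≤ M →
      tS (fun t => σ t * fstar n σ F M t ^ p) - M ^ p * tS σ ≤
        r * (tS (fun t => F t * fstar n σ F M t ^ (p - 1)) - M ^ (p - 1) * tS F)
  | 0, σ, F, M, hσ, hF, hM => by
      simp only [tS_zero, fstar]
      apply le_of_eq; ring
  | n + 1, σ, F, M, hσ, hF, hM => by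
      have key : ∀ c : Bool,
          tS (tch c fun t => σ t * fstar (n+1) σ F M t ^ p) - M ^ p * tS (tch c σ) ≤
          r * (tS (tch c fun t => F t * fstar (n+1) σ F M t ^ (p - 1)) - M ^ (p - 1) * tS (tch c F)) := by
        intro c
        set M' := max M (tS (tch c F) / tS (tch c σ)) with hM'
        have ih := doob_aux hpr n (tch c σ) (tch c F) M' (fun t => hσ _) (fun t => hF _)
          (hM.trans (le_max_left _ _))
        have hs : 0 < tS (tch c σ) := tS_pos fun t => hσ _
        have hb : (M' ^ p - M ^ p) * tS (tch c σ) ≤ r * (tS (tch c F) * (M' ^ (p-1) - M ^ (p-1))) := by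
          rcases le_total (tS (tch c F) / tS (tch c σ)) M with h | h
          · have : M' = M := max_eq_left h
            rw [this]; simp
          · have h1 : M' = tS (tch c F) / tS (tch c σ) := max_eq_right h
            have h2 : tS (tch c F) = M' * tS (tch c σ) := by rw [h1]; field_simp
            have := bern hpr hM (le_max_left M (tS (tch c F) / tS (tch c σ)))
            rw [h2]
            calc _ ≤ (r * M' * (M' ^ (p - 1) - M ^ (p - 1))) * tS (tch c σ) := by gcongr
              _ = _ := by ring
        have e1 : (tch c fun t => σ t * fstar (n+1) σ F M t ^ p) =
            fun t => tch c σ t * fstar n (tch c σ) (tch c F) M' t ^ p := rfl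
        have e2 : (tch c fun t => F t * fstar (n+1) σ F M t ^ (p-1)) =
            fun t => tch c F t * fstar n (tch c σ) (tch c F) M' t ^ (p-1) := rfl
        rw [e1, e2]
        linarith
      have h1 := key false
      have h2 := key true
      rw [tS_succ (fun t => σ t * fstar (n+1) σ F M t ^ p), tS_succ σ, tS_succ F,
        tS_succ (fun t => F t * fstar (n+1) σ F M t ^ (p - 1))]
      linarith

lemma doob {p r : ℝ} (hpr : p.HolderConjugate r) (n : ℕ) (σ F : Leaf n → ℝ)
    (hσ : ∀ t, 0 < σ t) (hF : ∀ t, 0 ≤ F t) :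
    tS (fun t => σ t * fstar n σ F (tS F / tS σ) t ^ p) ≤
      r * 2 ^ p / p * tS (fun t => F t ^ p * σ t ^ (1 - p)) := by
  have hp0 := hpr.pos
  have hr0 := hpr.symm.pos
  have hs : 0 < tS σ := tS_pos hσ
  have hsF : 0 ≤ tS F := tS_nonneg hF
  set M := tS F / tS σ with hM
  have hM0 : 0 ≤ M := by positivity
  have h1 := doob_aux hpr n σ F M hσ hF hM0
  have e1 : M ^ p * tS σ = M ^ (p - 1) * tS F := by
    have : tS F = M * tS σ := by rw [hM]; field_simp
    rw [this, ← mul_assoc]; congr 1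
    rcases eq_or_lt_of_le hM0 with h | h
    · rw [← h, Real.zero_rpow hp0.ne']; simp
    · rw [Real.rpow_sub_one h.ne']; field_simp
  have h2 : tS (fun t => σ t * fstar n σ F M t ^ p) ≤ r * tS (fun t => F t * fstar n σ F M t ^ (p - 1)) := by
    have : 0 ≤ (r - 1) * (M ^ (p - 1) * tS F) := by
      have := hpr.symm.lt
      have : 0 ≤ r - 1 := by linarith
      positivity
    nlinarith
  have h3 : ∀ t, F t * fstar n σ F M t ^ (p - 1) ≤
      (2 ^ (p - 1) / p) * (F t ^ p * σ t ^ (1 - p)) + (1 / (2 * r)) * (σ t * fstar n σ F M t ^ p) := by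
    intro t
    have hst : 0 ≤ fstar n σ F M t := hM0.trans (fstar_ge _ _ _ _ _)
    have hσt := hσ t
    have hFt := hF t
    set a := fstar n σ F M t
    have hY := Real.young_inequality_of_nonneg (a := 2 ^ (1 / r) * (F t * σ t ^ (- (1 / r))))
      (b := a ^ (p - 1) * σ t ^ (1 / r) * 2 ^ (-(1 / r))) (by positivity) (by positivity) hpr
    have e0 : 2 ^ (1 / r) * (F t * σ t ^ (- (1 / r))) * (a ^ (p - 1) * σ t ^ (1 / r) * 2 ^ (-(1 / r)))
        = F t * a ^ (p - 1) := by
      rw [Real.rpow_neg hσt.le, Real.rpow_neg (by norm_num)]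
      have : (0:ℝ) < 2 ^ (1 / r) := by positivity
      have : (0:ℝ) < σ t ^ (1 / r) := by positivity
      field_simp
    have hrp : 1 / r * p = p - 1 := by
      rw [← hpr.div_conj_eq_sub_one]; ring
    have e1 : (2 ^ (1 / r) * (F t * σ t ^ (- (1 / r)))) ^ p = 2 ^ (p - 1) * (F t ^ p * σ t ^ (1 - p)) := by
      rw [Real.mul_rpow (by positivity) (by positivity), Real.mul_rpow (by positivity) (by positivity),
        ← Real.rpow_mul (by norm_num), ← Real.rpow_mul hσt.le, neg_mul, hrp]
      congr 3; ring
    have e2 : (a ^ (p - 1) * σ t ^ (1 / r) * 2 ^ (-(1 / r))) ^ r = a ^ p * σ t * 2⁻¹ := by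
      have k1 : (a ^ (p - 1)) ^ r = a ^ p := by
        rw [← Real.rpow_mul hst, hpr.sub_one_mul_conj]
      have k2 : (σ t ^ (1 / r)) ^ r = σ t := by
        rw [← Real.rpow_mul hσt.le, one_div_mul_cancel hr0.ne', Real.rpow_one]
      have k3 : ((2:ℝ) ^ (-(1 / r))) ^ r = 2⁻¹ := by
        rw [← Real.rpow_mul (by norm_num), neg_mul, one_div_mul_cancel hr0.ne', Real.rpow_neg_one]
      rw [Real.mul_rpow (by positivity) (by positivity), Real.mul_rpow (by positivity) (by positivity),
        k1, k2, k3]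
    rw [e0, e1, e2] at hY
    calc _ ≤ _ := hY
      _ = _ := by field_simp
  have h4 := tS_mono h3
  rw [tS_add, tS_mul, tS_mul] at h4
  set X := tS (fun t => σ t * fstar n σ F M t ^ p)
  set Y := tS (fun t => F t ^ p * σ t ^ (1 - p))
  have h5 : X ≤ r * ((2 ^ (p - 1) / p) * Y + (1 / (2 * r)) * X) :=
    h2.trans (by gcongr)
  have e5 : r * ((2 ^ (p - 1) / p) * Y + (1 / (2 * r)) * X) = r * (2 ^ (p - 1)) / p * Y + X / 2 := by
    field_simp
  have e6 : (2:ℝ) ^ (p - 1) = 2 ^ p / 2 := by rw [Real.rpow_sub_one (by norm_num)]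
  rw [e5, e6] at h5
  have : r * (2 ^ p / 2) / p * Y = (r * 2 ^ p / p * Y) / 2 := by ring
  linarith

lemma tS_const : ∀ (n : ℕ) (a : ℝ), tS (fun _ : Leaf n => a) = 2 ^ n * a
  | 0, a => by simp [tS_zero]
  | n + 1, a => by
      have h := tS_const n a
      have : tS (fun _ : Leaf (n+1) => a) = tS (fun _ : Leaf n => a) + tS (fun _ : Leaf n => a) := rfl
      rw [this, h]; ring

def tphi (d : Bool) : (n : ℕ) → ℝ → (Leaf n → ℝ) → Leaf n → ℝ
  | 0, _, _, _ => 0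
  | n + 1, L, u, x => max (if x.1 = d then tS (tch (!x.1) u) / (L / 2) else 0)
      (tphi d n (L / 2) (tch x.1 u) x.2)

def ttau (d : Bool) (α : ℝ) : (n : ℕ) → ℝ → (Leaf n → ℝ) → Leaf n → ℝ
  | 0, _, _, _ => 0
  | n + 1, L, u, x => (if x.1 = d then L ^ (α - 1) * tS (tch (!x.1) u) else 0) +
      (ttau d α n (L / 2) (tch x.1 u) x.2)

lemma tphi_nonneg (d : Bool) : ∀ (n : ℕ) (L : ℝ) (u : Leaf n → ℝ) (x : Leaf n), 0 ≤ tphi d n L u x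
  | 0, _, _, _ => le_rfl
  | n + 1, _, _, _ => (tphi_nonneg d n _ _ _).trans (le_max_right _ _)

lemma ttau_nonneg (d : Bool) (α : ℝ) : ∀ (n : ℕ) (L : ℝ) (u : Leaf n → ℝ) (x : Leaf n),
    0 < L → (∀ t, 0 < u t) → 0 ≤ ttau d α n L u x
  | 0, _, _, _, _, _ => le_rfl
  | n + 1, L, u, x, hL, hu => by
      have h1 := ttau_nonneg d α n (L / 2) (tch x.1 u) x.2 (by positivity) (fun t => hu _)
      have h2 : 0 < tS (tch (!x.1) u) := tS_pos fun t => hu _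
      show 0 ≤ (if x.1 = d then L ^ (α - 1) * tS (tch (!x.1) u) else 0) +
        (ttau d α n (L / 2) (tch x.1 u) x.2)
      split_ifs <;> positivity

lemma conc_aux {α V W : ℝ} (hα : 0 < α) (hα1 : α < 1) (hW : 0 < W) (hV : 0 ≤ V) :
    (V + W) ^ (α - 1) * W ≤ (1 / α) * ((V + W) ^ α - V ^ α) := by
  have hX : 0 < V + W := by linarith
  have h := rpow_one_add_le_one_add_mul_self (s := - (W / (V + W))) (p := α)
    (by
      have : W / (V + W) ≤ 1 := by rw [div_le_one hX]; linarith
      linarith) hα.le hα1.le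
  have e : 1 + -(W / (V + W)) = V / (V + W) := by field_simp; ring
  rw [e, Real.div_rpow hV hX.le, div_le_iff₀ (by positivity)] at h
  rw [Real.rpow_sub_one hX.ne']
  have e2 : (1 + α * -(W / (V + W))) * (V + W) ^ α = (V + W) ^ α - α * ((V + W) ^ α / (V + W) * W) := by
    field_simp
    ring
  rw [e2] at h
  rw [one_div, ← div_eq_inv_mul, le_div_iff₀ hα]
  linarith

lemma hedberg_aux (d : Bool) {α : ℝ} (hα : 0 < α) (hα1 : α < 1) :
    ∀ (n : ℕ) (L : ℝ) (u : Leaf n → ℝ) (x : Leaf n) (φ : ℝ), 0 < L → (∀ t, 0 < u t) →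
      tphi d n L u x ≤ φ → ∃ V, 0 ≤ V ∧ V ≤ tS u ∧ V ≤ L * φ ∧
        ttau d α n L u x ≤ (1 / α) * (φ ^ (1 - α) * V ^ α)
  | 0, L, u, x, φ, hL, hu, hφ => by
      have hφ0 : 0 ≤ φ := hφ
      refine ⟨0, le_rfl, (tS_pos hu).le, by positivity, ?_⟩
      show (0:ℝ) ≤ _
      positivity
  | n + 1, L, u, x, φ, hL, hu, hφ => by
      have hφ' : max (if x.1 = d then tS (tch (!x.1) u) / (L / 2) else 0)
        (tphi d n (L / 2) (tch x.1 u) x.2) ≤ φ := hφ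
      obtain ⟨V, hV0, hVu, hVL, hτ⟩ := hedberg_aux d hα hα1 n (L / 2) (tch x.1 u) x.2 φ (by positivity)
        (fun t => hu _) ((le_max_right _ _).trans hφ')
      have hφ0 : 0 ≤ φ := (tphi_nonneg d (n+1) L u x).trans hφ
      have hW : 0 < tS (tch (!x.1) u) := tS_pos fun t => hu _
      have hS := tS_succ' u x.1
      have e : ttau d α (n+1) L u x = (if x.1 = d then L ^ (α - 1) * tS (tch (!x.1) u) else 0) +
        (ttau d α n (L / 2) (tch x.1 u) x.2) := rfl
      by_cases hc : x.1 = d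
      · rw [if_pos hc] at e hφ'
        set W := tS (tch (!x.1) u)
        have h1 : W ≤ φ * (L / 2) := by
          rw [← div_le_iff₀ (by positivity)]; exact (le_max_left _ _).trans hφ'
        have hφp : 0 < φ := by
          by_contra h
          have : φ = 0 := le_antisymm (not_lt.1 h) hφ0
          rw [this] at h1; linarith
        have hVW : V + W ≤ L * φ := by linarith
        refine ⟨V + W, by linarith, by linarith, hVW, ?_⟩
        rw [e]
        have h2 : L ^ (α - 1) ≤ φ ^ (1 - α) * (V + W) ^ (α - 1) := by
          have h3 : (V + W) / φ ≤ L := by rw [div_le_iff₀ hφp]; exact hVW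
          have h4 := Real.rpow_le_rpow_of_nonpos (z := α - 1) (by positivity) h3 (by linarith)
          refine h4.trans (le_of_eq ?_)
          rw [Real.div_rpow (by positivity) hφ0, show 1 - α = -(α - 1) by ring, Real.rpow_neg hφ0]
          field_simp
        have h5 := conc_aux hα hα1 hW hV0
        calc L ^ (α - 1) * W + ttau d α n (L / 2) (tch x.1 u) x.2
            ≤ φ ^ (1 - α) * (V + W) ^ (α - 1) * W + 1 / α * (φ ^ (1 - α) * V ^ α) := by gcongr
          _ = φ ^ (1 - α) * ((V + W) ^ (α - 1) * W) + 1 / α * (φ ^ (1 - α) * V ^ α) := by ring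
          _ ≤ φ ^ (1 - α) * ((1 / α) * ((V + W) ^ α - V ^ α)) + 1 / α * (φ ^ (1 - α) * V ^ α) := by
              gcongr
          _ = _ := by ring
      · rw [if_neg hc, zero_add] at e
        refine ⟨V, hV0, by linarith, ?_, e ▸ hτ⟩
        have : 0 ≤ L * φ := by positivity
        linarith

lemma hedberg (d : Bool) {α : ℝ} (hα : 0 < α) (hα1 : α < 1) (n : ℕ) (L : ℝ) (u : Leaf n → ℝ)
    (x : Leaf n) (hL : 0 < L) (hu : ∀ t, 0 < u t) :
    ttau d α n L u x ≤ (1 / α) * (tphi d n L u x ^ (1 - α) * (tS u) ^ α) := by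
  obtain ⟨V, h0, h1, _, h2⟩ := hedberg_aux d hα hα1 n L u x _ hL hu le_rfl
  have := tphi_nonneg d n L u x
  refine h2.trans ?_
  gcongr

def Adm (d : Bool) (s0 s1 K : ℝ) : (n : ℕ) → ℝ → (Leaf n → ℝ) → (Leaf n → ℝ) → Prop
  | 0, L, σ, u => L ≤ u () ^ (1 / s0) * σ () ^ (1 / s1)
  | n + 1, L, σ, u => tS (tch d σ) * tS (tch (!d) u) ^ (s1 - 1) ≤ K * (L / 2) ^ s1 ∧
      ∀ c, Adm d s0 s1 K n (L / 2) (tch c σ) (tch c u)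

lemma adm_leaf (d : Bool) (s0 s1 K : ℝ) : ∀ (n : ℕ) (L : ℝ) (σ u : Leaf n → ℝ), Adm d s0 s1 K n L σ u →
    ∀ t, L / 2 ^ n ≤ u t ^ (1 / s0) * σ t ^ (1 / s1)
  | 0, L, σ, u, h, t => by
      rw [pow_zero, div_one]; exact h
  | n + 1, L, σ, u, h, t => by
      have := adm_leaf d s0 s1 K n (L / 2) _ _ (h.2 t.1) t.2
      refine le_trans (le_of_eq ?_) this
      rw [pow_succ]; field_simp

lemma weak (d : Bool) {s0 s1 K : ℝ} (hs : 1 < s1) :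
    ∀ (n : ℕ) (L : ℝ) (σ u : Leaf n → ℝ) (m : ℝ), 0 < L → (∀ t, 0 < σ t) → (∀ t, 0 < u t) →
      Adm d s0 s1 K n L σ u → 0 ≤ m →
      tS (fun t => σ t * (max m (tphi d n L u t) ^ s1 - m ^ s1)) ≤
        s1 * K * (L / 2 ^ n) * tS (fun t => max m (tphi d n L u t) - m)
  | 0, L, σ, u, m, hL, hσ, hu, hA, hm => by
      simp only [tS_zero, tphi, max_eq_left hm]; simp
  | n + 1, L, σ, u, m, hL, hσ, hu, hA, hm => by
      have key : ∀ c : Bool,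
          tS (tch c fun t => σ t * (max m (tphi d (n+1) L u t) ^ s1 - m ^ s1)) ≤
          s1 * K * (L / 2 ^ (n+1)) * tS (tch c fun t => max m (tphi d (n+1) L u t) - m) := by
        intro c
        have hL2 : L / 2 / 2 ^ n = L / 2 ^ (n+1) := by rw [pow_succ]; field_simp
        have hL20 : 0 < L / 2 := by positivity
        by_cases hc : c = d
        · set a := tS (tch (!c) u) / (L / 2) with ha
          have ha0 : 0 < tS (tch (!c) u) := tS_pos fun t => hu _
          have e : ∀ t, max m (max a (tphi d n (L/2) (tch c u) t)) =
              max (max m a) (tphi d n (L/2) (tch c u) t) := fun t => (max_assoc _ _ _).symm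
          have ih := weak d hs n (L/2) (tch c σ) (tch c u) (max m a) hL20
            (fun t => hσ _) (fun t => hu _) (hA.2 c) (hm.trans (le_max_left _ _))
          have f1 : (tch c fun t => σ t * (max m (tphi d (n+1) L u t) ^ s1 - m ^ s1)) =
              fun t => tch c σ t * (max (max m a) (tphi d n (L/2) (tch c u) t) ^ s1 - (max m a) ^ s1)
                + ((max m a) ^ s1 - m ^ s1) * tch c σ t := by
            funext t
            have : tphi d (n+1) L u (c, t) = max a (tphi d n (L/2) (tch c u) t) := by
              simp only [tphi, if_pos hc]; rfl
            show σ (c, t) * (max m (tphi d (n+1) L u (c,t)) ^ s1 - m ^ s1) = _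
            rw [this, e]
            simp only [tch]; ring
          have f2 : (tch c fun t => max m (tphi d (n+1) L u t) - m) =
              fun t => (max (max m a) (tphi d n (L/2) (tch c u) t) - (max m a))
                + (max m a - m) := by
            funext t
            have : tphi d (n+1) L u (c, t) = max a (tphi d n (L/2) (tch c u) t) := by
              simp only [tphi, if_pos hc]; rfl
            show (max m (tphi d (n+1) L u (c,t)) - m) = _
            rw [this, e]; ring
          rw [f1, f2, tS_add, tS_add, tS_mul, tS_const]
          rw [hL2] at ih
          have hx : ((max m a) ^ s1 - m ^ s1) * tS (tch c σ) ≤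
              s1 * K * (L / 2) * (max m a - m) := by
            rcases le_total a m with h | h
            · rw [max_eq_left h]; simp
            · rw [max_eq_right h]
              have hb := bern2 hs hm h
              have hσ0 : 0 < tS (tch c σ) := tS_pos fun t => hσ _
              have hA1 := hA.1
              rw [← hc] at hA1
              have h6 : a ^ (s1 - 1) * tS (tch c σ) ≤ K * (L / 2) := by
                rw [ha, Real.div_rpow ha0.le hL20.le, div_mul_eq_mul_div, div_le_iff₀ (by positivity)]
                have : (L / 2) * (L / 2) ^ (s1 - 1) = (L/2) ^ s1 := by
                  rw [Real.rpow_sub_one hL20.ne']; field_simp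
                rw [mul_assoc, this, mul_comm]; exact hA1
              calc (a ^ s1 - m ^ s1) * tS (tch c σ) ≤ (s1 * a ^ (s1 - 1) * (a - m)) * tS (tch c σ) := by
                    gcongr
                _ = s1 * (a - m) * (a ^ (s1 - 1) * tS (tch c σ)) := by ring
                _ ≤ s1 * (a - m) * (K * (L / 2)) := by
                    have : 0 ≤ a - m := by linarith
                    gcongr
                _ = _ := by ring
          have e9 : L / 2 ^ (n+1) * (2 ^ n * (max m a - m)) = L / 2 * (max m a - m) := by
            rw [pow_succ]; field_simp
          calc _ ≤ _ := add_le_add ih hx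
            _ = s1 * K * (L / 2 ^ (n + 1)) * tS (fun t => max (max m a) (tphi d n (L / 2) (tch c u) t) - max m a)
                + s1 * K * (L / 2 ^ (n+1) * (2 ^ n * (max m a - m))) := by rw [e9]; ring
            _ = _ := by ring
        · have ih := weak d hs n (L/2) (tch c σ) (tch c u) m hL20
            (fun t => hσ _) (fun t => hu _) (hA.2 c) hm
          rw [hL2] at ih
          have this : ∀ t, tphi d (n+1) L u (c, t) = (tphi d n (L/2) (tch c u) t) := by
            intro t
            simp only [tphi, if_neg hc]
            exact max_eq_right (tphi_nonneg _ _ _ _ _)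
          have f1 : (tch c fun t => σ t * (max m (tphi d (n+1) L u t) ^ s1 - m ^ s1)) =
              fun t => tch c σ t * (max m (tphi d n (L/2) (tch c u) t) ^ s1 - m ^ s1) := by
            funext t
            show σ (c, t) * (max m (tphi d (n+1) L u (c,t)) ^ s1 - m ^ s1) = _
            rw [this]; rfl
          have f2 : (tch c fun t => max m (tphi d (n+1) L u t) - m) =
              fun t => max m (tphi d n (L/2) (tch c u) t) - m := by
            funext t
            show (max m (tphi d (n+1) L u (c,t)) - m) = _
            rw [this]
          rw [f1, f2]; exact ih
      rw [tS_succ, tS_succ (fun t => max m (tphi d (n+1) L u t) - m), mul_add]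
      exact add_le_add (key _) (key _)

lemma ttest (d : Bool) {s0 s1 K : ℝ} (hs : s0.HolderConjugate s1) (hK : 0 < K) (n : ℕ) (L : ℝ)
    (σ u : Leaf n → ℝ) (hL : 0 < L) (hσ : ∀ t, 0 < σ t) (hu : ∀ t, 0 < u t)
    (hA : Adm d s0 s1 K n L σ u) :
    tS (fun t => σ t * tphi d n L u t ^ s1) ≤ s1 * (2 * K) ^ s0 / s0 * tS u := by
  have h1 := weak d hs.symm.lt n L σ u 0 hL hσ hu hA le_rfl
  have hs1 := hs.symm.pos
  have hs0 := hs.pos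
  simp only [max_eq_right (tphi_nonneg d n L u _), Real.zero_rpow hs1.ne', sub_zero] at h1
  have h3 : ∀ t, (L / 2 ^ n) * tphi d n L u t ≤
      ((2 * K) ^ (s0 - 1) / s0) * u t + 1 / (2 * K * s1) * (σ t * tphi d n L u t ^ s1) := by
    intro t
    have hl := adm_leaf d s0 s1 K n L σ u hA t
    have hφ := tphi_nonneg d n L u t
    set φ := tphi d n L u t
    have hut := hu t
    have hσt := hσ t
    have hY := Real.young_inequality_of_nonneg (a := (2*K) ^ (1 / s1) * u t ^ (1 / s0))
      (b := (2*K) ^ (-(1/s1)) * (σ t ^ (1 / s1) * φ)) (by positivity) (by positivity) hs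
    have e0 : (2*K) ^ (1 / s1) * u t ^ (1 / s0) * ((2*K) ^ (-(1/s1)) * (σ t ^ (1 / s1) * φ)) =
        u t ^ (1 / s0) * σ t ^ (1 / s1) * φ := by
      rw [Real.rpow_neg (by positivity)]; 
      have : (0:ℝ) < (2*K) ^ (1 / s1) := by positivity
      field_simp
    have k1 : (u t ^ (1 / s0)) ^ s0 = u t := by
      rw [← Real.rpow_mul hut.le, one_div_mul_cancel hs0.ne', Real.rpow_one]
    have k2 : (σ t ^ (1 / s1)) ^ s1 = σ t := by
      rw [← Real.rpow_mul hσt.le, one_div_mul_cancel hs1.ne', Real.rpow_one]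
    have k3 : ((2 * K) ^ (1 / s1)) ^ s0 = (2 * K) ^ (s0 - 1) := by
      rw [← Real.rpow_mul (by positivity)]; congr 1
      rw [← hs.div_conj_eq_sub_one]; ring
    have k4 : ((2 * K) ^ (-(1 / s1))) ^ s1 = (2 * K)⁻¹ := by
      rw [← Real.rpow_mul (by positivity), neg_mul, one_div_mul_cancel hs1.ne', Real.rpow_neg_one]
    have j1 : ((2*K) ^ (1 / s1) * u t ^ (1 / s0)) ^ s0 = (2 * K) ^ (s0 - 1) * u t := by
      rw [Real.mul_rpow (by positivity) (by positivity), k1, k3]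
    have j2 : ((2*K) ^ (-(1/s1)) * (σ t ^ (1 / s1) * φ)) ^ s1 = (2 * K)⁻¹ * (σ t * φ ^ s1) := by
      rw [Real.mul_rpow (by positivity) (by positivity), k4,
        Real.mul_rpow (x := σ t ^ (1 / s1)) (by positivity) (by positivity), k2]
    rw [e0, j1, j2] at hY
    calc _ ≤ u t ^ (1 / s0) * σ t ^ (1 / s1) * φ := by gcongr
      _ ≤ _ := hY
      _ = _ := by field_simp
  have h4 := tS_mono h3
  rw [tS_add, tS_mul, tS_mul, tS_mul] at h4
  set X := tS (fun t => σ t * tphi d n L u t ^ s1)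
  set Y := tS u
  have h5 : X ≤ s1 * K * ((2 * K) ^ (s0 - 1) / s0 * Y + 1 / (2 * K * s1) * X) := by
    refine h1.trans ?_
    rw [mul_assoc]
    gcongr
  have e6 : (2 * K) ^ (s0 - 1) = (2 * K) ^ s0 / (2 * K) := by rw [Real.rpow_sub_one (by positivity)]
  have e5 : s1 * K * ((2 * K) ^ (s0 - 1) / s0 * Y + 1 / (2 * K * s1) * X) =
     (s1 * (2 * K) ^ s0 / s0 * Y) / 2 + X / 2 := by
    rw [e6]; field_simp
  linarith

/-- stopping maximal functions -/
def tZ (d : Bool) (e s1 : ℝ) : (n : ℕ) → ℝ → (Leaf n → ℝ) → (Leaf n → ℝ) → ℝ → Leaf n → ℝ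
  | 0, _, _, _, _, _ => 0
  | n + 1, L, u, G, M, x => max (M ^ e * tphi d (n+1) L u x ^ s1)
      (tZ d e s1 n (L / 2) (tch x.1 u) (tch x.1 G) (max M (tS (tch x.1 G) / tS (tch x.1 u))) x.2)

def tB (d : Bool) (α : ℝ) : (n : ℕ) → ℝ → (Leaf n → ℝ) → (Leaf n → ℝ) → ℝ → Leaf n → ℝ
  | 0, _, _, _, _, _ => 0
  | n + 1, L, u, G, M, x => max (M * ttau d α (n+1) L u x)
      (tB d α n (L / 2) (tch x.1 u) (tch x.1 G) (max M (tS (tch x.1 G) / tS (tch x.1 u))) x.2)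

lemma tZ_ge (d : Bool) (e : ℝ) {s1 : ℝ} (hs : s1 ≠ 0) : ∀ (n : ℕ) (L : ℝ) (u G : Leaf n → ℝ) (M : ℝ) (x : Leaf n),
    M ^ e * tphi d n L u x ^ s1 ≤ tZ d e s1 n L u G M x
  | 0, _, _, _, _, _ => by simp [tphi, tZ, Real.zero_rpow hs]
  | _ + 1, _, _, _, _, _ => le_max_left _ _

lemma tB_ge (d : Bool) (α : ℝ) : ∀ (n : ℕ) (L : ℝ) (u G : Leaf n → ℝ) (M : ℝ) (x : Leaf n),
    M * ttau d α n L u x ≤ tB d α n L u G M x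
  | 0, _, _, _, _, _ => by simp [ttau, tB]
  | _ + 1, _, _, _, _, _ => le_max_left _ _

lemma tB_nonneg (d : Bool) (α : ℝ) : ∀ (n : ℕ) (L : ℝ) (u G : Leaf n → ℝ) (M : ℝ) (x : Leaf n),
    0 ≤ tB d α n L u G M x
  | 0, _, _, _, _, _ => le_rfl
  | n + 1, _, _, _, _, _ => (tB_nonneg d α n _ _ _ _ _).trans (le_max_right _ _)

lemma tZ_sum_aux (d : Bool) {s0 s1 K e : ℝ} (hs : s0.HolderConjugate s1) (hK : 0 < K) (he : 0 < e) :
    ∀ (n : ℕ) (L : ℝ) (σ u G : Leaf n → ℝ) (M : ℝ), 0 < L → (∀ t, 0 < σ t) → (∀ t, 0 < u t) →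
      Adm d s0 s1 K n L σ u → 0 ≤ M →
      tS (fun t => σ t * (tZ d e s1 n L u G M t - M ^ e * tphi d n L u t ^ s1)) ≤
        s1 * (2 * K) ^ s0 / s0 * tS (fun t => u t * (fstar n u G M t ^ e - M ^ e))
  | 0, L, σ, u, G, M, hL, hσ, hu, hA, hM => by
      simp [tS_zero, tZ, tphi, fstar, Real.zero_rpow hs.symm.pos.ne']
  | n + 1, L, σ, u, G, M, hL, hσ, hu, hA, hM => by
      set T := s1 * (2 * K) ^ s0 / s0 with hT
      have key : ∀ c : Bool,
          tS (tch c fun t => σ t * (tZ d e s1 (n+1) L u G M t - M ^ e * tphi d (n+1) L u t ^ s1)) ≤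
          T * tS (tch c fun t => u t * (fstar (n+1) u G M t ^ e - M ^ e)) := by
        intro c
        set M' := max M (tS (tch c G) / tS (tch c u)) with hM'
        have hMM : M ≤ M' := le_max_left _ _
        have hL2 : 0 < L / 2 := by positivity
        have ih := tZ_sum_aux d hs hK he n (L/2) (tch c σ) (tch c u) (tch c G) M' hL2 (fun t => hσ _)
          (fun t => hu _) (hA.2 c) (hM.trans hMM)
        have ht := ttest d hs hK n (L/2) (tch c σ) (tch c u) hL2 (fun t => hσ _)
          (fun t => hu _) (hA.2 c)
        rw [← hT] at ih ht
        have hMe : M ^ e ≤ M' ^ e := Real.rpow_le_rpow hM hMM he.le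
        have f1 : ∀ t, (tch c fun t => σ t * (tZ d e s1 (n+1) L u G M t - M ^ e * tphi d (n+1) L u t ^ s1)) t ≤
            (tch c σ t * (tZ d e s1 n (L/2) (tch c u) (tch c G) M' t -
              M' ^ e * tphi d n (L/2) (tch c u) t ^ s1)) + (M' ^ e - M ^ e) *
              (tch c σ t * tphi d n (L/2) (tch c u) t ^ s1) := by
          intro t
          have hφ0 := tphi_nonneg d n (L/2) (tch c u) t
          have hφ : tphi d n (L/2) (tch c u) t ≤ tphi d (n+1) L u (c, t) := le_max_right _ _
          have hz : tZ d e s1 (n+1) L u G M (c, t) = max (M ^ e * tphi d (n+1) L u (c, t) ^ s1)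
            (tZ d e s1 n (L/2) (tch c u) (tch c G) M' t) := rfl
          have hzg := tZ_ge d e hs.symm.pos.ne' n (L/2) (tch c u) (tch c G) M' t
          have hσt : 0 < σ (c, t) := hσ _
          show σ (c, t) * (tZ d e s1 (n+1) L u G M (c, t) - M ^ e * tphi d (n+1) L u (c, t) ^ s1) ≤
            σ (c, t) * _ + _ * (σ (c, t) * _)
          rw [hz]
          have hφs := Real.rpow_le_rpow hφ0 hφ hs.symm.pos.le
          have hφs0 := Real.rpow_nonneg hφ0 s1
          have hMe0 : 0 ≤ M ^ e := Real.rpow_nonneg hM e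
          set A := tphi d (n+1) L u (c, t) ^ s1
          set B := tphi d n (L/2) (tch c u) t ^ s1
          set Z := tZ d e s1 n (L/2) (tch c u) (tch c G) M' t
          have hfin : max (M ^ e * A) Z - M ^ e * A ≤ (Z - M' ^ e * B) + (M' ^ e - M ^ e) * B := by
            have h1 : M ^ e * B ≤ M ^ e * A := by gcongr
            have h2 : M ^ e * B ≤ M' ^ e * B := by gcongr
            rcases le_total (M ^ e * A) Z with h | h
            · rw [max_eq_right h]; linarith
            · rw [max_eq_left h]; linarith
          calc _ ≤ σ (c, t) * ((Z - M' ^ e * B) + (M' ^ e - M ^ e) * B) := by gcongr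
            _ = _ := by ring
        have h2 := tS_mono f1
        rw [tS_add, tS_mul] at h2
        have f2 : (tch c fun t => u t * (fstar (n+1) u G M t ^ e - M ^ e)) =
            fun t => tch c u t * (fstar n (tch c u) (tch c G) M' t ^ e - M' ^ e) +
              (M' ^ e - M ^ e) * tch c u t := by
          funext t
          show u (c, t) * (fstar n (tch c u) (tch c G) M' t ^ e - M ^ e) = u (c,t) * _ + _ * u (c, t)
          ring
        rw [f2, tS_add, tS_mul, mul_add]
        refine h2.trans (add_le_add ih ?_)
        have : 0 ≤ M' ^ e - M ^ e := by linarith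
        calc _ ≤ (M' ^ e - M ^ e) * (T * tS (tch c u)) := by gcongr
          _ = _ := by ring
      rw [tS_succ, tS_succ (fun t => u t * (fstar (n+1) u G M t ^ e - M ^ e)), mul_add]
      exact add_le_add (key _) (key _)

lemma tZ_sum (d : Bool) {s0 s1 K e : ℝ} (hs : s0.HolderConjugate s1) (hK : 0 < K) (he : 0 < e)
    (n : ℕ) (L : ℝ) (σ u G : Leaf n → ℝ) (M : ℝ) (hL : 0 < L) (hσ : ∀ t, 0 < σ t) (hu : ∀ t, 0 < u t)
    (hA : Adm d s0 s1 K n L σ u) (hM : 0 ≤ M) :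
    tS (fun t => σ t * tZ d e s1 n L u G M t) ≤
        s1 * (2 * K) ^ s0 / s0 * tS (fun t => u t * fstar n u G M t ^ e) := by
  have h1 := tZ_sum_aux d hs hK he n L σ u G M hL hσ hu hA hM
  have h2 := ttest d hs hK n L σ u hL hσ hu hA
  set T := s1 * (2 * K) ^ s0 / s0
  have e1 : (fun t => σ t * (tZ d e s1 n L u G M t - M ^ e * tphi d n L u t ^ s1)) =
    fun t => σ t * tZ d e s1 n L u G M t - M ^ e * (σ t * tphi d n L u t ^ s1) := by
      funext t; ring
  have e2 : (fun t => u t * (fstar n u G M t ^ e - M ^ e)) =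
    fun t => u t * fstar n u G M t ^ e - M ^ e * u t := by funext t; ring
  rw [e1, e2, tS_sub, tS_sub, tS_mul, tS_mul] at h1
  have h3 : M ^ e * tS (fun t => σ t * tphi d n L u t ^ s1) ≤ M ^ e * (T * tS u) := by
    have := Real.rpow_nonneg hM e
    gcongr
  nlinarith

lemma tB_le_tZ (d : Bool) {α e r s1 : ℝ} (hα : 0 < α) (hα1 : α < 1) (he : 0 < e) (hr : 0 < r)
    (hre : r = e * (1 + α * r)) (hs : (1 - α) * r = s1) :
    ∀ (n : ℕ) (L : ℝ) (u G : Leaf n → ℝ) (M : ℝ), 0 < L → (∀ t, 0 < u t) → 0 ≤ M →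
      tS (fun t => u t * fstar n u G M t ^ e) ≤ 1 →
      ∀ x, tB d α n L u G M x ^ r ≤ (1 / α) ^ r * tZ d e s1 n L u G M x
  | 0, L, u, G, M, hL, hu, hM, h1, x => by
      simp [tB, tZ, Real.zero_rpow hr.ne']
  | n + 1, L, u, G, M, hL, hu, hM, h1, x => by
      have ih := tB_le_tZ d hα hα1 he hr hre hs n (L/2) (tch x.1 u) (tch x.1 G)
        (max M (tS (tch x.1 G) / tS (tch x.1 u))) (by positivity) (fun t => hu _)
        (hM.trans (le_max_left _ _)) (by
          refine le_trans ?_ h1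
          refine tS_le_succ (f := fun t => u t * fstar (n+1) u G M t ^ e) ?_ x.1
          intro t
          exact mul_nonneg (hu t).le (Real.rpow_nonneg (hM.trans (fstar_ge _ _ _ _ _)) _)) x.2
      have hMS : M ^ e * tS u ≤ 1 := by
        rw [← tS_mul]
        refine le_trans (tS_mono fun t => ?_) h1
        rw [mul_comm]
        have := fstar_ge (n+1) u G M t
        have hut := hu t
        gcongr
      have hSu : 0 < tS u := tS_pos hu
      have hh := hedberg d hα hα1 (n+1) L u x hL hu
      have hφ := tphi_nonneg d (n+1) L u x
      have ht := ttau_nonneg d α (n+1) L u x hL hu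
      have hB : tB d α (n+1) L u G M x = max (M * ttau d α (n+1) L u x)
        (tB d α n (L / 2) (tch x.1 u) (tch x.1 G) (max M (tS (tch x.1 G) / tS (tch x.1 u))) x.2) := rfl
      have hZ : tZ d e s1 (n+1) L u G M x = max (M ^ e * tphi d (n+1) L u x ^ s1)
        (tZ d e s1 n (L / 2) (tch x.1 u) (tch x.1 G) (max M (tS (tch x.1 G) / tS (tch x.1 u))) x.2) := rfl
      rw [hB, hZ]
      have hB0 := tB_nonneg d α n (L / 2) (tch x.1 u) (tch x.1 G) (max M (tS (tch x.1 G) / tS (tch x.1 u))) x.2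
      rcases le_total (M * ttau d α (n+1) L u x)
        (tB d α n (L / 2) (tch x.1 u) (tch x.1 G) (max M (tS (tch x.1 G) / tS (tch x.1 u))) x.2) with h | h
      · rw [max_eq_right h]
        refine ih.trans ?_
        gcongr
        exact le_max_right _ _
      · rw [max_eq_left h]
        have h5 : (M * ttau d α (n+1) L u x) ^ r ≤ (1 / α) ^ r * (M ^ e * tphi d (n+1) L u x ^ s1) := by
          set φ := tphi d (n+1) L u x
          calc (M * ttau d α (n+1) L u x) ^ r ≤ (M * ((1 / α) * (φ ^ (1 - α) * (tS u) ^ α))) ^ r := by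
                gcongr
            _ = (1 / α) ^ r * (M ^ e * φ ^ s1) * ((M ^ e * tS u) ^ (α * r)) := by
                rw [Real.mul_rpow hM (by positivity), Real.mul_rpow (by positivity) (by positivity),
                  Real.mul_rpow (by positivity) (by positivity), ← Real.rpow_mul hφ,
                  Real.mul_rpow (by positivity) (by positivity), ← Real.rpow_mul hSu.le,
                  ← Real.rpow_mul hM, hs]
                have : M ^ r = M ^ e * M ^ (e * (α * r)) := by
                  rw [← Real.rpow_add_of_nonneg hM (by positivity) (by positivity)]
                  congr 1; linarith
                rw [this]; ring
            _ ≤ (1 / α) ^ r * (M ^ e * φ ^ s1) * 1 := by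
                have : (M ^ e * tS u) ^ (α * r) ≤ 1 := Real.rpow_le_one (by positivity) hMS (by positivity)
                gcongr
            _ = _ := by ring
        refine h5.trans ?_
        gcongr
        exact le_max_left _ _

lemma tB_sum (d : Bool) {α s0 s1 K e r : ℝ} (hα : 0 < α) (hα1 : α < 1)
    (hs : s0.HolderConjugate s1) (hK : 0 < K) (he : 0 < e) (hr : 0 < r)
    (hre : r = e * (1 + α * r)) (hs1 : (1 - α) * r = s1)
    (n : ℕ) (L : ℝ) (σ u G : Leaf n → ℝ) (M : ℝ) (hL : 0 < L) (hσ : ∀ t, 0 < σ t) (hu : ∀ t, 0 < u t)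
    (hA : Adm d s0 s1 K n L σ u) (hM : 0 ≤ M) (h1 : tS (fun t => u t * fstar n u G M t ^ e) ≤ 1) :
    tS (fun t => σ t * tB d α n L u G M t ^ r) ≤ (1 / α) ^ r * (s1 * (2 * K) ^ s0 / s0) := by
  have h2 := tZ_sum d hs hK he n L σ u G M hL hσ hu hA hM
  have h3 := tB_le_tZ d hα hα1 he hr hre hs1 n L u G M hL hu hM h1
  have hT : 0 ≤ s1 * (2 * K) ^ s0 / s0 := by
    have := hs.pos; have := hs.symm.pos; positivity
  calc _ ≤ tS (fun t => (1/α)^r * (σ t * tZ d e s1 n L u G M t)) := by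
        apply tS_mono; intro t
        have := h3 t; have := hσ t
        calc _ ≤ σ t * ((1 / α) ^ r * tZ d e s1 n L u G M t) := by gcongr
          _ = _ := by ring
    _ = (1/α)^r * tS (fun t => (σ t * tZ d e s1 n L u G M t)) := tS_mul _ _
    _ ≤ (1/α)^r * ((s1 * (2 * K) ^ s0 / s0) * 1) := by
        refine mul_le_mul_of_nonneg_left (h2.trans ?_) (by positivity)
        exact mul_le_mul_of_nonneg_left h1 hT
    _ = _ := by ring

def tLam (α : ℝ) : (n : ℕ) → ℝ → (Leaf n → ℝ) → (Leaf n → ℝ) → ℝ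
  | 0, _, _, _ => 0
  | n + 1, L, F, G => L ^ (α - 1) * tS (tch true F) * tS (tch false G) +
      (tLam α n (L / 2) (tch false F) (tch false G) + tLam α n (L / 2) (tch true F) (tch true G))

lemma tLam_smul (α a b : ℝ) : ∀ (n : ℕ) (L : ℝ) (F G : Leaf n → ℝ),
    tLam α n L (fun t => a * F t) (fun t => b * G t) = a * b * tLam α n L F G
  | 0, _, _, _ => by simp [tLam]
  | n + 1, L, F, G => by
      have h1 := tLam_smul α a b n (L/2) (tch false F) (tch false G)
      have h2 := tLam_smul α a b n (L/2) (tch true F) (tch true G)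
      have e : tLam α (n+1) L (fun t => a * F t) (fun t => b * G t) =
        L ^ (α - 1) * tS (fun t => a * tch true F t) * tS (fun t => b * tch false G t) +
        (tLam α n (L / 2) (fun t => a * tch false F t) (fun t => b * tch false G t) +
         tLam α n (L / 2) (fun t => a * tch true F t) (fun t => b * tch true G t)) := rfl
      rw [e, h1, h2, tS_mul, tS_mul, tLam]; ring

lemma tLam_eq_true (α : ℝ) : ∀ (n : ℕ) (L : ℝ) (F G : Leaf n → ℝ),
    tLam α n L F G = tS (fun t => F t * ttau true α n L G t)
  | 0, _, _, _ => by simp [tLam, ttau, tS_zero]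
  | n + 1, L, F, G => by
      have h1 := tLam_eq_true α n (L/2) (tch false F) (tch false G)
      have h2 := tLam_eq_true α n (L/2) (tch true F) (tch true G)
      have e1 : (tch false fun t => F t * ttau true α (n+1) L G t) =
          fun t => tch false F t * ttau true α n (L/2) (tch false G) t := by
        funext t; simp [tch, ttau]
      have e2 : (tch true fun t => F t * ttau true α (n+1) L G t) =
          fun t => (L ^ (α - 1) * tS (tch false G)) * tch true F t +
            tch true F t * ttau true α n (L/2) (tch true G) t := by
        funext t; simp [tch, ttau]
        change F (true, t) * (_ + ttau true α n (L/2) (tch true G) t) = _ + F (true, t) * _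
        ring
      rw [tS_succ, e1, e2, tS_add, tS_mul, tLam, h1, h2]; ring

lemma tLam_eq_false (α : ℝ) : ∀ (n : ℕ) (L : ℝ) (F G : Leaf n → ℝ),
    tLam α n L F G = tS (fun t => G t * ttau false α n L F t)
  | 0, _, _, _ => by simp [tLam, ttau, tS_zero]
  | n + 1, L, F, G => by
      have h1 := tLam_eq_false α n (L/2) (tch false F) (tch false G)
      have h2 := tLam_eq_false α n (L/2) (tch true F) (tch true G)
      have e1 : (tch true fun t => G t * ttau false α (n+1) L F t) =
          fun t => tch true G t * ttau false α n (L/2) (tch true F) t := by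
        funext t; simp [tch, ttau]
      have e2 : (tch false fun t => G t * ttau false α (n+1) L F t) =
          fun t => (L ^ (α - 1) * tS (tch true F)) * tch false G t +
            tch false G t * ttau false α n (L/2) (tch false F) t := by
        funext t; simp [tch, ttau]
        change G (false, t) * (_ + ttau false α n (L/2) (tch false F) t) = _ + G (false, t) * _
        ring
      rw [tS_succ, e1, e2, tS_add, tS_mul, tLam, h1, h2]; ring

def tPC (α : ℝ) : (n : ℕ) → ℝ → (σ u F G : Leaf n → ℝ) → ℝ → ℝ → ℝ
  | 0, _, _, _, _, _, _, _ => 0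
  | n + 1, L, σ, u, F, G, Mf, Mg =>
      L ^ (α - 1) * tS (tch true σ) * tS (tch false u) *
        ((max Mf (tS (tch true F) / tS (tch true σ)) - Mf) *
         (max Mg (tS (tch false G) / tS (tch false u)) - Mg)) +
      (tPC α n (L / 2) (tch false σ) (tch false u) (tch false F) (tch false G)
        (max Mf (tS (tch false F) / tS (tch false σ))) (max Mg (tS (tch false G) / tS (tch false u))) +
       tPC α n (L / 2) (tch true σ) (tch true u) (tch true F) (tch true G)
        (max Mf (tS (tch true F) / tS (tch true σ))) (max Mg (tS (tch true G) / tS (tch true u))))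

lemma claimGen (d : Bool) {α : ℝ} (n : ℕ) (L : ℝ) (σ u F G : Leaf (n+1) → ℝ) (Mf Mg : ℝ) (c : Bool)
    (hL : 0 < L) (hσ : ∀ t, 0 < σ t) (hu : ∀ t, 0 < u t) (hMg : 0 ≤ Mg) :
    (max Mf (tS (tch c F) / tS (tch c σ)) - Mf) *
      ((if c = d then L ^ (α - 1) * tS (tch (!c) u) * tS (tch c σ) else 0) * Mg +
        max Mg (tS (tch c G) / tS (tch c u)) *
          tS (fun t => tch c σ t * ttau d α n (L/2) (tch c u) t)) +
      2 * tS (fun t => tch c σ t * ((fstar n (tch c σ) (tch c F) (max Mf (tS (tch c F) / tS (tch c σ))) t -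
          max Mf (tS (tch c F) / tS (tch c σ))) *
        tB d α n (L/2) (tch c u) (tch c G) (max Mg (tS (tch c G) / tS (tch c u))) t)) ≤
    2 * tS (tch c fun t => σ t * ((fstar (n+1) σ F Mf t - Mf) * tB d α (n+1) L u G Mg t)) := by
  set Mf' := max Mf (tS (tch c F) / tS (tch c σ)) with hMf'
  set Mg' := max Mg (tS (tch c G) / tS (tch c u)) with hMg'
  have hΔ : 0 ≤ Mf' - Mf := sub_nonneg.2 (le_max_left _ _)
  obtain ⟨W, hW⟩ : ∃ W, W = tS (tch (!c) u) := ⟨_, rfl⟩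
  rw [← hW]
  have e1 : (if c = d then L ^ (α - 1) * W * tS (tch c σ) else 0) * Mg =
      tS (fun t => (if c = d then L ^ (α - 1) * W * Mg else 0) * tch c σ t) := by
    rw [tS_mul]; split_ifs <;> ring
  rw [e1, ← tS_mul Mg', ← tS_add, ← tS_mul, ← tS_mul, ← tS_mul, ← tS_add]
  apply tS_mono
  intro t
  show _ ≤ 2 * (σ (c, t) * ((fstar n (tch c σ) (tch c F) Mf' t - Mf) * tB d α (n+1) L u G Mg (c, t)))
  have hB1 : tB d α n (L/2) (tch c u) (tch c G) Mg' t ≤ tB d α (n+1) L u G Mg (c, t) := le_max_right _ _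
  have hB2 : Mg * ttau d α (n+1) L u (c, t) ≤ tB d α (n+1) L u G Mg (c, t) := le_max_left _ _
  have hB3 := tB_ge d α n (L/2) (tch c u) (tch c G) Mg' t
  have ht : ttau d α (n+1) L u (c, t) = (if c = d then L ^ (α - 1) * W else 0) +
      ttau d α n (L/2) (tch c u) t := by rw [hW]; rfl
  have ht0 := ttau_nonneg d α n (L/2) (tch c u) t (by positivity) (fun t => hu _)
  have hst := fstar_ge n (tch c σ) (tch c F) Mf' t
  have hσt : 0 < σ (c, t) := hσ _
  have hσe : tch c σ t = σ (c, t) := rfl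
  rw [hσe]
  set B := tB d α (n+1) L u G Mg (c, t)
  set B' := tB d α n (L/2) (tch c u) (tch c G) Mg' t
  set τ := ttau d α n (L/2) (tch c u) t
  set fs := fstar n (tch c σ) (tch c F) Mf' t
  have h1 : (if c = d then L ^ (α - 1) * W * Mg else 0) ≤ B := by
    rw [ht] at hB2
    have : 0 ≤ Mg * τ := by positivity
    split_ifs at hB2 ⊢ <;> nlinarith
  have h2 : Mg' * τ ≤ B := hB3.trans hB1
  calc _ = σ (c, t) * ((Mf' - Mf) * ((if c = d then L ^ (α - 1) * W * Mg else 0) + Mg' * τ)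
        + 2 * ((fs - Mf') * B')) := by ring
    _ ≤ σ (c, t) * ((Mf' - Mf) * (B + B) + 2 * ((fs - Mf') * B)) := by
        have : 0 ≤ fs - Mf' := by linarith
        gcongr
    _ = _ := by ring

lemma main_ind {α : ℝ} : ∀ (n : ℕ) (L : ℝ) (σ u F G : Leaf n → ℝ) (Mf Mg : ℝ),
    0 < L → (∀ t, 0 < σ t) → (∀ t, 0 < u t) → (∀ t, 0 ≤ F t) → (∀ t, 0 ≤ G t) → 0 ≤ Mf → 0 ≤ Mg →
    tLam α n L F G ≤ Mf * Mg * tLam α n L σ u +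
      2 * tS (fun t => σ t * ((fstar n σ F Mf t - Mf) * tB true α n L u G Mg t)) +
      2 * tS (fun t => u t * ((fstar n u G Mg t - Mg) * tB false α n L σ F Mf t)) +
      tPC α n L σ u F G Mf Mg
  | 0, L, σ, u, F, G, Mf, Mg, hL, hσ, hu, hF, hG, hMf, hMg => by
      simp [tLam, tPC, tB, tS_zero]
  | n + 1, L, σ, u, F, G, Mf, Mg, hL, hσ, hu, hF, hG, hMf, hMg => by
      have ih : ∀ c, _ := fun c => main_ind (α := α) n (L/2) (tch c σ) (tch c u) (tch c F) (tch c G)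
        (max Mf (tS (tch c F) / tS (tch c σ))) (max Mg (tS (tch c G) / tS (tch c u)))
        (by positivity) (fun t => hσ _) (fun t => hu _) (fun t => hF _) (fun t => hG _)
        (hMf.trans (le_max_left _ _)) (hMg.trans (le_max_left _ _))
      have k1 : ∀ c, _ := fun c => claimGen true (α := α) n L σ u F G Mf Mg c hL hσ hu hMg
      have k2 : ∀ c, _ := fun c => claimGen false (α := α) n L u σ G F Mg Mf c hL hu hσ hMf
      simp only [← tLam_eq_true, ← tLam_eq_false] at k1 k2
      have ihl := ih false
      have ihr := ih true
      have k1l := k1 false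
      have k1r := k1 true
      have k2l := k2 false
      have k2r := k2 true
      clear ih k1 k2
      simp only [Bool.false_eq_true, Bool.true_eq_false, if_false, if_true, zero_mul, zero_add,
        Bool.not_true, Bool.not_false] at k1l k1r k2l k2r
      rw [tS_succ (fun t => σ t * ((fstar (n+1) σ F Mf t - Mf) * tB true α (n+1) L u G Mg t)),
        tS_succ (fun t => u t * ((fstar (n+1) u G Mg t - Mg) * tB false α (n+1) L σ F Mf t)),
        tLam, tLam, tPC]
      have hσr : 0 < tS (tch true σ) := tS_pos fun t => hσ _
      have hul : 0 < tS (tch false u) := tS_pos fun t => hu _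
      have hFr : tS (tch true F) ≤ max Mf (tS (tch true F) / tS (tch true σ)) * tS (tch true σ) := by
        rw [← div_le_iff₀ hσr]; exact le_max_right _ _
      have hGl : tS (tch false G) ≤ max Mg (tS (tch false G) / tS (tch false u)) * tS (tch false u) := by
        rw [← div_le_iff₀ hul]; exact le_max_right _ _
      have hFr0 : 0 ≤ tS (tch true F) := tS_nonneg fun t => hF _
      have hGl0 : 0 ≤ tS (tch false G) := tS_nonneg fun t => hG _
      have hA : ∀ c, 0 ≤ tLam α n (L/2) (tch c σ) (tch c u) := by
        intro c
        rw [tLam_eq_true]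
        apply tS_nonneg
        intro t
        exact mul_nonneg (hσ _).le (ttau_nonneg _ _ _ _ _ _ (by positivity) (fun t => hu _))
      have hAl := hA false
      have hAr := hA true
      have hx1 : Mf ≤ max Mf (tS (tch true F) / tS (tch true σ)) := le_max_left _ _
      have hx2 : Mf ≤ max Mf (tS (tch false F) / tS (tch false σ)) := le_max_left _ _
      have hx3 : Mg ≤ max Mg (tS (tch true G) / tS (tch true u)) := le_max_left _ _
      have hx4 : Mg ≤ max Mg (tS (tch false G) / tS (tch false u)) := le_max_left _ _
      generalize max Mf (tS (tch true F) / tS (tch true σ)) = Fr at *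
      generalize max Mf (tS (tch false F) / tS (tch false σ)) = Fl at *
      generalize max Mg (tS (tch true G) / tS (tch true u)) = Gr at *
      generalize max Mg (tS (tch false G) / tS (tch false u)) = Gl at *
      have hX : L ^ (α - 1) * tS (tch true F) * tS (tch false G) ≤
          L ^ (α - 1) * (Fr * tS (tch true σ)) * (Gl * tS (tch false u)) := by
        have : 0 ≤ Fr := hMf.trans hx1
        gcongr
      have m1 : (Gl - Mg) * (Mf * tLam α n (L/2) (tch false σ) (tch false u)) ≤
          (Gl - Mg) * (Fl * tLam α n (L/2) (tch false σ) (tch false u)) := by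
        have : 0 ≤ Gl - Mg := by linarith
        gcongr
      have m2 : (Gr - Mg) * (Mf * tLam α n (L/2) (tch true σ) (tch true u)) ≤
          (Gr - Mg) * (Fr * tLam α n (L/2) (tch true σ) (tch true u)) := by
        have : 0 ≤ Gr - Mg := by linarith
        gcongr
      generalize tS (tch true σ) = σr at *
      generalize tS (tch false u) = ul at *
      generalize L ^ (α - 1) = ll at *
      generalize tLam α n (L/2) (tch false σ) (tch false u) = Al at *
      generalize tLam α n (L/2) (tch true σ) (tch true u) = Ar at *
      linarith

lemma pow_sub_le {x y p : ℝ} (hp : 1 ≤ p) (hy : 0 ≤ y) (hxy : y ≤ x) :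
    (x - y) ^ p ≤ x ^ p - y ^ p := by
  have h := Real.add_rpow_le_rpow_add (sub_nonneg.2 hxy) hy hp
  rw [sub_add_cancel] at h
  linarith

lemma PC_bound {α p r q e s s' K1 : ℝ} (hpr : p.HolderConjugate r) (hqe : q.HolderConjugate e)
    (hss : s.HolderConjugate s') (hs' : (1 - α) * r = s') (hα1 : α < 1) (her : e ≤ r)
    (hsq : (s' - 1) / r = 1 / q) (hK1 : 0 < K1) :
    ∀ (n : ℕ) (L : ℝ) (σ u F G : Leaf n → ℝ) (Mf Mg : ℝ),
    0 < L → (∀ t, 0 < σ t) → (∀ t, 0 < u t) → 0 ≤ Mf → 0 ≤ Mg →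
    Adm true s s' K1 n L σ u →
    tS (fun t => u t * fstar n u G Mg t ^ e) ≤ 1 →
    tPC α n L σ u F G Mf Mg ≤ K1 ^ (1 / r) * (tS (fun t => σ t * (fstar n σ F Mf t ^ p - Mf ^ p)) +
      tS (fun t => u t * (fstar n u G Mg t ^ e - Mg ^ e)))
  | 0, L, σ, u, F, G, Mf, Mg, hL, hσ, hu, hMf, hMg, hA, h1 => by
      simp [tPC, tS_zero, fstar]
  | n + 1, L, σ, u, F, G, Mf, Mg, hL, hσ, hu, hMf, hMg, hA, h1 => by
      have hp0 := hpr.pos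
      have hr0 := hpr.symm.pos
      have hq0 := hqe.pos
      have he0 := hqe.symm.pos
      have h1c : ∀ c, tS (fun t => tch c u t * fstar n (tch c u) (tch c G)
          (max Mg (tS (tch c G) / tS (tch c u))) t ^ e) ≤ 1 := by
        intro c
        refine le_trans ?_ h1
        refine tS_le_succ (f := fun t => u t * fstar (n+1) u G Mg t ^ e) ?_ c
        intro t
        exact mul_nonneg (hu t).le (Real.rpow_nonneg (hMg.trans (fstar_ge _ _ _ _ _)) _)
      have ih : ∀ c, _ := fun c => PC_bound hpr hqe hss hs' hα1 her hsq hK1 n (L/2) (tch c σ) (tch c u)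
        (tch c F) (tch c G)
        (max Mf (tS (tch c F) / tS (tch c σ))) (max Mg (tS (tch c G) / tS (tch c u)))
        (by positivity) (fun t => hσ _) (fun t => hu _)
        (hMf.trans (le_max_left _ _)) (hMg.trans (le_max_left _ _)) (hA.2 c) (h1c c)
      have ef : ∀ c, tS (tch c fun t => σ t * (fstar (n+1) σ F Mf t ^ p - Mf ^ p)) =
          tS (fun t => tch c σ t * (fstar n (tch c σ) (tch c F) (max Mf (tS (tch c F) / tS (tch c σ))) t ^ p
            - (max Mf (tS (tch c F) / tS (tch c σ))) ^ p)) +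
          ((max Mf (tS (tch c F) / tS (tch c σ))) ^ p - Mf ^ p) * tS (tch c σ) := by
        intro c
        rw [← tS_mul, ← tS_add]
        congr 1; funext t
        show σ (c, t) * (fstar n (tch c σ) (tch c F) _ t ^ p - Mf ^ p) = σ (c, t) * _ + _ * σ (c, t)
        ring
      have eg : ∀ c, tS (tch c fun t => u t * (fstar (n+1) u G Mg t ^ e - Mg ^ e)) =
          tS (fun t => tch c u t * (fstar n (tch c u) (tch c G) (max Mg (tS (tch c G) / tS (tch c u))) t ^ e
            - (max Mg (tS (tch c G) / tS (tch c u))) ^ e)) +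
          ((max Mg (tS (tch c G) / tS (tch c u))) ^ e - Mg ^ e) * tS (tch c u) := by
        intro c
        rw [← tS_mul, ← tS_add]
        congr 1; funext t
        show u (c, t) * (fstar n (tch c u) (tch c G) _ t ^ e - Mg ^ e) = u (c, t) * _ + _ * u (c, t)
        ring
      have hg1 : (max Mg (tS (tch false G) / tS (tch false u))) ^ e * tS (tch false u) ≤ 1 := by
        rw [← tS_mul]
        refine le_trans (tS_mono fun t => ?_) (h1c false)
        rw [mul_comm]
        have := fstar_ge n (tch false u) (tch false G) (max Mg (tS (tch false G) / tS (tch false u))) t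
        have : 0 < tch false u t := hu _
        have : 0 ≤ max Mg (tS (tch false G) / tS (tch false u)) := hMg.trans (le_max_left _ _)
        gcongr
      have ihl := ih false
      have ihr := ih true
      have hσp : ∀ c, 0 < tS (tch c σ) := fun c => tS_pos fun t => hσ _
      have hup : ∀ c, 0 < tS (tch c u) := fun c => tS_pos fun t => hu _
      have hσr := hσp true
      have hσl := hσp false
      have hur := hup true
      have hul := hup false
      have hA1 : tS (tch true σ) * tS (tch false u) ^ (s' - 1) ≤ K1 * (L / 2) ^ s' := hA.1
      rw [tS_succ (fun t => σ t * (fstar (n+1) σ F Mf t ^ p - Mf ^ p)),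
        tS_succ (fun t => u t * (fstar (n+1) u G Mg t ^ e - Mg ^ e)), ef, ef, eg, eg, tPC]
      have hx1 : Mf ≤ max Mf (tS (tch true F) / tS (tch true σ)) := le_max_left _ _
      have hx2 : Mf ≤ max Mf (tS (tch false F) / tS (tch false σ)) := le_max_left _ _
      have hx3 : Mg ≤ max Mg (tS (tch true G) / tS (tch true u)) := le_max_left _ _
      have hx4 : Mg ≤ max Mg (tS (tch false G) / tS (tch false u)) := le_max_left _ _
      clear ih ef eg
      generalize max Mf (tS (tch true F) / tS (tch true σ)) = Fr at *
      generalize max Mf (tS (tch false F) / tS (tch false σ)) = Fl at *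
      generalize max Mg (tS (tch true G) / tS (tch true u)) = Gr at *
      generalize max Mg (tS (tch false G) / tS (tch false u)) = Gl at *
      generalize tS (tch true σ) = σr at *
      generalize tS (tch false u) = ul at *
      generalize tS (tch false σ) = σl at *
      generalize tS (tch true u) = ur at *
      have hκ : L ^ (α - 1) * (σr ^ (1 / r) * ul ^ (1 / q)) ≤ K1 ^ (1 / r) := by
        have h2 := Real.rpow_le_rpow (z := 1 / r) (by positivity) hA1 (by positivity)
        rw [Real.mul_rpow (by positivity) (by positivity), Real.mul_rpow (by positivity) (by positivity),
          ← Real.rpow_mul hul.le, ← Real.rpow_mul (by positivity)] at h2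
        have e1 : (s' - 1) * (1 / r) = 1 / q := by rw [← hsq]; ring
        have e2 : s' * (1 / r) = 1 - α := by rw [← hs']; field_simp
        rw [e1, e2] at h2
        have h3 : (L / 2) ^ (1 - α) ≤ L ^ (1 - α) := by
          have : 0 < 1 - α := by linarith
          gcongr; linarith
        have h4 : L ^ (α - 1) * L ^ (1 - α) = 1 := by
          rw [← Real.rpow_add hL]; simp
        calc _ ≤ L ^ (α - 1) * (K1 ^ (1 / r) * (L / 2) ^ (1 - α)) := by gcongr
          _ ≤ L ^ (α - 1) * (K1 ^ (1 / r) * L ^ (1 - α)) := by gcongr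
          _ = K1 ^ (1 / r) * (L ^ (α - 1) * L ^ (1 - α)) := by ring
          _ = _ := by rw [h4, mul_one]
      have hb1 : (Gl - Mg) ^ e ≤ Gl ^ e - Mg ^ e := pow_sub_le hqe.symm.lt.le hMg hx4
      have ha1 : (Fr - Mf) ^ p ≤ Fr ^ p - Mf ^ p := pow_sub_le hpr.lt.le hMf hx1
      have hΔf : 0 ≤ Fr - Mf := by linarith
      have hΔg : 0 ≤ Gl - Mg := by linarith
      have hterm : L ^ (α - 1) * σr * ul * ((Fr - Mf) * (Gl - Mg)) ≤
          K1 ^ (1 / r) * ((Fr ^ p - Mf ^ p) * σr + (Gl ^ e - Mg ^ e) * ul) := by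
        have e1 : σr = σr ^ (1 / r) * σr ^ (1 / p) := by
          rw [← Real.rpow_add hσr, one_div, one_div, add_comm, hpr.inv_add_inv_eq_one, Real.rpow_one]
        have e2 : ul = ul ^ (1 / q) * ul ^ (1 / e) := by
          rw [← Real.rpow_add hul, one_div, one_div, hqe.inv_add_inv_eq_one, Real.rpow_one]
        have hap : (σr ^ (1 / p) * (Fr - Mf)) ^ p = σr * (Fr - Mf) ^ p := by
          rw [Real.mul_rpow (by positivity) hΔf, ← Real.rpow_mul hσr.le, one_div_mul_cancel hp0.ne',
            Real.rpow_one]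
        have hbe : (ul ^ (1 / e) * (Gl - Mg)) ^ e = ul * (Gl - Mg) ^ e := by
          rw [Real.mul_rpow (by positivity) hΔg, ← Real.rpow_mul hul.le, one_div_mul_cancel he0.ne',
            Real.rpow_one]
        set a := σr ^ (1 / p) * (Fr - Mf) with ha
        set b := ul ^ (1 / e) * (Gl - Mg) with hb
        have ha0 : 0 ≤ a := by positivity
        have hb0 : 0 ≤ b := by positivity
        have hbe1 : b ^ e ≤ 1 := by
          rw [hbe]
          have : 0 ≤ Mg ^ e := Real.rpow_nonneg hMg _
          have h9 : ul * (Gl - Mg) ^ e ≤ ul * Gl ^ e := by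
            gcongr; linarith
          linarith
        have hb1' : b ≤ 1 := by
          by_contra h
          have := Real.one_lt_rpow (not_le.1 h) he0
          linarith
        have hY := Real.young_inequality_of_nonneg ha0 hb0 hpr
        have hbr : b ^ r ≤ b ^ e := by
          rcases eq_or_lt_of_le hb0 with h | h
          · rw [← h, Real.zero_rpow hr0.ne', Real.zero_rpow he0.ne']
          · exact Real.rpow_le_rpow_of_exponent_ge h hb1' her
        have hY2 : a * b ≤ a ^ p + b ^ e := by
          have i1 : a ^ p / p ≤ a ^ p := div_le_self (by positivity) hpr.lt.le
          have i2 : b ^ r / r ≤ b ^ r := div_le_self (by positivity) hpr.symm.lt.le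
          linarith
        calc L ^ (α - 1) * σr * ul * ((Fr - Mf) * (Gl - Mg))
            = L ^ (α - 1) * (σr ^ (1 / r) * σr ^ (1 / p)) * (ul ^ (1 / q) * ul ^ (1 / e)) * ((Fr - Mf) * (Gl - Mg)) := by
                rw [← e1, ← e2]
          _ = (L ^ (α - 1) * (σr ^ (1 / r) * ul ^ (1 / q))) * (a * b) := by rw [ha, hb]; ring
          _ ≤ K1 ^ (1 / r) * (a ^ p + b ^ e) := by gcongr
          _ = K1 ^ (1 / r) * (σr * (Fr - Mf) ^ p + ul * (Gl - Mg) ^ e) := by rw [hap, hbe]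
          _ ≤ K1 ^ (1 / r) * (σr * (Fr ^ p - Mf ^ p) + ul * (Gl ^ e - Mg ^ e)) := by gcongr
          _ = _ := by ring
      have hFl : 0 ≤ K1 ^ (1 / r) * ((Fl ^ p - Mf ^ p) * σl) := by
        have : Mf ^ p ≤ Fl ^ p := by gcongr
        have : 0 ≤ Fl ^ p - Mf ^ p := by linarith
        positivity
      have hGr : 0 ≤ K1 ^ (1 / r) * ((Gr ^ e - Mg ^ e) * ur) := by
        have : Mg ^ e ≤ Gr ^ e := by gcongr
        have : 0 ≤ Gr ^ e - Mg ^ e := by linarith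
        positivity
      generalize K1 ^ (1 / r) = κ at *
      clear hκ hA1 h1c h1 hσp hup hg1 hb1 ha1
      linarith

lemma young_sum {p r N C : ℝ} (hpr : p.HolderConjugate r) (hN : 0 < N) (n : ℕ) (σ f B : Leaf n → ℝ)
    (hσ : ∀ t, 0 < σ t) (hf : ∀ t, 0 ≤ f t) (hB : ∀ t, 0 ≤ B t)
    (h1 : tS (fun t => σ t * f t ^ p) ≤ 1) (h2 : tS (fun t => σ t * B t ^ r) ≤ C * N ^ r) :
    tS (fun t => σ t * (f t * B t)) ≤ N * (1 + C) := by
  have hr0 := hpr.symm.pos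
  have h3 : ∀ t, σ t * (f t * B t) ≤ N * (σ t * f t ^ p) + (N * (N ^ r)⁻¹) * (σ t * B t ^ r) := by
    intro t
    have hft := hf t
    have hBt := hB t
    have hσt := hσ t
    have hY := Real.young_inequality_of_nonneg hft (show 0 ≤ B t / N by positivity) hpr
    have i1 : f t ^ p / p ≤ f t ^ p := div_le_self (by positivity) hpr.lt.le
    have i2 : (B t / N) ^ r / r ≤ (B t / N) ^ r := div_le_self (by positivity) hpr.symm.lt.le
    have hY2 : f t * (B t / N) ≤ f t ^ p + (B t / N) ^ r := by linarith
    rw [Real.div_rpow hBt hN.le] at hY2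
    calc σ t * (f t * B t) = N * σ t * (f t * (B t / N)) := by field_simp
      _ ≤ N * σ t * (f t ^ p + B t ^ r / N ^ r) := by gcongr
      _ = _ := by ring
  have h4 := tS_mono h3
  rw [tS_add, tS_mul, tS_mul] at h4
  refine h4.trans ?_
  have hNr : 0 < N ^ r := by positivity
  calc _ ≤ N * 1 + (N * (N ^ r)⁻¹) * (C * N ^ r) := by gcongr
    _ = _ := by field_simp

structure Params (α p r q e s s' : ℝ) : Prop where
  hα : 0 < α
  hα1 : α < 1
  hpr : p.HolderConjugate r
  hqe : q.HolderConjugate e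
  hss : s.HolderConjugate s'
  hs' : (1 - α) * r = s'
  hs : (1 - α) * q = s
  hr : r = e * (1 + α * r)
  hq : q = p * (1 + α * q)
  her : e ≤ r
  hsq : (s' - 1) / r = 1 / q

def treeC (α r q s s' : ℝ) : ℝ :=
  2 * (1 + (1 / α) ^ r * (s' * 2 ^ s / s)) + 2 * (1 + (1 / α) ^ q * (s * 2 ^ s' / s')) + 2

lemma tree_norm {α p r q e s s' K : ℝ} (P : Params α p r q e s s') (hK : 1 ≤ K)
    (n : ℕ) (L : ℝ) (σ u F G : Leaf n → ℝ) (hL : 0 < L) (hσ : ∀ t, 0 < σ t) (hu : ∀ t, 0 < u t)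
    (hF : ∀ t, 0 ≤ F t) (hG : ∀ t, 0 ≤ G t)
    (hA1 : Adm true s s' (K ^ (s' - 1)) n L σ u) (hA2 : Adm false s' s K n L u σ)
    (h1 : tS (fun t => σ t * fstar n σ F (tS F / tS σ) t ^ p) ≤ 1)
    (h2 : tS (fun t => u t * fstar n u G (tS G / tS u) t ^ e) ≤ 1) :
    tLam α n L F G ≤ treeC α r q s s' * K ^ ((1 - α) * max 1 (r / q)) := by
  have hα := P.hα
  have hα1 := P.hα1
  have hp0 := P.hpr.pos
  have hr0 := P.hpr.symm.pos
  have hq0 := P.hqe.pos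
  have he0 := P.hqe.symm.pos
  have hs0 := P.hss.pos
  have hs'0 := P.hss.symm.pos
  have hK0 : 0 < K := by linarith
  have hMf : 0 ≤ tS F / tS σ := div_nonneg (tS_nonneg hF) (tS_pos hσ).le
  have hMg : 0 ≤ tS G / tS u := div_nonneg (tS_nonneg hG) (tS_pos hu).le
  set Mf := tS F / tS σ
  set Mg := tS G / tS u
  have hm := main_ind (α := α) n L σ u F G Mf Mg hL hσ hu hF hG hMf hMg
  have hPC := PC_bound P.hpr P.hqe P.hss P.hs' hα1 P.her P.hsq (K1 := K ^ (s' - 1)) (by positivity)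
    n L σ u F G Mf Mg hL hσ hu hMf hMg hA1 h2
  have hB1 := tB_sum true hα hα1 P.hss (K := K ^ (s' - 1)) (by positivity) he0 hr0 P.hr P.hs' n L σ u G Mg
    hL hσ hu hA1 hMg h2
  have hB2 := tB_sum false hα hα1 P.hss.symm hK0 hp0 hq0 P.hq P.hs n L u σ F Mf
    hL hu hσ hA2 hMf h1
  set C1 := (1 / α) ^ r * (s' * 2 ^ s / s) with hC1
  set C2 := (1 / α) ^ q * (s * 2 ^ s' / s') with hC2
  have hC10 : 0 ≤ C1 := by positivity
  have hC20 : 0 ≤ C2 := by positivity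
  have eB1 : (1 / α) ^ r * (s' * (2 * K ^ (s' - 1)) ^ s / s) = C1 * (K ^ (1 - α)) ^ r := by
    have k1 : (K ^ (s' - 1)) ^ s = K ^ s' := by
      rw [← Real.rpow_mul hK0.le]; congr 1; exact P.hss.symm.sub_one_mul_conj
    rw [Real.mul_rpow (by norm_num) (by positivity), k1, ← Real.rpow_mul hK0.le, P.hs', hC1]; ring
  have eB2 : (1 / α) ^ q * (s * (2 * K) ^ s' / s') = C2 * (K ^ ((1 - α) * (r / q))) ^ q := by
    have k1 : (1 - α) * (r / q) * q = s' := by rw [← P.hs']; field_simp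
    rw [Real.mul_rpow (by norm_num) (by positivity), ← Real.rpow_mul hK0.le, k1, hC2]; ring
  rw [eB1] at hB1
  rw [eB2] at hB2
  have hfF : ∀ t, Mf ≤ fstar n σ F Mf t := fstar_ge _ _ _ _
  have hfG : ∀ t, Mg ≤ fstar n u G Mg t := fstar_ge _ _ _ _
  have y1 := young_sum P.hpr (N := K ^ (1 - α)) (by positivity) n σ (fstar n σ F Mf) (tB true α n L u G Mg) hσ
    (fun t => hMf.trans (hfF t)) (tB_nonneg _ _ _ _ _ _ _) h1 hB1
  have y2 := young_sum P.hqe.symm (N := K ^ ((1 - α) * (r / q))) (by positivity) n u (fstar n u G Mg)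
    (tB false α n L σ F Mf) hu
    (fun t => hMg.trans (hfG t)) (tB_nonneg _ _ _ _ _ _ _) h2 hB2
  have hN1 : K ^ (1 - α) ≤ K ^ ((1 - α) * max 1 (r / q)) := by
    apply Real.rpow_le_rpow_of_exponent_le hK
    have : 0 ≤ 1 - α := by linarith
    nlinarith [le_max_left 1 (r / q)]
  have hN2 : K ^ ((1 - α) * (r / q)) ≤ K ^ ((1 - α) * max 1 (r / q)) := by
    apply Real.rpow_le_rpow_of_exponent_le hK
    have : 0 ≤ 1 - α := by linarith
    nlinarith [le_max_right 1 (r / q)]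
  have hN3 : (K ^ (s' - 1)) ^ (1 / r) ≤ K ^ ((1 - α) * max 1 (r / q)) := by
    refine le_trans ?_ hN1
    rw [← Real.rpow_mul hK0.le]
    apply Real.rpow_le_rpow_of_exponent_le hK
    rw [← P.hs', mul_one_div, div_le_iff₀ hr0]; linarith
  set Kγ := K ^ ((1 - α) * max 1 (r / q))
  have hA0 : Mf * Mg * tLam α n L σ u ≤ tS (fun t => σ t * (Mf * tB true α n L u G Mg t)) := by
    rw [tLam_eq_true, ← tS_mul]
    apply tS_mono
    intro t
    have := tB_ge true α n L u G Mg t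
    have := hσ t
    calc _ = σ t * (Mf * (Mg * ttau true α n L u t)) := by ring
      _ ≤ _ := by gcongr
  have hT1 : Mf * Mg * tLam α n L σ u +
      2 * tS (fun t => σ t * ((fstar n σ F Mf t - Mf) * tB true α n L u G Mg t)) ≤
      2 * tS (fun t => σ t * (fstar n σ F Mf t * tB true α n L u G Mg t)) := by
    refine (add_le_add_left hA0 _).trans ?_
    rw [← tS_mul, ← tS_mul, ← tS_add]
    apply tS_mono
    intro t
    have h5 := tB_nonneg true α n L u G Mg t
    have h6 := hσ t
    have h7 : 0 ≤ σ t * (Mf * tB true α n L u G Mg t) := by positivity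
    nlinarith
  have hT2 : tS (fun t => u t * ((fstar n u G Mg t - Mg) * tB false α n L σ F Mf t)) ≤
      tS (fun t => u t * (fstar n u G Mg t * tB false α n L σ F Mf t)) := by
    apply tS_mono
    intro t
    have := tB_nonneg false α n L σ F Mf t
    have := hu t
    gcongr
    linarith
  have hP1 : tS (fun t => σ t * (fstar n σ F Mf t ^ p - Mf ^ p)) ≤ 1 := by
    refine le_trans (tS_mono fun t => ?_) h1
    have := hσ t
    have := Real.rpow_nonneg hMf p
    gcongr; linarith
  have hP2 : tS (fun t => u t * (fstar n u G Mg t ^ e - Mg ^ e)) ≤ 1 := by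
    refine le_trans (tS_mono fun t => ?_) h2
    have := hu t
    have := Real.rpow_nonneg hMg e
    gcongr; linarith
  have hPC2 : tPC α n L σ u F G Mf Mg ≤ Kγ * 2 := by
    refine hPC.trans ?_
    calc _ ≤ (K ^ (s' - 1)) ^ (1 / r) * 2 := by gcongr; linarith
      _ ≤ _ := by gcongr
  have y1' : tS (fun t => σ t * (fstar n σ F Mf t * tB true α n L u G Mg t)) ≤ Kγ * (1 + C1) :=
    y1.trans (by gcongr)
  have y2' : tS (fun t => u t * (fstar n u G Mg t * tB false α n L σ F Mf t)) ≤ Kγ * (1 + C2) :=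
    y2.trans (by gcongr)
  rw [treeC, ← hC1, ← hC2]
  linarith

def treeD (α p r q e s s' : ℝ) : ℝ :=
  treeC α r q s s' * ((r * 2 ^ p / p) ^ (1 / p) * (q * 2 ^ e / e) ^ (1 / e))

theorem tree_thm {α p r q e s s' K : ℝ} (P : Params α p r q e s s') (hK : 1 ≤ K)
    (n : ℕ) (L : ℝ) (σ u F G : Leaf n → ℝ) (hL : 0 < L) (hσ : ∀ t, 0 < σ t) (hu : ∀ t, 0 < u t)
    (hF : ∀ t, 0 ≤ F t) (hG : ∀ t, 0 ≤ G t)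
    (hA1 : Adm true s s' (K ^ (s' - 1)) n L σ u) (hA2 : Adm false s' s K n L u σ)
    (X Y : ℝ) (hX : 0 < X) (hY : 0 < Y)
    (h1 : tS (fun t => F t ^ p * σ t ^ (1 - p)) ≤ X ^ p)
    (h2 : tS (fun t => G t ^ e * u t ^ (1 - e)) ≤ Y ^ e) :
    tLam α n L F G ≤ treeD α p r q e s s' * K ^ ((1 - α) * max 1 (r / q)) * (X * Y) := by
  have hp0 := P.hpr.pos
  have hr0 := P.hpr.symm.pos
  have hq0 := P.hqe.pos
  have he0 := P.hqe.symm.pos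
  set D1 := r * 2 ^ p / p with hD1
  set D2 := q * 2 ^ e / e with hD2
  have hD10 : 0 < D1 := by positivity
  have hD20 : 0 < D2 := by positivity
  have gen : ∀ (p D X : ℝ) (σ F : Leaf n → ℝ), 0 < p → 0 < D → 0 < X → (∀ t, 0 ≤ F t) →
      tS (fun t => F t ^ p * σ t ^ (1 - p)) ≤ X ^ p →
      D * tS (fun t => ((D ^ (1 / p) * X)⁻¹ * F t) ^ p * σ t ^ (1 - p)) ≤ 1 := by
    intro p D X σ F hp hD hX hF h
    have e1 : (fun t => ((D ^ (1 / p) * X)⁻¹ * F t) ^ p * σ t ^ (1 - p)) =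
        fun t => (D * X ^ p)⁻¹ * (F t ^ p * σ t ^ (1 - p)) := by
      funext t
      rw [Real.mul_rpow (by positivity) (hF t), Real.inv_rpow (by positivity),
        Real.mul_rpow (by positivity) (by positivity), ← Real.rpow_mul hD.le,
        one_div_mul_cancel hp.ne', Real.rpow_one]; ring
    rw [e1, tS_mul]
    have : 0 < X ^ p := by positivity
    calc _ ≤ D * ((D * X ^ p)⁻¹ * X ^ p) := by gcongr
      _ = 1 := by field_simp
  have g1 := gen p D1 X σ F hp0 hD10 hX hF h1
  have g2 := gen e D2 Y u G he0 hD20 hY hG h2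
  set a := (D1 ^ (1 / p) * X) with ha
  set b := (D2 ^ (1 / e) * Y) with hb
  have ha0 : 0 < a := by positivity
  have hb0 : 0 < b := by positivity
  have hF' : ∀ t, 0 ≤ a⁻¹ * F t := fun t => mul_nonneg (by positivity) (hF t)
  have hG' : ∀ t, 0 ≤ b⁻¹ * G t := fun t => mul_nonneg (by positivity) (hG t)
  have d1 := (doob P.hpr n σ (fun t => a⁻¹ * F t) hσ hF').trans g1
  have d2 := (doob P.hqe.symm n u (fun t => b⁻¹ * G t) hu hG').trans g2
  have := tree_norm P hK n L σ u _ _ hL hσ hu hF' hG' hA1 hA2 d1 d2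
  rw [tLam_smul, ← mul_inv, inv_mul_le_iff₀ (by positivity)] at this
  refine this.trans (le_of_eq ?_)
  rw [treeD, ← hD1, ← hD2, ha, hb]; ring

/-- leaf data from an interval function -/
def leafI (I : ℝ → ℝ → ℝ) : (n : ℕ) → ℝ → ℝ → Leaf n → ℝ
  | 0, a, L, _ => I a L
  | n + 1, a, L, x => leafI I n (if x.1 then a + L / 2 else a) (L / 2) x.2

lemma tch_leafI_true (I : ℝ → ℝ → ℝ) (n : ℕ) (a L : ℝ) :
    tch true (leafI I (n+1) a L) = leafI I n (a + L / 2) (L / 2) := by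
  funext t; rfl

lemma tch_leafI_false (I : ℝ → ℝ → ℝ) (n : ℕ) (a L : ℝ) :
    tch false (leafI I (n+1) a L) = leafI I n a (L / 2) := by
  funext t; rfl

lemma tS_leafI {I : ℝ → ℝ → ℝ} (hI : ∀ a L, 0 < L → I a L = I a (L/2) + I (a + L/2) (L/2)) :
    ∀ (n : ℕ) (a L : ℝ), 0 < L → tS (leafI I n a L) = I a L
  | 0, _, _, _ => rfl
  | n + 1, a, L, hL => by
      have hL2 : 0 < L / 2 := by positivity
      rw [tS_succ, tch_leafI_true, tch_leafI_false, tS_leafI hI n _ _ hL2, tS_leafI hI n _ _ hL2,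
        hI a L hL]

lemma leafI_ex : ∀ (n : ℕ) (a L : ℝ), 0 < L → ∀ t : Leaf n, ∃ a' L', 0 < L' ∧
    ∀ I : ℝ → ℝ → ℝ, leafI I n a L t = I a' L'
  | 0, a, L, hL, _ => ⟨a, L, hL, fun _ => rfl⟩
  | n + 1, a, L, hL, t => by
      obtain ⟨a', L', h, h'⟩ := leafI_ex n (if t.1 then a + L / 2 else a) (L / 2) (by positivity) t.2
      exact ⟨a', L', h, fun I => h' I⟩

lemma adm_false_leafI {s0 s1 K : ℝ} {U V : ℝ → ℝ → ℝ}
    (hU : ∀ a L, 0 < L → U a L = U a (L/2) + U (a + L/2) (L/2))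
    (hV : ∀ a L, 0 < L → V a L = V a (L/2) + V (a + L/2) (L/2))
    (h1 : ∀ a L, 0 < L → U a L * V (a + L) L ^ (s1 - 1) ≤ K * L ^ s1)
    (h2 : ∀ a L, 0 < L → L ≤ V a L ^ (1 / s0) * U a L ^ (1 / s1)) :
    ∀ (n : ℕ) (a L : ℝ), 0 < L → Adm false s0 s1 K n L (leafI U n a L) (leafI V n a L)
  | 0, a, L, hL => h2 a L hL
  | n + 1, a, L, hL => by
      have hL2 : 0 < L / 2 := by positivity
      have ih := adm_false_leafI hU hV h1 h2 n
      refine ⟨?_, ?_⟩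
      · rw [Bool.not_false, tch_leafI_true, tch_leafI_false, tS_leafI hU n _ _ hL2, tS_leafI hV n _ _ hL2]
        exact h1 a (L/2) hL2
      · intro c
        cases c
        · rw [tch_leafI_false, tch_leafI_false]; exact ih _ _ hL2
        · rw [tch_leafI_true, tch_leafI_true]; exact ih _ _ hL2

lemma adm_true_leafI {s0 s1 K : ℝ} {U V : ℝ → ℝ → ℝ}
    (hU : ∀ a L, 0 < L → U a L = U a (L/2) + U (a + L/2) (L/2))
    (hV : ∀ a L, 0 < L → V a L = V a (L/2) + V (a + L/2) (L/2))
    (h1 : ∀ a L, 0 < L → V (a + L) L * U a L ^ (s1 - 1) ≤ K * L ^ s1)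
    (h2 : ∀ a L, 0 < L → L ≤ U a L ^ (1 / s0) * V a L ^ (1 / s1)) :
    ∀ (n : ℕ) (a L : ℝ), 0 < L → Adm true s0 s1 K n L (leafI V n a L) (leafI U n a L)
  | 0, a, L, hL => h2 a L hL
  | n + 1, a, L, hL => by
      have hL2 : 0 < L / 2 := by positivity
      have ih := adm_true_leafI hU hV h1 h2 n
      refine ⟨?_, ?_⟩
      · rw [Bool.not_true, tch_leafI_true, tch_leafI_false, tS_leafI hU n _ _ hL2, tS_leafI hV n _ _ hL2]
        exact h1 a (L/2) hL2
      · intro c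
        cases c
        · rw [tch_leafI_false, tch_leafI_false]; exact ih _ _ hL2
        · rw [tch_leafI_true, tch_leafI_true]; exact ih _ _ hL2

theorem line_tree {α p r q e s s' K : ℝ} (P : Params α p r q e s s') (hK : 1 ≤ K)
    {U V F G J H : ℝ → ℝ → ℝ}
    (hU : ∀ a L, 0 < L → U a L = U a (L/2) + U (a + L/2) (L/2))
    (hV : ∀ a L, 0 < L → V a L = V a (L/2) + V (a + L/2) (L/2))
    (hJ : ∀ a L, 0 < L → J a L = J a (L/2) + J (a + L/2) (L/2))
    (hH : ∀ a L, 0 < L → H a L = H a (L/2) + H (a + L/2) (L/2))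
    (hU0 : ∀ a L, 0 < L → 0 < U a L) (hV0 : ∀ a L, 0 < L → 0 < V a L)
    (hF0 : ∀ a L, 0 < L → 0 ≤ F a L) (hG0 : ∀ a L, 0 < L → 0 ≤ G a L)
    (h1 : ∀ a L, 0 < L → U a L * V (a + L) L ^ (s - 1) ≤ K * L ^ s)
    (h2 : ∀ a L, 0 < L → L ≤ U a L ^ (1 / s) * V a L ^ (1 / s'))
    (hFJ : ∀ a L, 0 < L → F a L ^ p * V a L ^ (1 - p) ≤ J a L)
    (hGH : ∀ a L, 0 < L → G a L ^ e * U a L ^ (1 - e) ≤ H a L)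
    (X Y : ℝ) (hX : 0 < X) (hY : 0 < Y) (n : ℕ) (a L : ℝ) (hL : 0 < L)
    (hJX : J a L ≤ X ^ p) (hHY : H a L ≤ Y ^ e) :
    tLam α n L (leafI F n a L) (leafI G n a L) ≤
      treeD α p r q e s s' * K ^ ((1 - α) * max 1 (r / q)) * (X * Y) := by
  have hs0 := P.hss.pos
  have hs'0 := P.hss.symm.pos
  have hs1 := P.hss.symm.lt
  have hK0 : 0 < K := by linarith
  have h3 : ∀ a L, 0 < L → V (a + L) L * U a L ^ (s' - 1) ≤ K ^ (s' - 1) * L ^ s' := by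
    intro a L hL
    have hu := hU0 a L hL
    have hv := hV0 (a + L) L hL
    have h := Real.rpow_le_rpow (by positivity) (h1 a L hL) (show 0 ≤ s' - 1 by linarith)
    rw [Real.mul_rpow (by positivity) (by positivity), Real.mul_rpow (by positivity) (by positivity),
      ← Real.rpow_mul hv.le, ← Real.rpow_mul hL.le] at h
    have e1 : (s - 1) * (s' - 1) = 1 := by
      have := P.hss.mul_eq_add
      linarith
    have e2 : s * (s' - 1) = s' := by rw [mul_comm]; exact P.hss.symm.sub_one_mul_conj
    rw [e1, e2, Real.rpow_one] at h
    linarith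
  have hp : ∀ {I : ℝ → ℝ → ℝ}, (∀ a L, 0 < L → 0 < I a L) → ∀ t, 0 < leafI I n a L t := by
    intro I hI t
    obtain ⟨a', L', h, h'⟩ := leafI_ex n a L hL t
    rw [h']; exact hI _ _ h
  have hn : ∀ {I : ℝ → ℝ → ℝ}, (∀ a L, 0 < L → 0 ≤ I a L) → ∀ t, 0 ≤ leafI I n a L t := by
    intro I hI t
    obtain ⟨a', L', h, h'⟩ := leafI_ex n a L hL t
    rw [h']; exact hI _ _ h
  refine tree_thm P hK n L (leafI V n a L) (leafI U n a L) _ _ hL (hp hV0) (hp hU0) (hn hF0) (hn hG0)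
    (adm_true_leafI hU hV h3 h2 n a L hL)
    (adm_false_leafI hU hV h1 (fun a L hL => by rw [mul_comm]; exact h2 a L hL) n a L hL) X Y hX hY ?_ ?_
  · refine le_trans (tS_mono (g := leafI J n a L) ?_) ((tS_leafI hJ n a L hL).trans_le hJX)
    intro t
    obtain ⟨a', L', h, h'⟩ := leafI_ex n a L hL t
    rw [h', h', h']; exact hFJ _ _ h
  · refine le_trans (tS_mono (g := leafI H n a L) ?_) ((tS_leafI hH n a L hL).trans_le hHY)
    intro t
    obtain ⟨a', L', h, h'⟩ := leafI_ex n a L hL t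
    rw [h', h', h']; exact hGH _ _ h

/-- the constant is at least one -/
lemma one_le_of_char {s s' K : ℝ} (hss : s.HolderConjugate s') {U V : ℝ → ℝ → ℝ} (hK0 : 0 ≤ K)
    (hU : ∀ a L, 0 < L → U a L = U a (L/2) + U (a + L/2) (L/2))
    (hU0 : ∀ a L, 0 < L → 0 < U a L) (hV0 : ∀ a L, 0 < L → 0 < V a L)
    (h1 : ∀ a L, 0 < L → U a L * V (a + L) L ^ (s - 1) ≤ K * L ^ s)
    (h2 : ∀ a L, 0 < L → L ≤ U a L ^ (1 / s) * V a L ^ (1 / s')) : 1 ≤ K := by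
  have hs0 := hss.pos
  have hs'0 := hss.symm.pos
  have base : ∀ a L, 0 < L → U a L ≤ K * U (a + L) L := by
    intro a L hL
    have hv := hV0 (a + L) L hL
    have hu := hU0 (a + L) L hL
    have h3 := Real.rpow_le_rpow hL.le (h2 (a + L) L hL) hs0.le
    rw [Real.mul_rpow (by positivity) (by positivity), ← Real.rpow_mul hu.le, ← Real.rpow_mul hv.le,
      one_div_mul_cancel hs0.ne', Real.rpow_one,
      show 1 / s' * s = s - 1 by rw [← hss.div_conj_eq_sub_one]; ring] at h3
    have h4 : U a L * V (a + L) L ^ (s - 1) ≤ K * U (a + L) L * V (a + L) L ^ (s - 1) :=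
      (h1 a L hL).trans (by rw [mul_assoc]; gcongr)
    exact le_of_mul_le_mul_right h4 (by positivity)
  have ind : ∀ k : ℕ, ∀ a L, 0 < L → U a L ≤ K ^ (2 ^ k) * U (a + L) L := by
    intro k
    induction k with
    | zero => simpa using base
    | succ k ih =>
      intro a L hL
      have hL2 : 0 < L / 2 := by positivity
      have i1 := ih a (L/2) hL2
      have i2 := ih (a + L/2) (L/2) hL2
      have i3 := ih (a + L/2 + L/2) (L/2) hL2
      have e1 : a + L/2 + L/2 = a + L := by ring
      rw [e1] at i2 i3
      rw [hU a L hL, hU (a + L) L hL]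
      have hk : 0 ≤ K ^ (2 ^ k) := by positivity
      have e2 : K ^ (2 ^ (k+1)) = K ^ (2^k) * K ^ (2^k) := by rw [← pow_add]; congr 1; ring
      rw [e2]
      have j1 : U a (L/2) ≤ K ^ (2^k) * (K ^ (2^k) * U (a + L) (L/2)) := i1.trans (by gcongr)
      have j2 : U (a + L/2) (L/2) ≤ K ^ (2^k) * (K ^ (2^k) * U (a + L + L/2) (L/2)) := i2.trans (by gcongr)
      linarith
  by_contra hlt
  push Not at hlt
  have hlim : Tendsto (fun k : ℕ => K ^ (2 ^ k) * U (0 + 1) 1) atTop (nhds (0 * U (0 + 1) 1)) := by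
    apply Tendsto.mul_const
    exact (tendsto_pow_atTop_nhds_zero_of_lt_one hK0 hlt).comp
      (tendsto_pow_atTop_atTop_of_one_lt (by norm_num))
  have := ge_of_tendsto' hlim (fun k => ind k 0 1 one_pos)
  have := hU0 0 1 one_pos
  linarith

/-- tree kernel -/
def tker (α : ℝ) : (n : ℕ) → ℝ → ℝ → ℝ → ℝ → ℝ≥0∞
  | 0, _, _, _, _ => 0
  | n + 1, a, L, x, t => ENNReal.ofReal (L ^ (α - 1)) *
      ((Ioc a (a + L/2)).indicator 1 x * (Ioc (a + L/2) (a + L/2 + L/2)).indicator 1 t) +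
      (tker α n a (L/2) x t + tker α n (a + L/2) (L/2) x t)

lemma tker_lower (α : ℝ) : ∀ (k n m : ℕ) (a L x t : ℝ), k < n → m < 2 ^ k →
    x ∈ Ioc (a + m * (L / 2 ^ k)) (a + m * (L / 2 ^ k) + L / 2 ^ k / 2) →
    t ∈ Ioc (a + m * (L / 2 ^ k) + L / 2 ^ k / 2) (a + m * (L / 2 ^ k) + L / 2 ^ k) →
    ENNReal.ofReal ((L / 2 ^ k) ^ (α - 1)) ≤ tker α n a L x t
  | _, 0, _, _, _, _, _, h, _, _, _ => by omega
  | 0, n + 1, m, a, L, x, t, _, hm, hx, ht => by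
      have hm0 : m = 0 := by omega
      subst hm0
      simp only [Nat.cast_zero, zero_mul, add_zero, pow_zero, div_one] at hx ht ⊢
      have ht' : t ∈ Ioc (a + L/2) (a + L/2 + L/2) := by
        rw [add_assoc, add_halves]; exact ht
      rw [tker, indicator_of_mem hx, indicator_of_mem ht']
      simp
  | k + 1, n + 1, m, a, L, x, t, hk, hm, hx, ht => by
      have e : L / 2 ^ (k+1) = L / 2 / 2 ^ k := by rw [pow_succ]; field_simp
      rw [e] at hx ht ⊢
      have hk' : k < n := by omega
      by_cases hmk : m < 2 ^ k
      · have := tker_lower α k n m a (L/2) x t hk' hmk hx ht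
        rw [tker]
        exact this.trans (le_trans (le_add_right le_rfl) (le_add_left le_rfl))
      · obtain ⟨m', rfl⟩ := Nat.exists_eq_add_of_le (not_lt.1 hmk)
        have hm' : m' < 2 ^ k := by rw [pow_succ] at hm; omega
        have e2 : a + ((2 ^ k + m' : ℕ) : ℝ) * (L / 2 / 2 ^ k) = a + L / 2 + m' * (L / 2 / 2 ^ k) := by
          push_cast; field_simp; ring
        rw [e2] at hx ht
        have := tker_lower α k n m' (a + L/2) (L/2) x t hk' hm' hx ht
        rw [tker]
        exact this.trans (le_trans (le_add_left le_rfl) (le_add_left le_rfl))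

lemma geom {α : ℝ} (hα1 : α < 1) {R x t : ℝ} (hR : 0 < R) (hx : x ∈ Ioc (-R) R) (ht : t ∈ Ioc (-R) R)
    (hxt : x < t) (n : ℕ) (hn : 4 * R / (t - x) < 2 ^ n) :
    ENNReal.ofReal ((t - x) ^ (α - 1)) ≤ ENNReal.ofReal (5 ^ (1 - α)) *
      ∑ j ∈ Finset.range 5, tker α n (-9 * R + 2 * R * j) (10 * R) x t := by
  have hδ : 0 < t - x := by linarith
  have hδ2 : t - x ≤ 2 * R := by linarith [hx.1, ht.2]
  obtain ⟨k, hk1, hk2⟩ := exists_nat_pow_near (x := 4 * R / (t - x)) (y := 2)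
    (by rw [le_div_iff₀ hδ]; linarith) (by norm_num)
  have hkn : k < n := by
    by_contra h
    have : (2:ℝ) ^ n ≤ 2 ^ k := pow_le_pow_right₀ (by norm_num) (not_lt.1 h)
    linarith
  have h2k : (0:ℝ) < 2 ^ k := by positivity
  set ℓ := 10 * R / 2 ^ k with hℓ
  have hℓ0 : 0 < ℓ := by positivity
  have hL : ℓ * 2 ^ k = 10 * R := by rw [hℓ]; field_simp
  have hd1 : t - x ≤ 2 * ℓ / 5 := by
    rw [le_div_iff₀ hδ] at hk1
    rw [hℓ, le_div_iff₀ (by norm_num), mul_div_assoc', le_div_iff₀ h2k]; linarith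
  have hd2 : ℓ / 5 < t - x := by
    rw [div_lt_iff₀ hδ, pow_succ] at hk2
    rw [hℓ, div_lt_iff₀ (by norm_num), div_lt_iff₀ h2k]; linarith
  set i : ℤ := ⌈5 * (t - (-9 * R) - ℓ / 2) / ℓ⌉ - 1 with hi
  have hi1 : (i : ℝ) < 5 * (t - (-9 * R) - ℓ / 2) / ℓ := by
    rw [hi]; push_cast
    linarith [Int.ceil_lt_add_one (5 * (t - (-9 * R) - ℓ / 2) / ℓ)]
  have hi2 : 5 * (t - (-9 * R) - ℓ / 2) / ℓ ≤ i + 1 := by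
    rw [hi]; push_cast
    linarith [Int.le_ceil (5 * (t - (-9 * R) - ℓ / 2) / ℓ)]
  rw [lt_div_iff₀ hℓ0] at hi1
  rw [div_le_iff₀ hℓ0] at hi2
  set j : ℤ := (i * 3 ^ k) % 5 with hj
  have hj0 : 0 ≤ j := Int.emod_nonneg _ (by norm_num)
  have hj5 : j < 5 := Int.emod_lt_of_pos _ (by norm_num)
  have hdvd : (5:ℤ) ∣ i - j * 2 ^ k := by
    have h1 : j ≡ i * 3 ^ k [ZMOD 5] := Int.mod_modEq _ _
    have h2 : j * 2 ^ k ≡ i * 3 ^ k * 2 ^ k [ZMOD 5] := h1.mul_right _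
    have h3 : i * 3 ^ k * 2 ^ k = i * 6 ^ k := by rw [mul_assoc, ← mul_pow]; norm_num
    have h4 : (6:ℤ) ^ k ≡ 1 ^ k [ZMOD 5] := Int.ModEq.pow k (by decide)
    rw [h3] at h2
    have h5 : j * 2 ^ k ≡ i [ZMOD 5] := h2.trans (by simpa using h4.mul_left i)
    exact h5.dvd
  obtain ⟨m, hm⟩ := hdvd
  have hmi : (i : ℝ) = j * 2 ^ k + 5 * m := by
    have : i = j * 2 ^ k + 5 * m := by linarith
    exact_mod_cast this
  have hj0' : (0:ℝ) ≤ j := by exact_mod_cast hj0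
  have hj4' : (j:ℝ) ≤ 4 := by exact_mod_cast (by omega : j ≤ 4)
  have hc : (-9 * R + 2 * R * j) + m * ℓ = -9 * R + i * ℓ / 5 := by
    rw [hmi]
    have : (2:ℝ) * R * j = j * (ℓ * 2 ^ k) / 5 := by rw [hL]; ring
    rw [this]; ring
  set a := -9 * R + 2 * R * (j:ℝ) with ha
  have hx1 : a + m * ℓ < x := by rw [hc]; linarith
  have hx2 : x ≤ a + m * ℓ + ℓ / 2 := by rw [hc]; linarith
  have ht1 : a + m * ℓ + ℓ / 2 < t := by rw [hc]; linarith
  have ht2 : t ≤ a + m * ℓ + ℓ := by rw [hc]; linarith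
  have haR : a ≤ -R := by rw [ha]; nlinarith
  have haR2 : R ≤ a + ℓ * 2 ^ k := by rw [hL, ha]; nlinarith
  have hm0 : 0 ≤ m := by
    have h1 : 0 < ((m:ℝ) + 1) * ℓ := by nlinarith [hx.1]
    have h2 : (0:ℝ) < (m:ℝ) + 1 := by
      by_contra h
      nlinarith
    have : 0 < m + 1 := by exact_mod_cast h2
    omega
  have hm1 : m < 2 ^ k := by
    have h1 : (m:ℝ) * ℓ < 2 ^ k * ℓ := by nlinarith [hx.2]
    have h2 := lt_of_mul_lt_mul_right h1 hℓ0.le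
    exact_mod_cast h2
  lift m to ℕ using hm0
  lift j to ℕ using hj0 with j' hj'
  have hm1' : m < 2 ^ k := by exact_mod_cast hm1
  simp only [Int.cast_natCast] at *
  have hlow := tker_lower α k n m a (10 * R) x t hkn hm1' ⟨hx1, hx2⟩ ⟨ht1, ht2⟩
  rw [ha] at hlow
  have hj5' : j' ∈ Finset.range 5 := by
    rw [Finset.mem_range]; omega
  have hsum := Finset.single_le_sum (f := fun j : ℕ => tker α n (-9 * R + 2 * R * j) (10 * R) x t)
    (fun _ _ => zero_le) hj5'
  have hfin : ENNReal.ofReal ((t - x) ^ (α - 1)) ≤ ENNReal.ofReal (5 ^ (1 - α)) *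
      ENNReal.ofReal (ℓ ^ (α - 1)) := by
    rw [← ENNReal.ofReal_mul (by positivity)]
    apply ENNReal.ofReal_le_ofReal
    have h1 := Real.rpow_le_rpow_of_nonpos (z := α - 1) (by positivity) hd2.le (by linarith)
    refine h1.trans (le_of_eq ?_)
    rw [Real.div_rpow hℓ0.le (by norm_num), show 1 - α = -(α - 1) by ring, Real.rpow_neg (by norm_num)]
    field_simp
  refine hfin.trans ?_
  gcongr
  exact hlow.trans hsum

def II (f : ℝ → ℝ≥0∞) (a L : ℝ) : ℝ := (∫⁻ t in Ioc a (a + L), f t).toReal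

def FinI (f : ℝ → ℝ≥0∞) : Prop := ∀ a L, ∫⁻ t in Ioc a (a + L), f t ≠ ∞

lemma II_nonneg (f : ℝ → ℝ≥0∞) (a L : ℝ) : 0 ≤ II f a L := ENNReal.toReal_nonneg

lemma II_add {f : ℝ → ℝ≥0∞} (hf : FinI f) (a L : ℝ) (hL : 0 < L) :
    II f a L = II f a (L/2) + II f (a + L/2) (L/2) := by
  have h : Ioc a (a + L) = Ioc a (a + L/2) ∪ Ioc (a + L/2) (a + L/2 + L/2) := by
    rw [Ioc_union_Ioc_eq_Ioc (by linarith) (by linarith)]; congr 1; ring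
  rw [II, h, lintegral_union measurableSet_Ioc (by
    rw [Set.disjoint_left]; intro x hx hx'; exact absurd hx.2 (not_le.2 hx'.1)),
    ENNReal.toReal_add (hf _ _) (hf _ _)]
  rfl

lemma tker_meas (α : ℝ) : ∀ (n : ℕ) (a L : ℝ), Measurable (fun z : ℝ × ℝ => tker α n a L z.1 z.2)
  | 0, _, _ => measurable_const
  | n + 1, a, L => by
      have h1 := tker_meas α n a (L/2)
      have h2 := tker_meas α n (a + L/2) (L/2)
      simp only [tker]
      refine Measurable.add (Measurable.const_mul (Measurable.mul ?_ ?_) _) (h1.add h2)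
      · exact (measurable_one.indicator measurableSet_Ioc).comp measurable_fst
      · exact (measurable_one.indicator measurableSet_Ioc).comp measurable_snd

lemma tLam_nonneg (α : ℝ) : ∀ (n : ℕ) (L : ℝ) (F G : Leaf n → ℝ), 0 < L → (∀ t, 0 ≤ F t) → (∀ t, 0 ≤ G t) →
    0 ≤ tLam α n L F G
  | 0, _, _, _, _, _, _ => le_rfl
  | n + 1, L, F, G, hL, hF, hG => by
      have h1 := tLam_nonneg α n (L/2) (tch false F) (tch false G) (by positivity) (fun t => hF _) (fun t => hG _)
      have h2 := tLam_nonneg α n (L/2) (tch true F) (tch true G) (by positivity) (fun t => hF _) (fun t => hG _)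
      have h3 : 0 ≤ tS (tch true F) := tS_nonneg fun t => hF _
      have h4 : 0 ≤ tS (tch false G) := tS_nonneg fun t => hG _
      rw [tLam]; positivity

lemma leafI_nonneg {I : ℝ → ℝ → ℝ} (hI : ∀ a L, 0 ≤ I a L) : ∀ (n : ℕ) (a L : ℝ) (t : Leaf n), 0 ≤ leafI I n a L t
  | 0, _, _, _ => hI _ _
  | n + 1, _, _, _ => leafI_nonneg hI n _ _ _

lemma ker_int (α : ℝ) {g H : ℝ → ℝ≥0∞} (hg : Measurable g) (hH : Measurable H) (hgf : FinI g) (hHf : FinI H) :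
    ∀ (n : ℕ) (a L : ℝ), 0 < L →
    ∫⁻ x, H x * ∫⁻ t, g t * tker α n a L x t =
      ENNReal.ofReal (tLam α n L (leafI (II g) n a L) (leafI (II H) n a L))
  | 0, a, L, _ => by simp [tker, tLam]
  | n + 1, a, L, hL => by
      have hL2 : 0 < L / 2 := by positivity
      have ih1 := ker_int α hg hH hgf hHf n a (L/2) hL2
      have ih2 := ker_int α hg hH hgf hHf n (a + L/2) (L/2) hL2
      have mk : ∀ a L, Measurable (fun z : ℝ × ℝ => g z.2 * tker α n a L z.1 z.2) := fun a L =>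
        (hg.comp measurable_snd).mul (tker_meas α n a L)
      have mi : ∀ a L, Measurable (fun x => ∫⁻ t, g t * tker α n a L x t) := fun a L =>
        (mk a L).lintegral_prod_right
      have mt : ∀ a L x, Measurable (fun t => g t * tker α n a L x t) := fun a L x =>
        (mk a L).comp measurable_prodMk_left
      have inner : ∀ x, ∫⁻ t, g t * tker α (n+1) a L x t =
          ENNReal.ofReal (L ^ (α - 1)) * (∫⁻ t in Ioc (a + L/2) (a + L/2 + L/2), g t) *
            (Ioc a (a + L/2)).indicator 1 x +
          ((∫⁻ t, g t * tker α n a (L/2) x t) + (∫⁻ t, g t * tker α n (a + L/2) (L/2) x t)) := by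
        intro x
        simp only [tker, mul_add]
        have ma : Measurable (fun t => g t * tker α n a (L/2) x t + g t * tker α n (a + L/2) (L/2) x t) :=
          (mt _ _ x).add (mt _ _ x)
        rw [lintegral_add_right _ ma, lintegral_add_right _ (mt _ _ x)]
        congr 1
        rw [← lintegral_indicator measurableSet_Ioc]
        rw [mul_right_comm, ← lintegral_const_mul _ (hg.indicator measurableSet_Ioc)]
        congr 1; funext t
        by_cases h : t ∈ Ioc (a + L/2) (a + L/2 + L/2)
        · rw [indicator_of_mem h, indicator_of_mem h]; simp; ring
        · rw [indicator_of_notMem h, indicator_of_notMem h]; simp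
      simp only [inner, mul_add]
      have hmi : ∀ a L, Measurable (fun x => H x * ∫⁻ t, g t * tker α n a L x t) := fun a L => hH.mul (mi a L)
      have ma : Measurable (fun x => (H x * ∫⁻ t, g t * tker α n a (L/2) x t) +
          (H x * ∫⁻ t, g t * tker α n (a + L/2) (L/2) x t)) := (hmi _ _).add (hmi _ _)
      rw [lintegral_add_right _ ma, lintegral_add_right _ (hmi _ _), ih1, ih2]
      have e1 : ∫⁻ x, H x * (ENNReal.ofReal (L ^ (α - 1)) * (∫⁻ t in Ioc (a + L/2) (a + L/2 + L/2), g t) *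
            (Ioc a (a + L/2)).indicator 1 x) =
          ENNReal.ofReal (L ^ (α - 1)) * (∫⁻ t in Ioc (a + L/2) (a + L/2 + L/2), g t) *
            ∫⁻ x in Ioc a (a + L/2), H x := by
        rw [← lintegral_indicator (f := H) measurableSet_Ioc,
          ← lintegral_const_mul _ (hH.indicator measurableSet_Ioc)]
        congr 1; funext x
        by_cases h : x ∈ Ioc a (a + L/2)
        · rw [indicator_of_mem h, indicator_of_mem h]; simp; ring
        · rw [indicator_of_notMem h, indicator_of_notMem h]; simp
      rw [e1, tLam, tch_leafI_true, tch_leafI_false, tch_leafI_true, tch_leafI_false,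
        tS_leafI (II_add hgf) n _ _ hL2, tS_leafI (II_add hHf) n _ _ hL2]
      have n1 := leafI_nonneg (II_nonneg g) n
      have n2 := leafI_nonneg (II_nonneg H) n
      have p1 := tLam_nonneg α n (L/2) _ _ hL2 (n1 a (L/2)) (n2 a (L/2))
      have p2 := tLam_nonneg α n (L/2) _ _ hL2 (n1 (a + L/2) (L/2)) (n2 (a + L/2) (L/2))
      have i1 := II_nonneg g (a + L/2) (L/2)
      have i2 := II_nonneg H a (L/2)
      rw [ENNReal.ofReal_add (by positivity) (by positivity), ENNReal.ofReal_add p1 p2,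
        ENNReal.ofReal_mul (by positivity), ENNReal.ofReal_mul (by positivity), II, II,
        ENNReal.ofReal_toReal (hgf _ _), ENNReal.ofReal_toReal (hHf _ _)]

lemma holdI {p r : ℝ} (hpr : p.HolderConjugate r) (μ : Measure ℝ) {f1 f2 : ℝ → ℝ≥0∞} (m1 : Measurable f1)
    (m2 : Measurable f2) (h1 : ∫⁻ x, f1 x ^ p ∂μ ≠ ∞) (h2 : ∫⁻ x, f2 x ^ r ∂μ ≠ ∞)
    (h0 : ∫⁻ x, f2 x ^ r ∂μ ≠ 0) :
    ∫⁻ x, f1 x * f2 x ∂μ ≠ ∞ ∧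
    (∫⁻ x, f1 x * f2 x ∂μ).toReal ^ p * (∫⁻ x, f2 x ^ r ∂μ).toReal ^ (1 - p) ≤
      (∫⁻ x, f1 x ^ p ∂μ).toReal := by
  have hp0 := hpr.pos
  have hr0 := hpr.symm.pos
  have h := ENNReal.lintegral_mul_le_Lp_mul_Lq μ hpr m1.aemeasurable m2.aemeasurable
  simp only [Pi.mul_apply] at h
  have hfin : (∫⁻ x, f1 x ^ p ∂μ) ^ (1 / p) * (∫⁻ x, f2 x ^ r ∂μ) ^ (1 / r) ≠ ∞ :=
    ENNReal.mul_ne_top (ENNReal.rpow_ne_top_of_nonneg (by positivity) h1)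
      (ENNReal.rpow_ne_top_of_nonneg (by positivity) h2)
  refine ⟨ne_top_of_le_ne_top hfin h, ?_⟩
  have h' := ENNReal.toReal_mono hfin h
  rw [ENNReal.toReal_mul, ← ENNReal.toReal_rpow, ← ENNReal.toReal_rpow] at h'
  have hc : 0 < (∫⁻ x, f2 x ^ r ∂μ).toReal := ENNReal.toReal_pos h0 h2
  have ha : 0 ≤ (∫⁻ x, f1 x * f2 x ∂μ).toReal := ENNReal.toReal_nonneg
  have hb : 0 ≤ (∫⁻ x, f1 x ^ p ∂μ).toReal := ENNReal.toReal_nonneg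
  generalize (∫⁻ x, f2 x ^ r ∂μ).toReal = c at *
  generalize (∫⁻ x, f1 x * f2 x ∂μ).toReal = A at *
  generalize (∫⁻ x, f1 x ^ p ∂μ).toReal = B at *
  have h3 := Real.rpow_le_rpow ha h' hp0.le
  rw [Real.mul_rpow (by positivity) (by positivity), ← Real.rpow_mul hb, ← Real.rpow_mul hc.le,
    one_div_mul_cancel hp0.ne', Real.rpow_one,
    show 1 / r * p = p - 1 by rw [← hpr.div_conj_eq_sub_one]; ring] at h3
  calc _ ≤ (B * c ^ (p - 1)) * c ^ (1 - p) := by gcongr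
    _ = B * (c ^ (p - 1) * c ^ (1 - p)) := by ring
    _ = B := by rw [← Real.rpow_add hc]; simp

/-- truncated kernel -/
def kE (α : ℝ) (m : ℕ) (x t : ℝ) : ℝ≥0∞ :=
  {z : ℝ × ℝ | (z.1 ∈ Ioc (-(m + 1 : ℝ)) (m + 1) ∧ z.2 ∈ Ioc (-(m + 1 : ℝ)) (m + 1)) ∧
    z.1 + 1 / (m + 1) ≤ z.2}.indicator (fun z => ENNReal.ofReal ((z.2 - z.1) ^ (α - 1))) (x, t)

lemma kE_meas (α : ℝ) (m : ℕ) : Measurable (fun z : ℝ × ℝ => kE α m z.1 z.2) := by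
  unfold kE
  refine Measurable.indicator ?_ ?_
  · exact (((measurable_snd.sub measurable_fst).pow_const _)).ennreal_ofReal
  · refine MeasurableSet.inter (MeasurableSet.inter ?_ ?_) ?_
    · exact measurable_fst measurableSet_Ioc
    · exact measurable_snd measurableSet_Ioc
    · exact measurableSet_le (measurable_fst.add_const _) measurable_snd

lemma kE_le {α : ℝ} (hα1 : α < 1) (m : ℕ) (x t : ℝ) : kE α m x t ≤ ENNReal.ofReal (5 ^ (1 - α)) *
      ∑ j ∈ Finset.range 5, tker α (4 * (m+1)^2) (-9 * (m+1:ℝ) + 2 * (m+1:ℝ) * j) (10 * (m+1:ℝ)) x t := by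
  unfold kE
  by_cases h : (x, t) ∈ {z : ℝ × ℝ | (z.1 ∈ Ioc (-(m + 1 : ℝ)) (m + 1) ∧ z.2 ∈ Ioc (-(m + 1 : ℝ)) (m + 1)) ∧
    z.1 + 1 / (m + 1) ≤ z.2}
  · rw [indicator_of_mem h]
    obtain ⟨⟨hx, ht⟩, hxt⟩ := h
    simp only at hx ht hxt
    have hm : (0:ℝ) < 1 / (m + 1) := by positivity
    refine geom hα1 (by positivity) hx ht (by linarith) _ ?_
    have h1 : 4 * (m + 1 : ℝ) / (t - x) ≤ 4 * (m + 1) ^ 2 := by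
      rw [div_le_iff₀ (by linarith)]
      calc 4 * (m + 1 : ℝ) = 4 * (m + 1) ^ 2 * (1 / (m + 1)) := by field_simp
        _ ≤ _ := by gcongr; linarith
    refine h1.trans_lt ?_
    have := Nat.lt_two_pow_self (n := 4 * (m+1)^2)
    exact_mod_cast this
  · rw [indicator_of_notMem h]; exact zero_le

theorem bilin {α p r q e s s' K : ℝ} (P : Params α p r q e s s') (hK : 1 ≤ K)
    {U V g H Jf Hf : ℝ → ℝ≥0∞} (hg : Measurable g) (hH : Measurable H)
    (hUf : FinI U) (hVf : FinI V) (hgf : FinI g) (hHf : FinI H)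
    (hU0 : ∀ a L, 0 < L → 0 < II U a L) (hV0 : ∀ a L, 0 < L → 0 < II V a L)
    (h1 : ∀ a L, 0 < L → II U a L * II V (a + L) L ^ (s - 1) ≤ K * L ^ s)
    (h2 : ∀ a L, 0 < L → L ≤ II U a L ^ (1 / s) * II V a L ^ (1 / s'))
    (hFJ : ∀ a L, 0 < L → II g a L ^ p * II V a L ^ (1 - p) ≤ II Jf a L)
    (hGH : ∀ a L, 0 < L → II H a L ^ e * II U a L ^ (1 - e) ≤ II Hf a L)
    (X Y : ℝ) (hX : 0 < X) (hY : 0 < Y)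
    (hJX : ∫⁻ x, Jf x ≤ ENNReal.ofReal (X ^ p)) (hHY : ∫⁻ x, Hf x ≤ ENNReal.ofReal (Y ^ e)) (m : ℕ) :
    ∫⁻ x, H x * ∫⁻ t, g t * kE α m x t ≤ ENNReal.ofReal (5 ^ (1 - α) * (5 *
      (treeD α p r q e s s' * K ^ ((1 - α) * max 1 (r / q)) * (X * Y)))) := by
  have hJf : FinI Jf := fun a L => ne_top_of_le_ne_top ENNReal.ofReal_ne_top
    ((setLIntegral_le_lintegral _ _).trans hJX)
  have hHff : FinI Hf := fun a L => ne_top_of_le_ne_top ENNReal.ofReal_ne_top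
    ((setLIntegral_le_lintegral _ _).trans hHY)
  have key : ∀ n a L, 0 < L → ∫⁻ x, H x * ∫⁻ t, g t * tker α n a L x t ≤
      ENNReal.ofReal (treeD α p r q e s s' * K ^ ((1 - α) * max 1 (r / q)) * (X * Y)) := by
    intro n a L hL
    rw [ker_int α hg hH hgf hHf n a L hL]
    apply ENNReal.ofReal_le_ofReal
    refine line_tree P hK (U := II U) (V := II V) (J := II Jf) (H := II Hf) (II_add hUf) (II_add hVf) (II_add hJf)
      (II_add hHff) hU0 hV0
      (fun a L _ => II_nonneg _ _ _) (fun a L _ => II_nonneg _ _ _) h1 h2 hFJ hGH X Y hX hY n a L hL ?_ ?_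
    · exact ENNReal.toReal_le_of_le_ofReal (by positivity) ((setLIntegral_le_lintegral _ _).trans hJX)
    · exact ENNReal.toReal_le_of_le_ofReal (by positivity) ((setLIntegral_le_lintegral _ _).trans hHY)
  set c5 := ENNReal.ofReal (5 ^ (1 - α))
  set D := treeD α p r q e s s' * K ^ ((1 - α) * max 1 (r / q)) * (X * Y)
  set n := 4 * (m+1)^2
  have mk : ∀ a L, Measurable (fun z : ℝ × ℝ => g z.2 * tker α n a L z.1 z.2) := fun a L =>
    (hg.comp measurable_snd).mul (tker_meas α n a L)
  have mi : ∀ a L, Measurable (fun x => ∫⁻ t, g t * tker α n a L x t) := fun a L =>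
    (mk a L).lintegral_prod_right
  have mt : ∀ a L x, Measurable (fun t => g t * tker α n a L x t) := fun a L x =>
    (mk a L).comp measurable_prodMk_left
  calc ∫⁻ x, H x * ∫⁻ t, g t * kE α m x t
      ≤ ∫⁻ x, H x * ∫⁻ t, g t * (c5 * ∑ j ∈ Finset.range 5,
          tker α n (-9 * (m+1:ℝ) + 2 * (m+1:ℝ) * j) (10 * (m+1:ℝ)) x t) := by
        gcongr with x t; exact kE_le P.hα1 m x t
    _ = ∫⁻ x, c5 * ∑ j ∈ Finset.range 5, H x * ∫⁻ t, g t *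
          tker α n (-9 * (m+1:ℝ) + 2 * (m+1:ℝ) * j) (10 * (m+1:ℝ)) x t := by
        congr 1; funext x
        have : ∀ t, g t * (c5 * ∑ j ∈ Finset.range 5,
          tker α n (-9 * (m+1:ℝ) + 2 * (m+1:ℝ) * j) (10 * (m+1:ℝ)) x t) =
          c5 * ∑ j ∈ Finset.range 5, g t * tker α n (-9 * (m+1:ℝ) + 2 * (m+1:ℝ) * j) (10 * (m+1:ℝ)) x t := by
          intro t; rw [← Finset.mul_sum]; ring
        simp only [this]
        rw [lintegral_const_mul _ (Finset.measurable_fun_sum _ fun j _ => mt _ _ x),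
          lintegral_finsetSum _ (fun j _ => mt _ _ x), ← Finset.mul_sum]
        ring
    _ = c5 * ∑ j ∈ Finset.range 5, ∫⁻ x, H x * ∫⁻ t, g t *
          tker α n (-9 * (m+1:ℝ) + 2 * (m+1:ℝ) * j) (10 * (m+1:ℝ)) x t := by
        have hmi : ∀ a L, Measurable (fun x => H x * ∫⁻ t, g t * tker α n a L x t) := fun a L => hH.mul (mi a L)
        rw [lintegral_const_mul _ (Finset.measurable_fun_sum _ fun j _ => hmi _ _),
          lintegral_finsetSum _ (fun j _ => hmi _ _)]
    _ ≤ c5 * ∑ j ∈ Finset.range 5, ENNReal.ofReal D := by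
        gcongr with j _
        exact key _ _ _ (by positivity)
    _ = _ := by
        rw [Finset.sum_const, Finset.card_range, ENNReal.ofReal_mul (p := 5 ^ (1 - α)) (by positivity),
          ENNReal.ofReal_mul (p := 5) (by norm_num), nsmul_eq_mul]
        norm_num [c5]

lemma max_minorant (F : ℝ → ℝ≥0∞) : ∃ g : ℝ → ℝ≥0∞, Measurable g ∧ (∀ x, g x ≤ F x) ∧
    ∀ φ : ℝ → ℝ≥0∞, Measurable φ → (∀ x, φ x ≤ F x) → ∀ᵐ x, φ x ≤ g x := by
  set ν : Measure ℝ := (volume : Measure ℝ).toFinite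
  have hn : ∀ n : ℕ, ∃ g : ℝ → ℝ≥0∞, Measurable g ∧ g ≤ (fun x => min (F x) n) ∧
      ∫⁻ x, min (F x) n ∂ν = ∫⁻ x, g x ∂ν := fun n => exists_measurable_le_lintegral_eq ν _
  choose g hgm hgle hgi using hn
  refine ⟨fun x => ⨆ n, g n x, Measurable.iSup hgm, fun x => iSup_le fun n => (hgle n x).trans (min_le_left _ _), ?_⟩
  intro φ hφ hφF
  have h1 : ∀ n : ℕ, ∀ᵐ x, min (φ x) n ≤ g n x := by
    intro n
    have hψ : Measurable (fun x => max (g n x) (min (φ x) n)) := (hgm n).max (hφ.min measurable_const)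
    have hfin : ∫⁻ x, g n x ∂ν ≠ ∞ := by
      rw [← hgi]
      refine ne_top_of_le_ne_top (b := ∫⁻ x, (n : ℝ≥0∞) ∂ν) ?_ (lintegral_mono fun x => min_le_right _ _)
      rw [lintegral_const]
      exact ENNReal.mul_ne_top (by simp) (measure_ne_top _ _)
    have h2 : g n =ᵐ[ν] fun x => max (g n x) (min (φ x) n) := by
      refine ae_eq_of_ae_le_of_lintegral_le (Eventually.of_forall fun x => le_max_left _ _) hfin hψ.aemeasurable ?_
      rw [← hgi]
      exact lintegral_mono fun x => max_le (hgle n x) (min_le_min_right _ (hφF x))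
    rw [EventuallyEq, ae_toFinite] at h2
    filter_upwards [h2] with x hx
    rw [hx]; exact le_max_right _ _
  rw [← ae_all_iff] at h1
  filter_upwards [h1] with x hx
  have h3 : Tendsto (fun n : ℕ => min (φ x) (n : ℝ≥0∞)) atTop (nhds (min (φ x) ⊤)) :=
    tendsto_const_nhds.min ENNReal.tendsto_nat_nhds_top
  rw [min_top_right] at h3
  exact le_of_tendsto h3 (Eventually.of_forall fun n => (hx n).trans (le_iSup (fun n => g n x) n))

lemma minorant_int {F g : ℝ → ℝ≥0∞} 
    (hmax : ∀ φ : ℝ → ℝ≥0∞, Measurable φ → (∀ x, φ x ≤ F x) → ∀ᵐ x, φ x ≤ g x)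
    {k : ℝ → ℝ≥0∞} (hk : Measurable k) {S : Set ℝ} (hS : MeasurableSet S)
    (hk0 : ∀ x ∈ S, k x ≠ 0) (hkt : ∀ x ∈ S, k x ≠ ∞) :
    ∫⁻ x in S, F x * k x ≤ ∫⁻ x in S, g x * k x := by
  obtain ⟨φ, hφ, hle, heq⟩ := exists_measurable_le_lintegral_eq (volume.restrict S) (fun x => F x * k x)
  rw [heq]
  have h := hmax (S.indicator fun x => φ x / k x) ((hφ.div hk).indicator hS) (by
    intro x
    by_cases hx : x ∈ S
    · rw [indicator_of_mem hx]
      exact ENNReal.div_le_of_le_mul (hle x)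
    · rw [indicator_of_notMem hx]; exact zero_le)
  refine lintegral_mono_ae ?_
  rw [ae_restrict_iff' hS]
  filter_upwards [h] with x hx hxS
  rw [indicator_of_mem hxS] at hx
  exact (ENNReal.div_le_iff (hk0 x hxS) (hkt x hxS)).1 hx

def WE (α : ℝ) (g : ℝ → ℝ≥0∞) (x : ℝ) : ℝ≥0∞ := ∫⁻ t in Ioi x, g t * ENNReal.ofReal ((t - x) ^ (α - 1))

lemma kE_tendsto (α : ℝ) (x t : ℝ) : Tendsto (fun m => kE α m x t) atTop
    (nhds ((Ioi x).indicator (fun t => ENNReal.ofReal ((t - x) ^ (α - 1))) t)) := by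
  by_cases h : x < t
  · rw [indicator_of_mem (show t ∈ Ioi x from h)]
    refine tendsto_const_nhds.congr' ?_
    have e1 : Tendsto (fun m : ℕ => (m : ℝ) + 1) atTop atTop :=
      tendsto_natCast_atTop_atTop.atTop_add tendsto_const_nhds
    filter_upwards [e1.eventually_gt_atTop (|x|), e1.eventually_gt_atTop (|t|),
      (tendsto_one_div_add_atTop_nhds_zero_nat (𝕜 := ℝ)).eventually_lt_const (sub_pos.2 h)] with m h1 h2 h3
    rw [abs_lt] at h1 h2
    unfold kE
    rw [indicator_of_mem]
    exact ⟨⟨⟨h1.1, h1.2.le⟩, ⟨h2.1, h2.2.le⟩⟩, by simp only; linarith⟩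
  · rw [indicator_of_notMem (show t ∉ Ioi x from h)]
    refine tendsto_const_nhds.congr ?_
    intro m
    unfold kE
    rw [indicator_of_notMem]
    rintro ⟨_, h2⟩
    simp only at h2
    have : (0:ℝ) < 1 / (m + 1) := by positivity
    linarith

lemma kE_mono (α : ℝ) (x t : ℝ) : Monotone (fun m => kE α m x t) := by
  intro m n hmn
  have h1 : (m : ℝ) ≤ n := by exact_mod_cast hmn
  simp only [kE]
  refine indicator_le_indicator_of_subset ?_ (fun _ => zero_le) _
  rintro ⟨a, b⟩ ⟨⟨⟨h2, h3⟩, ⟨h4, h5⟩⟩, h6⟩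
  simp only at h2 h3 h4 h5 h6
  have : 1 / ((n : ℝ) + 1) ≤ 1 / (m + 1) := by gcongr
  exact ⟨⟨⟨by simp only; linarith, by simp only; linarith⟩, ⟨by simp only; linarith, by simp only; linarith⟩⟩,
    by simp only; linarith⟩

lemma vE_tendsto (α : ℝ) {g : ℝ → ℝ≥0∞} (hg : Measurable g) (hgt : ∀ t, g t ≠ ∞) (x : ℝ) :
    Tendsto (fun m => ∫⁻ t, g t * kE α m x t) atTop (nhds (WE α g x)) := by
  rw [WE, ← lintegral_indicator measurableSet_Ioi]
  refine lintegral_tendsto_of_tendsto_of_monotone ?_ ?_ ?_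
  · intro m
    exact (hg.mul ((kE_meas α m).comp measurable_prodMk_left)).aemeasurable
  · exact Eventually.of_forall fun t m n hmn => mul_le_mul_right (kE_mono α x t hmn) _
  · refine Eventually.of_forall fun t => ?_
    have := ENNReal.Tendsto.const_mul (kE_tendsto α x t) (Or.inr (hgt t))
    convert this using 2
    by_cases h : t ∈ Ioi x
    · rw [indicator_of_mem h, indicator_of_mem h]
    · rw [indicator_of_notMem h, indicator_of_notMem h, mul_zero]

lemma setint_pos {f : ℝ → ℝ≥0∞} (hf : Measurable f) (h0 : ∀ x, f x ≠ 0) {a L : ℝ} (hL : 0 < L) :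
    ∫⁻ t in Ioc a (a + L), f t ≠ 0 := by
  rw [← pos_iff_ne_zero, setLIntegral_pos_iff hf]
  have : Function.support f = univ := by
    ext x; simp [h0 x]
  rw [this, univ_inter, Real.volume_Ioc]
  simp [hL]

lemma wdata {α p r q e s s' K : ℝ} (P : Params α p r q e s s') (hK0 : 0 ≤ K) {W : ℝ → ℝ≥0∞} (hW : Measurable W)
    (hW0 : ∀ x, W x ≠ 0) (hWt : ∀ x, W x ≠ ∞)
    (hch : ∀ a L, 0 < L → (∫⁻ t in Ioc a (a + L), W t ^ q) *
      (∫⁻ t in Ioc (a + L) (a + L + L), W t ^ (-r)) ^ (s - 1) ≤ ENNReal.ofReal (K * L ^ s)) :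
    FinI (fun t => W t ^ q) ∧ FinI (fun t => W t ^ (-r)) ∧
    (∀ a L, 0 < L → 0 < II (fun t => W t ^ q) a L) ∧
    (∀ a L, 0 < L → 0 < II (fun t => W t ^ (-r)) a L) ∧
    (∀ a L, 0 < L → II (fun t => W t ^ q) a L * II (fun t => W t ^ (-r)) (a + L) L ^ (s - 1) ≤ K * L ^ s) ∧
    (∀ a L, 0 < L → L ≤ II (fun t => W t ^ q) a L ^ (1 / s) * II (fun t => W t ^ (-r)) a L ^ (1 / s')) := by
  have hs1 : 0 < s - 1 := sub_pos.2 P.hss.lt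
  have hs0 := P.hss.pos
  have hs'0 := P.hss.symm.pos
  have hUm : Measurable (fun t => W t ^ q) := hW.pow_const _
  have hVm : Measurable (fun t => W t ^ (-r)) := hW.pow_const _
  have hUp : ∀ a L, 0 < L → ∫⁻ t in Ioc a (a + L), W t ^ q ≠ 0 := fun a L hL =>
    setint_pos hUm (fun x => (ENNReal.rpow_pos (pos_iff_ne_zero.2 (hW0 x)) (hWt x)).ne') hL
  have hVp : ∀ a L, 0 < L → ∫⁻ t in Ioc a (a + L), W t ^ (-r) ≠ 0 := fun a L hL =>
    setint_pos hVm (fun x => (ENNReal.rpow_pos (pos_iff_ne_zero.2 (hW0 x)) (hWt x)).ne') hL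
  have hUf : FinI (fun t => W t ^ q) := by
    intro a L
    rcases le_or_gt L 0 with hL | hL
    · rw [Ioc_eq_empty (by linarith)]; simp
    · intro h
      have h1 := hch a L hL
      rw [h, ENNReal.top_mul] at h1
      · exact absurd h1 (by simp)
      · rw [Ne, ENNReal.rpow_eq_zero_iff]
        rintro (h2 | h2)
        · exact hVp _ _ hL h2.1
        · linarith
  have hVf : FinI (fun t => W t ^ (-r)) := by
    intro a L
    rcases le_or_gt L 0 with hL | hL
    · rw [Ioc_eq_empty (by linarith)]; simp
    · intro h
      have h1 := hch (a - L) L hL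
      rw [sub_add_cancel, h, ENNReal.top_rpow_of_pos hs1, ENNReal.mul_top] at h1
      · exact absurd h1 (by simp)
      · have := hUp (a - L) L hL
        rwa [sub_add_cancel] at this
  have pU : ∀ a L, 0 < L → 0 < II (fun t => W t ^ q) a L := fun a L hL => ENNReal.toReal_pos (hUp a L hL) (hUf a L)
  have pV : ∀ a L, 0 < L → 0 < II (fun t => W t ^ (-r)) a L := fun a L hL => ENNReal.toReal_pos (hVp a L hL) (hVf a L)
  refine ⟨hUf, hVf, pU, pV, ?_, ?_⟩
  · intro a L hL
    have := ENNReal.toReal_mono ENNReal.ofReal_ne_top (hch a L hL)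
    rwa [ENNReal.toReal_mul, ← ENNReal.toReal_rpow, ENNReal.toReal_ofReal (by positivity)] at this
  · intro a L hL
    have h := ENNReal.lintegral_mul_le_Lp_mul_Lq (volume.restrict (Ioc a (a + L))) P.hss
      (f := fun t => W t ^ (q / s)) (g := fun t => W t ^ (-r / s')) (hW.pow_const _).aemeasurable
      (hW.pow_const _).aemeasurable
    have hq0 := P.hqe.pos
    have hr0 := P.hpr.symm.pos
    have e1 : q / s + -r / s' = 0 := by
      rw [← P.hs, ← P.hs']
      have : 1 - α ≠ 0 := by linarith [P.hα1]
      field_simp; ring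
    have e2 : ∀ t, ((fun t => W t ^ (q / s)) * fun t => W t ^ (-r / s')) t = 1 := by
      intro t
      rw [Pi.mul_apply, ← ENNReal.rpow_add _ _ (hW0 t) (hWt t), e1, ENNReal.rpow_zero]
    have e3 : ∀ t, (W t ^ (q / s)) ^ s = W t ^ q := by
      intro t; rw [← ENNReal.rpow_mul, div_mul_cancel₀ _ hs0.ne']
    have e4 : ∀ t, (W t ^ (-r / s')) ^ s' = W t ^ (-r) := by
      intro t; rw [← ENNReal.rpow_mul, div_mul_cancel₀ _ hs'0.ne']
    simp only [e2, e3, e4] at h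
    rw [lintegral_const, Measure.restrict_apply_univ, Real.volume_Ioc, one_mul, add_sub_cancel_left] at h
    have h' := ENNReal.toReal_mono (ENNReal.mul_ne_top (ENNReal.rpow_ne_top_of_nonneg (by positivity) (hUf a L))
      (ENNReal.rpow_ne_top_of_nonneg (by positivity) (hVf a L))) h
    rwa [ENNReal.toReal_mul, ← ENNReal.toReal_rpow, ← ENNReal.toReal_rpow, ENNReal.toReal_ofReal hL.le] at h'

def CC (α p r q e s s' : ℝ) : ℝ := 5 ^ (1 - α) * (5 * |treeD α p r q e s s'|)

theorem core {α p r q e s s' K : ℝ} (P : Params α p r q e s s') (hK0 : 0 ≤ K)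
    {W : ℝ → ℝ≥0∞} (hW : Measurable W)
    (hW0 : ∀ x, W x ≠ 0) (hWt : ∀ x, W x ≠ ∞)
    (hch : ∀ a L, 0 < L → (∫⁻ t in Ioc a (a + L), W t ^ q) *
      (∫⁻ t in Ioc (a + L) (a + L + L), W t ^ (-r)) ^ (s - 1) ≤ ENNReal.ofReal (K * L ^ s))
    {g : ℝ → ℝ≥0∞} (hg : Measurable g) (hgt : ∀ t, g t ≠ ∞) {X : ℝ} (hX : 0 < X)
    (hgX : ∫⁻ t, (g t * W t) ^ p ≤ ENNReal.ofReal (X ^ p)) :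
    1 ≤ K ∧ ∫⁻ x, WE α g x ^ q * W x ^ q ≤
      ENNReal.ofReal ((CC α p r q e s s' * K ^ ((1 - α) * max 1 (r / q)) * X) ^ q) := by
  obtain ⟨hUf, hVf, pU, pV, h1, h2⟩ := wdata P hK0 hW hW0 hWt hch
  have hK : 1 ≤ K := one_le_of_char P.hss hK0 (II_add hUf) pU pV h1 h2
  refine ⟨hK, ?_⟩
  have hq0 := P.hqe.pos
  have hq1 := P.hqe.lt
  have he0 := P.hqe.symm.pos
  have hp0 := P.hpr.pos
  set M := CC α p r q e s s' * K ^ ((1 - α) * max 1 (r / q)) * X with hM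
  have hM0 : 0 ≤ M := by
    have : 0 ≤ CC α p r q e s s' := by unfold CC; positivity
    positivity
  have eV : ∀ t, (W t)⁻¹ ^ r = W t ^ (-r) := fun t => by rw [ENNReal.inv_rpow, ENNReal.rpow_neg]
  have eg : ∀ t, g t * W t * (W t)⁻¹ = g t := fun t => by
    rw [mul_assoc, ENNReal.mul_inv_cancel (hW0 t) (hWt t), mul_one]
  have hVne : ∀ a L, 0 < L → ∫⁻ t in Ioc a (a + L), W t ^ (-r) ≠ 0 := fun a L hL h => by
    have := pV a L hL
    simp [II, h] at this
  have hUne : ∀ a L, 0 < L → ∫⁻ t in Ioc a (a + L), W t ^ q ≠ 0 := fun a L hL h => by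
    have := pU a L hL
    simp [II, h] at this
  have hold1 : ∀ a L, 0 < L → ∫⁻ t in Ioc a (a + L), g t ≠ ∞ ∧
      II g a L ^ p * II (fun t => W t ^ (-r)) a L ^ (1 - p) ≤ II (fun t => (g t * W t) ^ p) a L := by
    intro a L hL
    have := holdI P.hpr (volume.restrict (Ioc a (a + L))) (f1 := fun t => g t * W t) (f2 := fun t => (W t)⁻¹)
      (hg.mul hW) hW.inv (ne_top_of_le_ne_top ENNReal.ofReal_ne_top ((setLIntegral_le_lintegral _ _).trans hgX))
      (by simp only [eV]; exact hVf a L) (by simp only [eV]; exact hVne a L hL)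
    simp only [eV, eg] at this
    exact this
  have hgf : FinI g := by
    intro a L
    rcases le_or_gt L 0 with hL | hL
    · rw [Ioc_eq_empty (by linarith)]; simp
    · exact (hold1 a L hL).1
  set v : ℕ → ℝ → ℝ≥0∞ := fun m x => ∫⁻ t, g t * kE α m x t with hv
  have vm : ∀ m, Measurable (v m) := by
    intro m
    have h3 : Measurable (fun z : ℝ × ℝ => g z.2 * kE α m z.1 z.2) :=
      (hg.comp measurable_snd).mul (kE_meas α m)
    exact h3.lintegral_prod_right
  set E : ℕ → Set ℝ := fun m => Ioc (-(m + 1 : ℝ)) (-(m + 1 : ℝ) + 2 * (m + 1))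
  set φ : ℕ → ℝ → ℝ≥0∞ := fun m => (E m).indicator fun x => min (v m x) ((m : ℝ≥0∞) + 1) with hφ
  have φm : ∀ m, Measurable (φ m) := fun m => ((vm m).min measurable_const).indicator measurableSet_Ioc
  have φv : ∀ m x, φ m x ≤ v m x := by
    intro m x
    simp only [hφ]
    by_cases h : x ∈ E m
    · rw [indicator_of_mem h]; exact min_le_left _ _
    · rw [indicator_of_notMem h]; exact zero_le
  have φc : ∀ m x, φ m x ≤ (m : ℝ≥0∞) + 1 := by
    intro m x
    simp only [hφ]
    by_cases h : x ∈ E m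
    · rw [indicator_of_mem h]; exact min_le_right _ _
    · rw [indicator_of_notMem h]; exact zero_le
  have ct : ∀ m : ℕ, (m : ℝ≥0∞) + 1 ≠ ∞ := fun m => by simp
  have step : ∀ m, ∫⁻ x, φ m x ^ q * W x ^ q ≤ ENNReal.ofReal (M ^ q) := by
    intro m
    have Zf : ∫⁻ x, φ m x ^ q * W x ^ q ≠ ∞ := by
      refine ne_top_of_le_ne_top (b := ∫⁻ x in E m, ((m : ℝ≥0∞) + 1) ^ q * W x ^ q) ?_ ?_
      · rw [lintegral_const_mul _ (hW.pow_const _)]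
        exact ENNReal.mul_ne_top (ENNReal.rpow_ne_top_of_nonneg hq0.le (ct m)) (hUf _ _)
      · rw [← lintegral_indicator measurableSet_Ioc]
        refine lintegral_mono fun x => ?_
        by_cases h : x ∈ E m
        · rw [indicator_of_mem h]
          exact mul_le_mul_left (ENNReal.rpow_le_rpow (φc m x) hq0.le) _
        · have : φ m x = 0 := indicator_of_notMem h _
          simp only [this, ENNReal.zero_rpow_of_pos hq0, zero_mul]
          exact zero_le
    by_cases Z0 : ∫⁻ x, φ m x ^ q * W x ^ q = 0
    · rw [Z0]; exact zero_le
    set Z := (∫⁻ x, φ m x ^ q * W x ^ q).toReal with hZ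
    have Zp : 0 < Z := ENNReal.toReal_pos Z0 Zf
    set H : ℝ → ℝ≥0∞ := fun x => φ m x ^ (q - 1) * W x ^ q with hH
    have Hm : Measurable H := ((φm m).pow_const _).mul (hW.pow_const _)
    have Hf : FinI H := by
      intro a L
      refine ne_top_of_le_ne_top (b := ∫⁻ x in Ioc a (a + L), ((m : ℝ≥0∞) + 1) ^ (q - 1) * W x ^ q) ?_ ?_
      · rw [lintegral_const_mul _ (hW.pow_const _)]
        exact ENNReal.mul_ne_top (ENNReal.rpow_ne_top_of_nonneg (by linarith) (ct m)) (hUf _ _)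
      · refine lintegral_mono fun x => ?_
        simp only [hH]
        exact mul_le_mul_left (ENNReal.rpow_le_rpow (φc m x) (by linarith)) _
    have ee : (q - 1) * e = q := by
      have := P.hqe.sub_one_mul_conj; linarith
    have f1e : ∀ x, (φ m x ^ (q - 1) * W x ^ (q / e)) ^ e = φ m x ^ q * W x ^ q := by
      intro x
      rw [ENNReal.mul_rpow_of_nonneg _ _ he0.le, ← ENNReal.rpow_mul, ← ENNReal.rpow_mul, ee,
        div_mul_cancel₀ _ he0.ne']
    have f12 : ∀ x, φ m x ^ (q - 1) * W x ^ (q / e) * W x = H x := by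
      intro x
      rw [mul_assoc]
      congr 1
      nth_rewrite 2 [← ENNReal.rpow_one (W x)]
      rw [← ENNReal.rpow_add _ _ (hW0 x) (hWt x)]
      congr 1
      have := P.hqe.div_conj_eq_sub_one
      linarith
    have hGH : ∀ a L, 0 < L → II H a L ^ e * II (fun t => W t ^ q) a L ^ (1 - e) ≤
        II (fun x => φ m x ^ q * W x ^ q) a L := by
      intro a L hL
      have := (holdI P.hqe.symm (volume.restrict (Ioc a (a + L))) (f1 := fun x => φ m x ^ (q - 1) * W x ^ (q / e))
        (f2 := W) (((φm m).pow_const _).mul (hW.pow_const _)) hW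
        (by simp only [f1e]; exact ne_top_of_le_ne_top Zf (setLIntegral_le_lintegral _ _))
        (hUf a L) (hUne a L hL)).2
      simp only [f1e, f12] at this
      exact this
    have b := bilin P hK hg Hm hUf hVf hgf Hf pU pV h1 h2 (fun a L hL => (hold1 a L hL).2) hGH X (Z ^ (1 / e)) hX
      (by positivity) hgX (by
        rw [← Real.rpow_mul Zp.le, one_div_mul_cancel he0.ne', Real.rpow_one, hZ, ENNReal.ofReal_toReal Zf]) m
    have le1 : ∫⁻ x, φ m x ^ q * W x ^ q ≤ ∫⁻ x, H x * ∫⁻ t, g t * kE α m x t := by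
      refine lintegral_mono fun x => ?_
      calc φ m x ^ q * W x ^ q = φ m x ^ (q - 1) * φ m x ^ (1 : ℝ) * W x ^ q := by
            rw [← ENNReal.rpow_add_of_nonneg _ _ (by linarith) (by norm_num), sub_add_cancel]
        _ = H x * φ m x := by rw [ENNReal.rpow_one, hH]; ring
        _ ≤ _ := by gcongr; exact φv m x
    have b' := b.trans (ENNReal.ofReal_le_ofReal (show _ ≤ (5:ℝ) ^ (1 - α) * (5 * (|treeD α p r q e s s'| *
      K ^ ((1 - α) * max 1 (r / q)) * (X * Z ^ (1 / e)))) by gcongr; exact le_abs_self _))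
    have le2 := ENNReal.toReal_le_of_le_ofReal (by positivity) (le1.trans b')
    rw [← hZ] at le2
    have le3 : Z ≤ M * Z ^ (1 / e) := by
      refine le2.trans ?_
      refine le_of_eq ?_
      rw [hM, CC]; ring
    have eZ : Z = Z ^ (1 / q) * Z ^ (1 / e) := by
      rw [← Real.rpow_add Zp, one_div, one_div, P.hqe.inv_add_inv_eq_one, Real.rpow_one]
    have le4 : Z ^ (1 / q) ≤ M := by
      have : Z ^ (1 / q) * Z ^ (1 / e) ≤ M * Z ^ (1 / e) := by rw [← eZ]; exact le3
      exact le_of_mul_le_mul_right this (by positivity)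
    rw [← ENNReal.ofReal_toReal Zf]
    apply ENNReal.ofReal_le_ofReal
    calc Z = (Z ^ (1 / q)) ^ q := by rw [← Real.rpow_mul Zp.le, one_div_mul_cancel hq0.ne', Real.rpow_one]
      _ ≤ M ^ q := by gcongr
  have lim : ∀ x, Tendsto (fun m => φ m x ^ q * W x ^ q) atTop (nhds (WE α g x ^ q * W x ^ q)) := by
    intro x
    refine ENNReal.Tendsto.mul_const ?_ (Or.inr (ENNReal.rpow_ne_top_of_nonneg hq0.le (hWt x)))
    refine ((ENNReal.continuous_rpow_const (y := q)).tendsto _).comp ?_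
    have e1 : Tendsto (fun m : ℕ => (m : ℝ) + 1) atTop atTop :=
      tendsto_natCast_atTop_atTop.atTop_add tendsto_const_nhds
    have e2 : Tendsto (fun m : ℕ => min (v m x) ((m : ℝ≥0∞) + 1)) atTop (nhds (min (WE α g x) (⊤ + 1))) :=
      (vE_tendsto α hg hgt x).min (ENNReal.tendsto_nat_nhds_top.add tendsto_const_nhds)
    rw [top_add, min_top_right] at e2
    refine e2.congr' ?_
    filter_upwards [e1.eventually_gt_atTop (|x|)] with m hm
    rw [abs_lt] at hm
    simp only [hφ]
    rw [indicator_of_mem]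
    exact ⟨hm.1, by linarith⟩
  calc ∫⁻ x, WE α g x ^ q * W x ^ q = ∫⁻ x, liminf (fun m => φ m x ^ q * W x ^ q) atTop := by
        congr 1; funext x; exact (lim x).liminf_eq.symm
    _ ≤ liminf (fun m => ∫⁻ x, φ m x ^ q * W x ^ q) atTop :=
        lintegral_liminf_le fun m => ((φm m).pow_const _).mul (hW.pow_const _)
    _ ≤ _ := liminf_le_of_frequently_le' (Frequently.of_forall step)

lemma mkParams {p q α : ℝ} (hα : 0 < α) (hα1 : α < 1) (hp : 1 < p) (hpα : p < 1 / α)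
    (hq : q = p / (1 - α * p)) :
    Params α p (p / (p - 1)) q (q / (q - 1)) ((1 - α) * q) ((1 - α) * (p / (p - 1))) := by
  have h1 : 0 < 1 - α * p := by
    rw [lt_div_iff₀ hα] at hpα; linarith
  have hp0 : 0 < p := by linarith
  have hp1 : 0 < p - 1 := by linarith
  have ha1 : 0 < 1 - α := by linarith
  have hq0 : 0 < q := by rw [hq]; positivity
  have hpq : p ≤ q := by
    rw [hq, le_div_iff₀ h1]; nlinarith [mul_pos hα hp0]
  have hq1 : 0 < q - 1 := by linarith
  have hqi : q⁻¹ = p⁻¹ - α := by rw [hq]; field_simp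
  have hri : (p / (p - 1))⁻¹ = 1 - p⁻¹ := by field_simp
  have hei : (q / (q - 1))⁻¹ = 1 - q⁻¹ := by field_simp
  have hr0 : 0 < p / (p - 1) := by positivity
  have he0 : 0 < q / (q - 1) := by positivity
  have hpr : p.HolderConjugate (p / (p - 1)) := by
    rw [Real.holderConjugate_iff]; exact ⟨hp, by rw [hri]; ring⟩
  have hqe : q.HolderConjugate (q / (q - 1)) := by
    rw [Real.holderConjugate_iff]; exact ⟨by linarith, by rw [hei]; ring⟩
  generalize p / (p - 1) = r at *
  generalize q / (q - 1) = e at *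
  have hsum : ((1 - α) * q)⁻¹ + ((1 - α) * r)⁻¹ = 1 := by
    rw [mul_inv, mul_inv, hqi, hri]; field_simp; ring
  have hqq : q⁻¹ * q = 1 := inv_mul_cancel₀ hq0.ne'
  have hpp : p⁻¹ * p = 1 := inv_mul_cancel₀ hp0.ne'
  have hrr : r⁻¹ * r = 1 := inv_mul_cancel₀ hr0.ne'
  have hee : e⁻¹ * e = 1 := inv_mul_cancel₀ he0.ne'
  have her' : e⁻¹ = r⁻¹ + α := by rw [hei, hri, hqi]; ring
  constructor
  · exact hα
  · exact hα1
  · exact hpr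
  · exact hqe
  · rw [Real.holderConjugate_iff]
    refine ⟨?_, hsum⟩
    have h2 : 0 < ((1 - α) * r)⁻¹ := by positivity
    have h3 : ((1 - α) * q)⁻¹ < 1 := by linarith
    exact (inv_lt_one₀ (by positivity)).1 h3
  · rfl
  · rfl
  · calc r = e⁻¹ * e * r := by rw [hee, one_mul]
      _ = e * (r⁻¹ * r + α * r) := by rw [her']; ring
      _ = _ := by rw [hrr]
  · have : p⁻¹ = q⁻¹ + α := by rw [hqi]; ring
    calc q = p⁻¹ * p * q := by rw [hpp, one_mul]
      _ = p * (q⁻¹ * q + α * q) := by rw [this]; ring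
      _ = _ := by rw [hqq]
  · rw [← inv_le_inv₀ hr0 he0, her']; linarith
  · rw [div_eq_mul_inv, sub_mul, one_div, hqi, mul_assoc, mul_inv_cancel₀ hr0.ne', hri]; ring

lemma char_scale {A K u v : ℝ≥0∞} {s : ℝ} (hs : 1 < s) (hA0 : A ≠ 0) (hAt : A ≠ ∞)
    (h : A⁻¹ * u * (A⁻¹ * v) ^ (s - 1) ≤ K) : u * v ^ (s - 1) ≤ K * A ^ s := by
  have e1 : A ^ s = A * A ^ (s - 1) := by
    nth_rewrite 2 [← ENNReal.rpow_one A]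
    rw [← ENNReal.rpow_add _ _ hA0 hAt]; congr 1; ring
  calc u * v ^ (s - 1) = (A⁻¹ * A) * u * ((A⁻¹ * A) * v) ^ (s - 1) := by
        rw [ENNReal.inv_mul_cancel hA0 hAt, one_mul, one_mul]
    _ = A⁻¹ * u * (A⁻¹ * v) ^ (s - 1) * A ^ s := by
        rw [e1, show A⁻¹ * A * v = A * (A⁻¹ * v) by ring, ENNReal.mul_rpow_of_nonneg _ _ (by linarith : 0 ≤ s - 1)]
        ring
    _ ≤ _ := by gcongr

theorem upper (p q α : ℝ) (hα : 0 < α) (hα1 : α < 1) (hp : 1 < p) (hpα : p < 1 / α)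
    (hq : q = p / (1 - α * p)) : ∃ c : ℝ, 0 < c ∧
      ∀ w : ℝ → ℝ, IsWeight w → apqPlusChar p q w ≠ ∞ → 1 ≤ apqPlusChar p q w ∧ 
        ∀ f : ℝ → ℝ,
          lnormW q (fun x => w x ^ q) (Walpha α f) ≤
            ENNReal.ofReal c *
                apqPlusChar p q w ^ ((1 - α) * max 1 ((p / (p - 1)) / q)) *
              lnormW p (fun x => w x ^ p) (fun x => ENNReal.ofReal |f x|) := by
  have P := mkParams hα hα1 hp hpα hq
  obtain ⟨r, hr⟩ : ∃ r, r = p / (p - 1) := ⟨_, rfl⟩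
  rw [← hr] at P ⊢
  obtain ⟨e, he⟩ : ∃ e, e = q / (q - 1) := ⟨_, rfl⟩
  rw [← he] at P
  set s := (1 - α) * q with hs
  set s' := (1 - α) * r
  have hp0 := P.hpr.pos
  have hq0 := P.hqe.pos
  have hr0 := P.hpr.symm.pos
  refine ⟨CC α p r q e s s' + 1, by unfold CC; positivity, ?_⟩
  intro w ⟨hw0, hwl⟩ hfin
  have hsq : s - 1 = q / r := by
    have h1 := P.hss.inv_add_inv_eq_one
    have h2 := P.hss.div_conj_eq_sub_one
    rw [← h2, ← P.hs, ← P.hs']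
    have : 1 - α ≠ 0 := by linarith
    field_simp
  obtain ⟨K, hK⟩ : ∃ K, K = (apqPlusChar p q w).toReal := ⟨_, rfl⟩
  have hK0 : 0 ≤ K := by rw [hK]; exact ENNReal.toReal_nonneg
  have hKE : apqPlusChar p q w = ENNReal.ofReal K := by rw [hK, ENNReal.ofReal_toReal hfin]
  have hwm : AEMeasurable w volume := hwl.aestronglyMeasurable.aemeasurable
  set w' : ℝ → ℝ := fun x => if 0 < hwm.mk w x then hwm.mk w x else 1 with hw'
  have w'm : Measurable w' :=
    Measurable.ite (measurableSet_lt measurable_const hwm.measurable_mk) hwm.measurable_mk measurable_const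
  have w'p : ∀ x, 0 < w' x := by
    intro x; simp only [hw']; split_ifs with h
    · exact h
    · norm_num
  have hww : ∀ᵐ x, w x = w' x := by
    filter_upwards [hw0, hwm.ae_eq_mk] with x h1 h2
    simp only [hw', ← h2, h1, if_true]
  set W : ℝ → ℝ≥0∞ := fun x => ENNReal.ofReal (w' x) with hW
  have Wm : Measurable W := w'm.ennreal_ofReal
  have W0 : ∀ x, W x ≠ 0 := fun x => by simp [hW, w'p x]
  have Wt : ∀ x, W x ≠ ∞ := fun x => ENNReal.ofReal_ne_top
  have Wpow : ∀ y : ℝ, ∀ᵐ x, ENNReal.ofReal (w x ^ y) = W x ^ y := by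
    intro y
    filter_upwards [hww] with x hx
    rw [hx, hW, ENNReal.ofReal_rpow_of_pos (w'p x)]
  have hch : ∀ a L, 0 < L → (∫⁻ t in Ioc a (a + L), W t ^ q) *
      (∫⁻ t in Ioc (a + L) (a + L + L), W t ^ (-r)) ^ (s - 1) ≤ ENNReal.ofReal (K * L ^ s) := by
    intro a L hL
    have h1 : avgIoc (fun t => w t ^ q) (a + L - L) (a + L) *
      avgIoc (fun t => w t ^ (-r)) (a + L) (a + L + L) ^ (q / r) ≤ apqPlusChar p q w := by
      rw [apqPlusChar, ← hr]
      exact le_iSup_of_le (a + L) (le_iSup_of_le L (le_iSup_of_le hL le_rfl))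
    rw [avgIoc, avgIoc, lintIoc, lintIoc, ← hsq, hKE, add_sub_cancel_right, add_sub_cancel_left,
      add_sub_cancel_left, lintegral_congr_ae (ae_restrict_of_ae (Wpow q)),
      lintegral_congr_ae (ae_restrict_of_ae (Wpow (-r)))] at h1
    have := char_scale P.hss.lt (by simpa using hL) ENNReal.ofReal_ne_top h1
    rwa [ENNReal.ofReal_rpow_of_pos hL, ← ENNReal.ofReal_mul hK0] at this
  have hK1 : 1 ≤ K := (core P hK0 Wm W0 Wt hch (g := fun _ => 0) measurable_const (by simp) one_pos
    (by simp [hp0])).1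
  refine ⟨by rw [hKE]; simpa using hK1, ?_⟩
  intro f
  rw [hKE]
  set γ := (1 - α) * max 1 (r / q) with hγ
  have hγ0 : 0 ≤ γ := by
    have : 0 < 1 - α := by linarith
    have : 0 < max 1 (r / q) := lt_max_of_lt_left one_pos
    positivity
  set F : ℝ → ℝ≥0∞ := fun x => ENNReal.ofReal |f x| with hF
  obtain ⟨g, gm, gF, gmax⟩ := max_minorant F
  have gt : ∀ t, g t ≠ ∞ := fun t => ne_top_of_le_ne_top ENNReal.ofReal_ne_top (gF t)
  have hWa : ∀ x, Walpha α f x ≤ WE α g x := by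
    intro x
    have h1 : Walpha α f x = ∫⁻ t in Ioi x, F t * ENNReal.ofReal ((t - x) ^ (α - 1)) := by
      rw [Walpha]
      refine lintegral_congr fun t => ?_
      rw [ENNReal.ofReal_mul (abs_nonneg _)]
    rw [h1]
    refine minorant_int gmax (by fun_prop) measurableSet_Ioi ?_ (fun _ _ => ENNReal.ofReal_ne_top)
    intro t ht
    have : 0 < t - x := sub_pos.2 ht
    simp only [ne_eq, ENNReal.ofReal_eq_zero, not_le]
    positivity
  have hL : lnormW q (fun x => w x ^ q) (Walpha α f) ≤ (∫⁻ x, WE α g x ^ q * W x ^ q) ^ (1 / q) := by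
    rw [lnormW]
    refine ENNReal.rpow_le_rpow ?_ (by positivity)
    refine lintegral_mono_ae ?_
    filter_upwards [Wpow q] with x hx
    rw [hx]
    exact mul_le_mul_left (ENNReal.rpow_le_rpow (hWa x) hq0.le) _
  set N := lnormW p (fun x => w x ^ p) F with hN
  have hKg : 0 < K ^ γ := by positivity
  rw [ENNReal.ofReal_rpow_of_nonneg hK0 hγ0]
  have hCC : 0 ≤ CC α p r q e s s' := by unfold CC; positivity
  by_cases hNt : N = ∞
  · rw [hNt, ENNReal.mul_top]
    · exact le_top
    · rw [← ENNReal.ofReal_mul (by positivity)]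
      simp only [ne_eq, ENNReal.ofReal_eq_zero, not_le]
      positivity
  have hgN : ∫⁻ t, (g t * W t) ^ p ≤ N ^ p := by
    rw [hN, lnormW, ← ENNReal.rpow_mul, one_div_mul_cancel hp0.ne', ENNReal.rpow_one]
    refine lintegral_mono_ae ?_
    filter_upwards [Wpow p] with x hx
    rw [hx, ENNReal.mul_rpow_of_nonneg _ _ hp0.le]
    exact mul_le_mul_left (ENNReal.rpow_le_rpow (gF x) hp0.le) _
  have key : ∀ ε : ℝ, 0 < ε → lnormW q (fun x => w x ^ q) (Walpha α f) ≤
      ENNReal.ofReal (CC α p r q e s s' * K ^ γ * (N.toReal + ε)) := by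
    intro ε hε
    have hn : 0 ≤ N.toReal := ENNReal.toReal_nonneg
    have hX : 0 < N.toReal + ε := by positivity
    have h1 := (core P hK0 Wm W0 Wt hch gm gt hX (hgN.trans (by
      rw [← ENNReal.ofReal_rpow_of_pos hX]
      refine ENNReal.rpow_le_rpow ?_ hp0.le
      rw [ENNReal.ofReal_add hn hε.le, ENNReal.ofReal_toReal hNt]
      exact le_self_add))).2
    refine hL.trans ((ENNReal.rpow_le_rpow h1 (by positivity)).trans (le_of_eq ?_))
    rw [← ENNReal.ofReal_rpow_of_nonneg (by positivity) hq0.le, ← ENNReal.rpow_mul, mul_one_div_cancel hq0.ne',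
      ENNReal.rpow_one]
  have hlim : Tendsto (fun ε : ℝ => ENNReal.ofReal (CC α p r q e s s' * K ^ γ * (N.toReal + ε)))
      (nhdsWithin 0 (Ioi 0)) (nhds (ENNReal.ofReal (CC α p r q e s s' * K ^ γ * (N.toReal + 0)))) := by
    refine Tendsto.mono_left ?_ nhdsWithin_le_nhds
    refine Continuous.tendsto ?_ _
    exact ENNReal.continuous_ofReal.comp (by fun_prop)
  have := ge_of_tendsto hlim (by filter_upwards [self_mem_nhdsWithin] with ε hε using key ε hε)
  refine this.trans ?_
  rw [add_zero, ENNReal.ofReal_mul (by positivity), ENNReal.ofReal_mul hCC, ENNReal.ofReal_toReal hNt]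
  gcongr
  linarith

lemma sharp_abs (p q α : ℝ) (hα : 0 < α) (hα1 : α < 1) (hp : 1 < p) (hpα : p < 1 / α)
    (hq : q = p / (1 - α * p)) {γ κ C1 A1 A2 : ℝ} (hγ : 0 < γ) (hκ : 0 < κ) (hγκ : γ * κ = 1 - α) (hC1 : 0 < C1)
    (hA1 : 0 < A1) (hA2 : 0 < A2)
    (fam : ∀ δ : ℝ, 0 < δ → δ < 1 → ∃ w f : ℝ → ℝ, IsWeight w ∧ apqPlusChar p q w ≤ ENNReal.ofReal (C1 * δ ^ (-κ)) ∧
      ENNReal.ofReal (A1 * δ ^ (-1 - 1 / q)) ≤ lnormW q (fun x => w x ^ q) (Walpha α f) ∧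
      lnormW p (fun x => w x ^ p) (fun x => ENNReal.ofReal |f x|) ≤ ENNReal.ofReal (A2 * δ ^ (-1 / p)))
    (β : ℝ) (hβ : β < γ) :
    ¬ ∃ c : ℝ, 0 < c ∧
        ∀ w : ℝ → ℝ, IsWeight w → apqPlusChar p q w ≠ ∞ →
          ∀ f : ℝ → ℝ,
            lnormW q (fun x => w x ^ q) (Walpha α f) ≤
              ENNReal.ofReal c * apqPlusChar p q w ^ β *
                lnormW p (fun x => w x ^ p) (fun x => ENNReal.ofReal |f x|) := by
  rintro ⟨c, hc, H⟩
  obtain ⟨c0, _, up⟩ := upper p q α hα hα1 hp hpα hq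
  set B := max β 0 with hB
  have hB0 : 0 ≤ B := le_max_right _ _
  have hBγ : B < γ := max_lt hβ hγ
  have hη : 0 < (1 - α) - κ * B := by rw [← hγκ]; nlinarith
  have h1 : 0 < 1 - α * p := by
    rw [lt_div_iff₀ hα] at hpα; linarith
  have hp0 : 0 < p := by linarith
  have hqi : 1 / q = 1 / p - α := by rw [hq]; field_simp
  have key : ∀ δ : ℝ, 0 < δ → δ < 1 → A1 ≤ c * C1 ^ B * A2 * δ ^ ((1 - α) - κ * B) := by
    intro δ hδ hδ1
    obtain ⟨w, f, hw, hch, hl, hn⟩ := fam δ hδ hδ1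
    have hfin := ne_top_of_le_ne_top ENNReal.ofReal_ne_top hch
    have hone := (up w hw hfin).1
    have e1 : ENNReal.ofReal (A1 * δ ^ (-1 - 1 / q)) ≤
        ENNReal.ofReal (c * (C1 * δ ^ (-κ)) ^ B * (A2 * δ ^ (-1 / p))) := by
      refine hl.trans ((H w hw hfin f).trans ?_)
      rw [ENNReal.ofReal_mul (by positivity), ENNReal.ofReal_mul hc.le,
        ← ENNReal.ofReal_rpow_of_nonneg (by positivity) hB0]
      have : apqPlusChar p q w ^ β ≤ ENNReal.ofReal (C1 * δ ^ (-κ)) ^ B :=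
        (ENNReal.rpow_le_rpow_of_exponent_le hone (le_max_left _ _)).trans (ENNReal.rpow_le_rpow hch hB0)
      gcongr
    rw [ENNReal.ofReal_le_ofReal_iff (by positivity)] at e1
    have e2 : A1 = A1 * δ ^ (-1 - 1 / q) * δ ^ (1 + 1 / q) := by
      rw [mul_assoc, ← Real.rpow_add hδ]; ring_nf; simp
    rw [e2]
    calc _ ≤ c * (C1 * δ ^ (-κ)) ^ B * (A2 * δ ^ (-1 / p)) * δ ^ (1 + 1 / q) := by gcongr
      _ = c * C1 ^ B * A2 * (δ ^ (-κ * B) * δ ^ (-1 / p) * δ ^ (1 + 1 / q)) := by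
          rw [Real.mul_rpow hC1.le (by positivity), ← Real.rpow_mul hδ.le]; ring
      _ = _ := by
          rw [← Real.rpow_add hδ, ← Real.rpow_add hδ]
          congr 2
          rw [hqi]; ring
  have lim : Tendsto (fun δ : ℝ => c * C1 ^ B * A2 * δ ^ ((1 - α) - κ * B)) (nhdsWithin 0 (Ioi 0)) (nhds 0) := by
    have : Tendsto (fun δ : ℝ => c * C1 ^ B * A2 * δ ^ ((1 - α) - κ * B)) (nhds 0)
        (nhds (c * C1 ^ B * A2 * 0 ^ ((1 - α) - κ * B))) :=
      ((Real.continuous_rpow_const hη.le).const_mul _).tendsto _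
    rw [Real.zero_rpow hη.ne', mul_zero] at this
    exact this.mono_left nhdsWithin_le_nhds
  have := ge_of_tendsto lim (by
    filter_upwards [Ioo_mem_nhdsGT (show (0:ℝ) < 1 by norm_num)] with δ hδ using key δ hδ.1 hδ.2)
  linarith

lemma int_pow {b x y : ℝ} (hb : 0 < b) (hx : 0 ≤ x) (hxy : x ≤ y) :
    ∫⁻ t in Ioc x y, ENNReal.ofReal (t ^ (b - 1)) = ENNReal.ofReal ((y ^ b - x ^ b) / b) := by
  have h1 := integral_rpow (a := x) (b := y) (r := b - 1) (Or.inl (by linarith))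
  have h2 := intervalIntegral.intervalIntegrable_rpow' (a := x) (b := y) (r := b - 1) (by linarith)
  rw [intervalIntegrable_iff_integrableOn_Ioc_of_le hxy] at h2
  rw [intervalIntegral.integral_of_le hxy, sub_add_cancel] at h1
  rw [← h1, ofReal_integral_eq_lintegral_ofReal h2]
  filter_upwards [ae_restrict_mem measurableSet_Ioc] with t ht
  exact Real.rpow_nonneg (hx.trans ht.1.le) _

lemma int_pow_pos {b R : ℝ} (hb : 0 < b) (hR : 0 ≤ R) :
    ∫⁻ t in Ioo 0 R, ENNReal.ofReal (|t| ^ (b - 1)) = ENNReal.ofReal (R ^ b / b) := by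
  have := int_pow hb le_rfl hR
  rw [Real.zero_rpow hb.ne', sub_zero] at this
  rw [← this, setLIntegral_congr Ioo_ae_eq_Ioc]
  refine setLIntegral_congr_fun measurableSet_Ioc fun t ht => ?_
  simp only [abs_of_pos ht.1]

lemma int_pow_neg {b R : ℝ} (hb : 0 < b) (hR : 0 ≤ R) :
    ∫⁻ t in Ioo (-R) 0, ENNReal.ofReal (|t| ^ (b - 1)) = ENNReal.ofReal (R ^ b / b) := by
  rw [← int_pow_pos hb hR]
  have := (Measure.measurePreserving_neg (volume : Measure ℝ)).setLIntegral_comp_preimage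
    (s := Ioo 0 R) measurableSet_Ioo (f := fun t => ENNReal.ofReal (|t| ^ (b - 1))) (by fun_prop)
  rw [← this]
  simp only [abs_neg]
  congr 2
  ext x; simp

lemma int_pow_all {b R : ℝ} (hb : 0 < b) (hR : 0 ≤ R) :
    ∫⁻ t in Ioo (-R) R, ENNReal.ofReal (|t| ^ (b - 1)) ≤ ENNReal.ofReal (2 * R ^ b / b) := by
  have h : (Ioo (-R) R : Set ℝ) ≤ᵐ[volume] (Ioo (-R) 0 ∪ Ioo 0 R : Set ℝ) := by
    have h0 : ∀ᵐ x : ℝ, x ≠ 0 := by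
      rw [ae_iff]; simp
    filter_upwards [h0] with x hx hxm
    have hxm : x ∈ Ioo (-R) R := hxm
    rcases lt_or_gt_of_ne hx with h | h
    · exact Or.inl ⟨hxm.1, h⟩
    · exact Or.inr ⟨h, hxm.2⟩
  refine (lintegral_mono_set' h).trans ((lintegral_union_le _ _ _).trans ?_)
  rw [int_pow_pos hb hR, int_pow_neg hb hR, ← ENNReal.ofReal_add (by positivity) (by positivity)]
  apply le_of_eq; congr 1; ring

lemma weight_pow {b : ℝ} (hb : 0 < b) : IsWeight (fun x => |x| ^ (b - 1)) := by
  refine ⟨?_, ?_⟩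
  · have h0 : ∀ᵐ x : ℝ, x ≠ 0 := by
      rw [ae_iff]; simp
    filter_upwards [h0] with x hx
    have := abs_pos.2 hx
    positivity
  · intro x
    refine ⟨Ioo (-(|x| + 1)) (|x| + 1), Ioo_mem_nhds (by linarith [neg_abs_le x]) (by linarith [le_abs_self x]), ?_, ?_⟩
    · exact Measurable.aestronglyMeasurable (by fun_prop)
    · rw [hasFiniteIntegral_iff_ofReal (Eventually.of_forall fun t => by positivity)]
      exact (int_pow_all hb (by positivity)).trans_lt ENNReal.ofReal_lt_top

lemma avg_up {b x h c : ℝ} (hb : 0 ≤ b) (hh : 0 < h) (hc : c = x ∨ c = x - h) :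
    avgIoc (fun t => |t| ^ b) c (c + h) ≤ ENNReal.ofReal ((|x| + h) ^ b) := by
  have h1 : lintIoc (fun t => |t| ^ b) c (c + h) ≤ ∫⁻ t in Ioc c (c + h), ENNReal.ofReal ((|x| + h) ^ b) := by
    rw [lintIoc]
    refine setLIntegral_mono' measurableSet_Ioc fun t ht => ?_
    apply ENNReal.ofReal_le_ofReal
    refine Real.rpow_le_rpow (abs_nonneg _) ?_ hb
    have := neg_abs_le x
    have := le_abs_self x
    have h2 := ht.1
    have h3 := ht.2
    rw [abs_le]
    rcases hc with hc | hc <;> subst hc <;> constructor <;> linarith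
  rw [setLIntegral_const, Real.volume_Ioc, add_sub_cancel_left] at h1
  rw [avgIoc, add_sub_cancel_left]
  calc _ ≤ (ENNReal.ofReal h)⁻¹ * (ENNReal.ofReal ((|x| + h) ^ b) * ENNReal.ofReal h) := by gcongr
    _ = ENNReal.ofReal ((|x| + h) ^ b) * ((ENNReal.ofReal h)⁻¹ * ENNReal.ofReal h) := by ring
    _ = _ := by rw [ENNReal.inv_mul_cancel (by simpa using hh) ENNReal.ofReal_ne_top, mul_one]

lemma avg_dn {δ x h c : ℝ} (hδ : 0 < δ) (hδ1 : δ < 1) (hh : 0 < h) (hc : c = x ∨ c = x - h) :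
    avgIoc (fun t => |t| ^ (δ - 1)) c (c + h) ≤ ENNReal.ofReal (6 / δ * (|x| + h) ^ (δ - 1)) := by
  have n1 := neg_abs_le x
  have n2 := le_abs_self x
  have n3 := abs_nonneg x
  have hR : 0 < |x| + h := by linarith
  suffices h1 : lintIoc (fun t => |t| ^ (δ - 1)) c (c + h) ≤ ENNReal.ofReal (6 / δ * (|x| + h) ^ (δ - 1) * h) by
    rw [avgIoc, add_sub_cancel_left]
    rw [ENNReal.ofReal_mul (by positivity)] at h1
    calc _ ≤ (ENNReal.ofReal h)⁻¹ * (ENNReal.ofReal (6 / δ * (|x| + h) ^ (δ - 1)) * ENNReal.ofReal h) := by gcongr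
      _ = ENNReal.ofReal (6 / δ * (|x| + h) ^ (δ - 1)) * ((ENNReal.ofReal h)⁻¹ * ENNReal.ofReal h) := by ring
      _ = _ := by rw [ENNReal.inv_mul_cancel (by simpa using hh) ENNReal.ofReal_ne_top, mul_one]
  rcases le_or_gt (2 * h) |x| with hx | hx
  · have h1 : lintIoc (fun t => |t| ^ (δ - 1)) c (c + h) ≤
        ∫⁻ t in Ioc c (c + h), ENNReal.ofReal (6 / δ * (|x| + h) ^ (δ - 1)) := by
      rw [lintIoc]
      refine setLIntegral_mono' measurableSet_Ioc fun t ht => ?_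
      apply ENNReal.ofReal_le_ofReal
      have ht1 : |x - t| ≤ h := by
        have h2 := ht.1
        have h3 := ht.2
        rw [abs_le]
        rcases hc with hc | hc <;> subst hc <;> constructor <;> linarith
      have ht2 : |x| - |t| ≤ h := (abs_sub_abs_le_abs_sub x t).trans ht1
      have ht3 : (|x| + h) / 3 ≤ |t| := by linarith
      calc |t| ^ (δ - 1) ≤ ((|x| + h) / 3) ^ (δ - 1) :=
            Real.rpow_le_rpow_of_nonpos (by positivity) ht3 (by linarith)
        _ = 3 ^ (1 - δ) * (|x| + h) ^ (δ - 1) := by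
            rw [Real.div_rpow hR.le (by norm_num), show δ - 1 = -(1 - δ) by ring, Real.rpow_neg (by norm_num : (0:ℝ) ≤ 3)]
            field_simp
        _ ≤ 6 / δ * (|x| + h) ^ (δ - 1) := by
            have a1 : (3:ℝ) ^ (1 - δ) ≤ 3 := by
              calc (3:ℝ) ^ (1 - δ) ≤ 3 ^ (1:ℝ) := Real.rpow_le_rpow_of_exponent_le (by norm_num) (by linarith)
                _ = 3 := Real.rpow_one _
            have a2 : 6 ≤ 6 / δ := by rw [le_div_iff₀ hδ]; linarith
            gcongr; linarith
    rw [setLIntegral_const, Real.volume_Ioc, add_sub_cancel_left] at h1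
    rwa [ENNReal.ofReal_mul (by positivity)]
  · have h1 : lintIoc (fun t => |t| ^ (δ - 1)) c (c + h) ≤ ENNReal.ofReal (2 * (|x| + h) ^ δ / δ) := by
      refine le_trans ?_ (int_pow_all hδ hR.le)
      rw [lintIoc, setLIntegral_congr Ioo_ae_eq_Ioc.symm]
      refine lintegral_mono_set ?_
      rcases hc with hc | hc <;> subst hc <;> refine Ioo_subset_Ioo ?_ ?_ <;> linarith
    refine h1.trans (ENNReal.ofReal_le_ofReal ?_)
    have : (|x| + h) ^ δ = (|x| + h) ^ (δ - 1) * (|x| + h) := by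
      nth_rewrite 3 [← Real.rpow_one (|x| + h)]
      rw [← Real.rpow_add hR]; congr 1; ring
    rw [this]
    calc 2 * ((|x| + h) ^ (δ - 1) * (|x| + h)) / δ ≤ 2 * ((|x| + h) ^ (δ - 1) * (3 * h)) / δ := by
          gcongr; linarith
      _ = _ := by ring

lemma lnorm_lower {q θ a b M ρ : ℝ} (hq : 0 < q) (hb : 0 < b) (hM : 0 ≤ M) (hρ : 0 ≤ ρ) (hab : (a + θ) * q = b - 1)
    {g : ℝ → ℝ≥0∞} (hg : ∀ x ∈ Ioo (-ρ) 0, ENNReal.ofReal (M * |x| ^ a) ≤ g x) :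
    ENNReal.ofReal (M * (ρ ^ b / b) ^ (1 / q)) ≤ lnormW q (fun x => (|x| ^ θ) ^ q) g := by
  have h1 : ENNReal.ofReal (M ^ q * (ρ ^ b / b)) ≤ ∫⁻ x, g x ^ q * ENNReal.ofReal ((|x| ^ θ) ^ q) := by
    rw [ENNReal.ofReal_mul (by positivity), ← int_pow_neg hb hρ, ← lintegral_const_mul _ (by fun_prop)]
    refine le_trans ?_ (setLIntegral_le_lintegral (Ioo (-ρ) 0) _)
    refine setLIntegral_mono' measurableSet_Ioo fun x hx => ?_
    have hx0 : 0 < |x| := abs_pos.2 hx.2.ne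
    calc ENNReal.ofReal (M ^ q) * ENNReal.ofReal (|x| ^ (b - 1))
        = ENNReal.ofReal (M * |x| ^ a) ^ q * ENNReal.ofReal ((|x| ^ θ) ^ q) := by
          rw [ENNReal.ofReal_rpow_of_nonneg (by positivity) hq.le, ← ENNReal.ofReal_mul (by positivity),
            ← ENNReal.ofReal_mul (by positivity), Real.mul_rpow hM (by positivity), mul_assoc,
            ← Real.mul_rpow (by positivity) (by positivity), ← Real.rpow_add hx0, ← Real.rpow_mul hx0.le, hab]
      _ ≤ _ := mul_le_mul_left (ENNReal.rpow_le_rpow (hg x hx) hq.le) _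
  have h2 := ENNReal.rpow_le_rpow h1 (show 0 ≤ 1 / q by positivity)
  rw [lnormW]
  refine le_trans (le_of_eq ?_) h2
  rw [ENNReal.ofReal_rpow_of_nonneg (by positivity) (by positivity), Real.mul_rpow (by positivity) (by positivity),
    ← Real.rpow_mul hM, mul_one_div_cancel hq.ne', Real.rpow_one]

lemma lnorm_test {p θ a b : ℝ} (hp : 0 < p) (hb : 0 < b) (hab : (a + θ) * p = b - 1) :
    lnormW p (fun x => (|x| ^ θ) ^ p) (fun x => ENNReal.ofReal |(Ioo (0:ℝ) 1).indicator (fun t => t ^ a) x|) =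
      ENNReal.ofReal ((1 / b) ^ (1 / p)) := by
  rw [lnormW, ← ENNReal.ofReal_rpow_of_nonneg (by positivity) (by positivity)]
  congr 1
  have := int_pow_pos hb (zero_le_one (α := ℝ))
  rw [Real.one_rpow] at this
  rw [← this, ← lintegral_indicator measurableSet_Ioo]
  congr 1; funext x
  by_cases hx : x ∈ Ioo (0:ℝ) 1
  · have hx0 := hx.1
    rw [indicator_of_mem hx, indicator_of_mem hx, abs_of_pos (by positivity), abs_of_pos hx0,
      ENNReal.ofReal_rpow_of_nonneg (by positivity) hp.le, ← ENNReal.ofReal_mul (by positivity),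
      ← Real.mul_rpow (by positivity) (by positivity), ← Real.rpow_add hx0, ← Real.rpow_mul hx0.le, hab]
  · rw [indicator_of_notMem hx, indicator_of_notMem hx]
    simp [hp]

lemma famA (p q α : ℝ) (hα : 0 < α) (hα1 : α < 1) (hp : 1 < p) (hpα : p < 1 / α)
    (hq : q = p / (1 - α * p)) (δ : ℝ) (hδ : 0 < δ) (hδ1 : δ < 1) :
    ∃ w f : ℝ → ℝ, IsWeight w ∧
      apqPlusChar p q w ≤ ENNReal.ofReal (6 ^ (q / (p / (p - 1))) * δ ^ (-(q / (p / (p - 1))))) ∧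
      ENNReal.ofReal (2 ^ (α - 1) * (p / q) ^ (1 / q) * δ ^ (-1 - 1 / q)) ≤ lnormW q (fun x => w x ^ q) (Walpha α f) ∧
      lnormW p (fun x => w x ^ p) (fun x => ENNReal.ofReal |f x|) ≤ ENNReal.ofReal (1 * δ ^ (-1 / p)) := by
  have P := mkParams hα hα1 hp hpα hq
  obtain ⟨r, hr⟩ : ∃ r, r = p / (p - 1) := ⟨_, rfl⟩
  simp only [apqPlusChar]
  rw [← hr] at P ⊢
  have hp0 := P.hpr.pos
  have hq0 := P.hqe.pos
  have hr0 := P.hpr.symm.pos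
  have h1p : 0 < 1 - α * p := by
    rw [lt_div_iff₀ hα] at hpα; linarith
  have hqi : q⁻¹ = p⁻¹ - α := by rw [hq]; field_simp
  have hri : r⁻¹ = 1 - p⁻¹ := by have := P.hpr.inv_add_inv_eq_one; linarith
  have hqq : q⁻¹ * q = 1 := inv_mul_cancel₀ hq0.ne'
  have hpp : p⁻¹ * p = 1 := inv_mul_cancel₀ hp0.ne'
  have hrr : r⁻¹ * r = 1 := inv_mul_cancel₀ hr0.ne'
  obtain ⟨θ, hθ⟩ : ∃ θ, θ = (1 - δ) * r⁻¹ := ⟨_, rfl⟩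
  have hθ0 : 0 ≤ θ := by rw [hθ]; exact mul_nonneg (by linarith) (by positivity)
  refine ⟨fun x => |x| ^ θ, (Ioo (0:ℝ) 1).indicator (fun t => t ^ (δ - 1)), ?_, ?_, ?_, ?_⟩
  · have := weight_pow (b := θ + 1) (by linarith)
    rwa [add_sub_cancel_right] at this
  · refine iSup_le fun x => iSup_le fun h => iSup_le fun hh => ?_
    have hR : 0 < |x| + h := by linarith [abs_nonneg x]
    have e1 : ∀ t : ℝ, (|t| ^ θ) ^ q = |t| ^ (θ * q) := fun t => (Real.rpow_mul (abs_nonneg t) _ _).symm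
    have e2 : ∀ t : ℝ, (|t| ^ θ) ^ (-r) = |t| ^ (δ - 1) := fun t => by
      rw [← Real.rpow_mul (abs_nonneg t)]; congr 1
      rw [hθ, mul_neg, mul_assoc, hrr]; ring
    simp only [e1, e2]
    have a1 := avg_up (b := θ * q) (x := x) (h := h) (c := x - h) (by positivity) hh (Or.inr rfl)
    rw [sub_add_cancel] at a1
    have a2 := avg_dn (x := x) (h := h) (c := x) hδ hδ1 hh (Or.inl rfl)
    calc _ ≤ ENNReal.ofReal ((|x| + h) ^ (θ * q)) * ENNReal.ofReal (6 / δ * (|x| + h) ^ (δ - 1)) ^ (q / r) := by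
          gcongr
      _ = _ := by
          rw [ENNReal.ofReal_rpow_of_nonneg (by positivity) (by positivity), ← ENNReal.ofReal_mul (by positivity)]
          congr 1
          rw [Real.mul_rpow (by positivity) (by positivity), ← Real.rpow_mul hR.le, mul_left_comm, ← Real.rpow_add hR]
          have : θ * q + (δ - 1) * (q / r) = 0 := by rw [hθ]; field_simp; ring
          rw [this, Real.rpow_zero, mul_one, Real.div_rpow (by norm_num) hδ.le, Real.rpow_neg hδ.le]; rfl
  · have hb : 0 < δ * q / p := by positivity
    have hM : 0 ≤ (2:ℝ) ^ (α - 1) / δ := by positivity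
    have hab : (α - 1 + δ + θ) * q = δ * q / p - 1 := by
      rw [hθ, hri]
      have : (α - 1 + δ + (1 - δ) * (1 - p⁻¹)) = -q⁻¹ + δ * p⁻¹ := by rw [hqi]; ring
      rw [this, add_mul, neg_mul, hqq]; ring
    refine le_trans (le_of_eq ?_) (lnorm_lower (q := q) (θ := θ) (a := α - 1 + δ) (b := δ * q / p) (ρ := 1)
      hq0 hb hM zero_le_one hab ?_)
    · congr 1
      have : (1:ℝ) / (δ * q / p) = p / q * δ ^ (-1:ℝ) := by rw [Real.rpow_neg_one]; field_simp
      rw [Real.one_rpow, this, Real.mul_rpow (by positivity) (by positivity), ← Real.rpow_mul hδ.le,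
        show (-1 - 1 / q) = -1 + -1 * (1 / q) by ring, Real.rpow_add hδ, Real.rpow_neg_one]
      ring
    · intro x hx
      have hx0 : 0 < |x| := abs_pos.2 hx.2.ne
      have hxa : |x| = -x := abs_of_neg hx.2
      rw [Walpha]
      have hsub : Ioo 0 |x| ⊆ Ioi x := fun t ht => hx.2.trans ht.1
      refine le_trans ?_ (lintegral_mono_set hsub)
      have hle : ∫⁻ t in Ioo 0 |x|, ENNReal.ofReal ((2 * |x|) ^ (α - 1)) * ENNReal.ofReal (|t| ^ (δ - 1)) ≤
          ∫⁻ t in Ioo 0 |x|, ENNReal.ofReal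
            (|(Ioo (0:ℝ) 1).indicator (fun t => t ^ (δ - 1)) t| * (t - x) ^ (α - 1)) := by
        refine setLIntegral_mono' measurableSet_Ioo fun t ht => ?_
        have ht0 := ht.1
        have htx := ht.2
        have hx1 := hx.1
        rw [indicator_of_mem (show t ∈ Ioo (0:ℝ) 1 from ⟨ht0, by linarith⟩),
          abs_of_pos (Real.rpow_pos_of_pos ht0 (δ - 1)), abs_of_pos ht0, ← ENNReal.ofReal_mul (by positivity), mul_comm]
        apply ENNReal.ofReal_le_ofReal
        refine mul_le_mul_of_nonneg_left ?_ (by positivity)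
        exact Real.rpow_le_rpow_of_nonpos (by linarith) (by linarith) (by linarith)
      refine le_trans (le_of_eq ?_) hle
      rw [lintegral_const_mul _ (by fun_prop), int_pow_pos hδ hx0.le, ← ENNReal.ofReal_mul (by positivity)]
      congr 1
      rw [Real.mul_rpow (by norm_num) hx0.le, Real.rpow_add hx0]; ring
  · rw [lnorm_test (θ := θ) (a := δ - 1) (b := δ) hp0 hδ]
    · apply le_of_eq; congr 1
      rw [one_mul, one_div, Real.inv_rpow hδ.le, ← Real.rpow_neg hδ.le]; congr 1; ring
    · rw [hθ, hri]
      have : (δ - 1 + (1 - δ) * (1 - p⁻¹)) * p = (δ - 1) * (p⁻¹ * p) := by ring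
      rw [this, hpp, mul_one]

lemma famB (p q α : ℝ) (hα : 0 < α) (hα1 : α < 1) (hp : 1 < p) (hpα : p < 1 / α)
    (hq : q = p / (1 - α * p)) (δ : ℝ) (hδ : 0 < δ) (hδ1 : δ < 1) :
    ∃ w f : ℝ → ℝ, IsWeight w ∧
      apqPlusChar p q w ≤ ENNReal.ofReal (6 * δ ^ (-(1:ℝ))) ∧
      ENNReal.ofReal (2 ^ (α - 1) / 2 * (1 / 2) ^ (1 / q) * δ ^ (-1 - 1 / q)) ≤
        lnormW q (fun x => w x ^ q) (Walpha α f) ∧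
      lnormW p (fun x => w x ^ p) (fun x => ENNReal.ofReal |f x|) ≤
        ENNReal.ofReal ((q / p) ^ (1 / p) * δ ^ (-1 / p)) := by
  have P := mkParams hα hα1 hp hpα hq
  obtain ⟨r, hr⟩ : ∃ r, r = p / (p - 1) := ⟨_, rfl⟩
  simp only [apqPlusChar]
  rw [← hr] at P ⊢
  have hp0 := P.hpr.pos
  have hq0 := P.hqe.pos
  have hq1 := P.hqe.lt
  have hr0 := P.hpr.symm.pos
  have h1p : 0 < 1 - α * p := by
    rw [lt_div_iff₀ hα] at hpα; linarith
  have hqi : q⁻¹ = p⁻¹ - α := by rw [hq]; field_simp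
  have hqq : q⁻¹ * q = 1 := inv_mul_cancel₀ hq0.ne'
  have hpp : p⁻¹ * p = 1 := inv_mul_cancel₀ hp0.ne'
  have hqi0 : 0 < q⁻¹ := by positivity
  have hqi1 : q⁻¹ < 1 := inv_lt_one_of_one_lt₀ hq1
  obtain ⟨θ, hθ⟩ : ∃ θ, θ = (δ - 1) * q⁻¹ := ⟨_, rfl⟩
  have hθq : θ * q = δ - 1 := by rw [hθ, mul_assoc, hqq, mul_one]
  refine ⟨fun x => |x| ^ θ, (Ioo (0:ℝ) 1).indicator (fun t => t ^ (-α)), ?_, ?_, ?_, ?_⟩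
  · have := weight_pow (b := θ + 1) (by rw [hθ]; nlinarith)
    rwa [add_sub_cancel_right] at this
  · refine iSup_le fun x => iSup_le fun h => iSup_le fun hh => ?_
    have hR : 0 < |x| + h := by linarith [abs_nonneg x]
    have e1 : ∀ t : ℝ, (|t| ^ θ) ^ q = |t| ^ (δ - 1) := fun t => by
      rw [← Real.rpow_mul (abs_nonneg t), hθq]
    have e2 : ∀ t : ℝ, (|t| ^ θ) ^ (-r) = |t| ^ (θ * (-r)) := fun t => (Real.rpow_mul (abs_nonneg t) _ _).symm
    have hb : 0 ≤ θ * (-r) := by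
      rw [hθ]
      have : 0 ≤ (1 - δ) * q⁻¹ * r := by
        have : 0 < 1 - δ := by linarith
        positivity
      linarith
    simp only [e1, e2]
    have a1 := avg_dn (x := x) (h := h) (c := x - h) hδ hδ1 hh (Or.inr rfl)
    rw [sub_add_cancel] at a1
    have a2 := avg_up (b := θ * (-r)) (x := x) (h := h) (c := x) hb hh (Or.inl rfl)
    calc _ ≤ ENNReal.ofReal (6 / δ * (|x| + h) ^ (δ - 1)) * ENNReal.ofReal ((|x| + h) ^ (θ * (-r))) ^ (q / r) := by
          gcongr
      _ = _ := by
          rw [ENNReal.ofReal_rpow_of_nonneg (by positivity) (by positivity), ← ENNReal.ofReal_mul (by positivity)]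
          congr 1
          rw [← Real.rpow_mul hR.le, mul_assoc, ← Real.rpow_add hR]
          have : δ - 1 + θ * -r * (q / r) = 0 := by rw [← hθq]; field_simp; ring
          rw [this, Real.rpow_zero, mul_one, Real.rpow_neg_one]; rfl
  · have hM : 0 ≤ (2:ℝ) ^ (α - 1) / 2 / δ := by positivity
    have hρ : 0 < (1 / 2 : ℝ) ^ (1 / δ) := by positivity
    have hρ1 : (1 / 2 : ℝ) ^ (1 / δ) ≤ 1 := Real.rpow_le_one (by norm_num) (by norm_num) (by positivity)
    have hρδ : ((1 / 2 : ℝ) ^ (1 / δ)) ^ δ = 1 / 2 := by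
      rw [← Real.rpow_mul (by norm_num), one_div_mul_cancel hδ.ne', Real.rpow_one]
    obtain ⟨ρ, hρe⟩ : ∃ ρ, ρ = (1 / 2 : ℝ) ^ (1 / δ) := ⟨_, rfl⟩
    rw [← hρe] at hρ hρ1 hρδ
    refine le_trans (le_of_eq ?_) (lnorm_lower (q := q) (θ := θ) (a := 0) (b := δ) (ρ := ρ)
      hq0 hδ hM hρ.le (by rw [zero_add, hθq]) ?_)
    · congr 1
      have : (1:ℝ) / 2 / δ = 1 / 2 * δ ^ (-1:ℝ) := by rw [Real.rpow_neg_one]; field_simp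
      rw [hρδ, this, Real.mul_rpow (by positivity) (by positivity), ← Real.rpow_mul hδ.le,
        show (-1 - 1 / q) = -1 + -1 * (1 / q) by ring, Real.rpow_add hδ, Real.rpow_neg_one]
      ring
    · intro x hx
      have hx0 : 0 < |x| := abs_pos.2 hx.2.ne
      have hxa : |x| = -x := abs_of_neg hx.2
      have hxρ : |x| ≤ ρ := by rw [hxa]; linarith [hx.1]
      rw [Walpha]
      have hsub : Ioo |x| 1 ⊆ Ioi x := fun t ht => hx.2.trans (hx0.trans ht.1)
      refine le_trans ?_ (lintegral_mono_set hsub)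
      have hle : ∫⁻ t in Ioo |x| 1, ENNReal.ofReal (2 ^ (α - 1)) * ENNReal.ofReal (t ^ (δ - 1)) ≤
          ∫⁻ t in Ioo |x| 1, ENNReal.ofReal
            (|(Ioo (0:ℝ) 1).indicator (fun t => t ^ (-α)) t| * (t - x) ^ (α - 1)) := by
        refine setLIntegral_mono' measurableSet_Ioo fun t ht => ?_
        have ht0 : 0 < t := hx0.trans ht.1
        have htx := ht.1
        rw [indicator_of_mem (show t ∈ Ioo (0:ℝ) 1 from ⟨ht0, ht.2⟩), abs_of_pos (by positivity),
          ← ENNReal.ofReal_mul (by positivity)]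
        apply ENNReal.ofReal_le_ofReal
        calc (2:ℝ) ^ (α - 1) * t ^ (δ - 1) ≤ 2 ^ (α - 1) * t ^ (-1 : ℝ) := by
              refine mul_le_mul_of_nonneg_left ?_ (by positivity)
              exact Real.rpow_le_rpow_of_exponent_ge ht0 ht.2.le (by linarith)
          _ = t ^ (-α) * (2 * t) ^ (α - 1) := by
              rw [Real.mul_rpow (by norm_num) ht0.le, mul_left_comm, ← Real.rpow_add ht0]
              congr 2; ring
          _ ≤ _ := by
              refine mul_le_mul_of_nonneg_left ?_ (by positivity)
              exact Real.rpow_le_rpow_of_nonpos (by linarith) (by linarith) (by linarith)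
      refine le_trans ?_ hle
      rw [lintegral_const_mul _ (by fun_prop), setLIntegral_congr Ioo_ae_eq_Ioc,
        int_pow hδ hx0.le (hxρ.trans hρ1), ← ENNReal.ofReal_mul (by positivity)]
      apply ENNReal.ofReal_le_ofReal
      have : |x| ^ δ ≤ 1 / 2 := by
        rw [← hρδ]; exact Real.rpow_le_rpow hx0.le hxρ hδ.le
      rw [Real.rpow_zero, Real.one_rpow, mul_one]
      calc (2:ℝ) ^ (α - 1) / 2 / δ = 2 ^ (α - 1) * ((1 / 2) / δ) := by ring
        _ ≤ _ := by gcongr; linarith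
  · rw [lnorm_test (θ := θ) (a := -α) (b := δ * p / q) hp0 (by positivity)]
    · apply le_of_eq; congr 1
      have : (1:ℝ) / (δ * p / q) = q / p * δ ^ (-1:ℝ) := by rw [Real.rpow_neg_one]; field_simp
      rw [this, Real.mul_rpow (by positivity) (by positivity), ← Real.rpow_mul hδ.le]
      congr 2; ring
    · rw [hθ]
      have h3 : -α + (δ - 1) * q⁻¹ = -p⁻¹ + δ * q⁻¹ := by
        have : p⁻¹ = q⁻¹ + α := by linarith
        rw [this]; ring
      rw [h3, add_mul, neg_mul, hpp]; ring

theorem stmt14 (p q α : ℝ) (hα : 0 < α) (hα1 : α < 1) (hp : 1 < p) (hpα : p < 1 / α)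
    (hq : q = p / (1 - α * p)) :
    (∃ c : ℝ, 0 < c ∧
      ∀ w : ℝ → ℝ, IsWeight w → apqPlusChar p q w ≠ ∞ →
        ∀ f : ℝ → ℝ,
          lnormW q (fun x => w x ^ q) (Walpha α f) ≤
            ENNReal.ofReal c *
                apqPlusChar p q w ^ ((1 - α) * max 1 ((p / (p - 1)) / q)) *
              lnormW p (fun x => w x ^ p) (fun x => ENNReal.ofReal |f x|)) ∧
    (∀ β : ℝ, β < (1 - α) * max 1 ((p / (p - 1)) / q) →
      ¬ ∃ c : ℝ, 0 < c ∧
        ∀ w : ℝ → ℝ, IsWeight w → apqPlusChar p q w ≠ ∞ →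
          ∀ f : ℝ → ℝ,
            lnormW q (fun x => w x ^ q) (Walpha α f) ≤
              ENNReal.ofReal c * apqPlusChar p q w ^ β *
                lnormW p (fun x => w x ^ p) (fun x => ENNReal.ofReal |f x|)) := by
  have P := mkParams hα hα1 hp hpα hq
  have hp0 := P.hpr.pos
  have hq0 := P.hqe.pos
  have hr0 := P.hpr.symm.pos
  refine ⟨?_, ?_⟩
  · obtain ⟨c, hc, h⟩ := upper p q α hα hα1 hp hpα hq
    exact ⟨c, hc, fun w hw hf => (h w hw hf).2⟩
  · intro β hβ
    have ha : 0 < 1 - α := by linarith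
    rcases le_total 1 ((p / (p - 1)) / q) with h | h
    · rw [max_eq_right h] at hβ
      refine sharp_abs p q α hα hα1 hp hpα hq (γ := (1 - α) * ((p / (p - 1)) / q)) (κ := q / (p / (p - 1)))
        (C1 := 6 ^ (q / (p / (p - 1)))) (A1 := 2 ^ (α - 1) * (p / q) ^ (1 / q)) (A2 := 1) (by positivity)
        (by positivity) ?_ (by positivity) (by positivity) one_pos (famA p q α hα hα1 hp hpα hq) β hβ
      generalize p / (p - 1) = r at *
      field_simp
    · rw [max_eq_left h, mul_one] at hβ
      exact sharp_abs p q α hα hα1 hp hpα hq (γ := 1 - α) (κ := 1)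
        (C1 := 6) (A1 := 2 ^ (α - 1) / 2 * (1 / 2) ^ (1 / q)) (A2 := (q / p) ^ (1 / p)) ha
        one_pos (by ring) (by norm_num) (by positivity) (by positivity) (famB p q α hα hα1 hp hpα hq) β hβ

end
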